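/- arXiv:1111.0319 — 3 statements merged into one kernel-verified Lean document; each statement's English description precedes it below -/
import Mathlib

section
/- Let K be a field of characteristic 0 and let R, R₁, R₂ be unital PI-algebras over K such that T(R) = T(R₁)·T(R₂) (product of two-sided ideals in K⟨X⟩). If the codimension series c(R₁,t) and c(R₂,t) are both rational power series, then the codimension series c(R,t) is also a rational power series. -/
/-- The T-ideal of polynomial identities of a unital `K`-algebra `R`: the set of
elements of the free unital associative algebra `K⟨x₀,x₁,…⟩` on countably many
generators that vanish under every `K`-algebra homomorphism to `R`.  (It is a
two-sided ideal; here it is recorded as a `K`-subspace of the free algebra, and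
the product of two T-ideals below is the span of products, which agrees with the
product of two-sided ideals.) -/
noncomputable def Tideal (K : Type*) [Field K] (R : Type*) [Ring R] [Algebra K R] :
    Submodule K (FreeAlgebra K ℕ) :=
  ⨅ f : FreeAlgebra K ℕ →ₐ[K] R, LinearMap.ker f.toLinearMap

/-- `multilinearPart K n` is `P_n`, the subspace of the free algebra spanned by the
multilinear monomials `x_(σ 1) ⋯ x_(σ n)`, `σ ∈ S_n`. -/
noncomputable def multilinearPart (K : Type*) [Field K] (n : ℕ) :
    Submodule K (FreeAlgebra K ℕ) :=
  Submodule.span K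
    { w | ∃ σ : Equiv.Perm (Fin n),
        w = (List.ofFn fun i : Fin n => FreeAlgebra.ι K ((σ i : ℕ))).prod }

/-- The `n`-th codimension of a T-ideal `I`: `dim_K P_n/(P_n ∩ I)`. -/
noncomputable def codim (K : Type*) [Field K] (I : Submodule K (FreeAlgebra K ℕ))
    (n : ℕ) : ℕ :=
  Module.finrank K
    (↥(multilinearPart K n) ⧸ (I.comap (multilinearPart K n).subtype))

/-- The codimension series `c(I,t) = ∑ₙ cₙ(I) tⁿ ∈ ℂ⟦t⟧` of a T-ideal `I`. -/
noncomputable def codimSeries (K : Type*) [Field K]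
    (I : Submodule K (FreeAlgebra K ℕ)) : PowerSeries ℂ :=
  PowerSeries.mk fun n => (codim K I n : ℂ)

/-- A power series is rational if `q * a = p` for polynomials `p q` with `q 0 ≠ 0`. -/
def IsRationalPS (a : PowerSeries ℂ) : Prop :=
  ∃ p q : Polynomial ℂ, q.coeff 0 ≠ 0 ∧
    (q : PowerSeries ℂ) * a = (p : PowerSeries ℂ)

/-- A power series is algebraic over ℂ(t) if it is annihilated by a nonzero
polynomial `F(t,y) ∈ ℂ[t][y]`. -/
def IsAlgebraicPS (b : PowerSeries ℂ) : Prop :=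
  ∃ F : Polynomial (Polynomial ℂ), F ≠ 0 ∧
    Polynomial.eval₂ Polynomial.coeToPowerSeries.ringHom b F = 0

def FDps (f : PowerSeries ℂ) : Prop :=
  ∃ V : Submodule ℂ (PowerSeries ℂ), V.FG ∧ f ∈ V ∧
    ∀ v ∈ V, PowerSeries.derivative ℂ v ∈ V

lemma FDps.add {f g : PowerSeries ℂ} (hf : FDps f) (hg : FDps g) : FDps (f + g) := by
  obtain ⟨V, hV, hfV, hdV⟩ := hf
  obtain ⟨W, hW, hgW, hdW⟩ := hg
  refine ⟨V ⊔ W, hV.sup hW, Submodule.add_mem_sup hfV hgW, ?_⟩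
  intro v hv
  obtain ⟨a, ha, b, hb, rfl⟩ := Submodule.mem_sup.1 hv
  rw [map_add]
  exact Submodule.add_mem_sup (hdV a ha) (hdW b hb)

lemma FDps.mul {f g : PowerSeries ℂ} (hf : FDps f) (hg : FDps g) : FDps (f * g) := by
  obtain ⟨V, hV, hfV, hdV⟩ := hf
  obtain ⟨W, hW, hgW, hdW⟩ := hg
  refine ⟨V * W, hV.mul hW, Submodule.mul_mem_mul hfV hgW, ?_⟩
  intro v hv
  induction hv using Submodule.mul_induction_on' with
  | mem_mul_mem a ha b hb =>
    rw [Derivation.leibniz, smul_eq_mul, smul_eq_mul, mul_comm b]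
    exact add_mem (Submodule.mul_mem_mul ha (hdW b hb)) (Submodule.mul_mem_mul (hdV a ha) hb)
  | add a _ b _ iha ihb => rw [map_add]; exact add_mem iha ihb

lemma FDps.X_sub_one : FDps (PowerSeries.X - 1) := by
  refine ⟨Submodule.span ℂ {1, PowerSeries.X}, Submodule.fg_span (by simp), ?_, ?_⟩
  · exact sub_mem (Submodule.subset_span (by simp)) (Submodule.subset_span (by simp))
  · intro v hv
    induction hv using Submodule.span_induction with
    | mem x hx =>
      rcases hx with rfl | rfl
      · simp
      · rw [PowerSeries.derivative_X]
        exact Submodule.subset_span (by simp)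
    | zero => simp
    | add a b _ _ ha hb => rw [map_add]; exact add_mem ha hb
    | smul c a _ ha => rw [Derivation.map_smul]; exact Submodule.smul_mem _ _ ha

/-- exponential transform -/
noncomputable def EPS : PowerSeries ℂ →ₗ[ℂ] PowerSeries ℂ where
  toFun f := PowerSeries.mk fun n => PowerSeries.coeff n f / (n.factorial : ℂ)
  map_add' f g := by ext n; simp [add_div]
  map_smul' c g := by ext n; simp [mul_div_assoc]

noncomputable def SPS : PowerSeries ℂ →ₗ[ℂ] PowerSeries ℂ where
  toFun f := PowerSeries.mk fun n => PowerSeries.coeff (n+1) f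
  map_add' f g := by ext n; simp
  map_smul' c g := by ext n; simp

@[simp] lemma coeff_EPS (f : PowerSeries ℂ) (n : ℕ) :
    PowerSeries.coeff n (EPS f) = PowerSeries.coeff n f / (n.factorial : ℂ) := by
  simp [EPS]

@[simp] lemma coeff_SPS (f : PowerSeries ℂ) (n : ℕ) :
    PowerSeries.coeff n (SPS f) = PowerSeries.coeff (n+1) f := by
  simp [SPS]

lemma EPS_inj : Function.Injective EPS := by
  intro f g h
  ext n
  have := congrArg (PowerSeries.coeff n) h
  have hn : (n.factorial : ℂ) ≠ 0 := by exact_mod_cast n.factorial_ne_zero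
  simpa [div_left_inj' hn] using this

lemma EPS_SPS (f : PowerSeries ℂ) : PowerSeries.derivative ℂ (EPS f) = EPS (SPS f) := by
  ext n
  rw [PowerSeries.coeff_derivative]
  simp only [coeff_EPS, coeff_SPS, Nat.factorial_succ]
  have hn : (n.factorial : ℂ) ≠ 0 := by exact_mod_cast n.factorial_ne_zero
  have hn' : (n : ℂ) + 1 ≠ 0 := by exact_mod_cast n.succ_ne_zero
  push_cast
  field_simp

lemma coeff_SPS_pow (f : PowerSeries ℂ) (k n : ℕ) :
    PowerSeries.coeff n ((SPS ^ k) f) = PowerSeries.coeff (n+k) f := by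
  induction k generalizing n with
  | zero => simp
  | succ k ih => rw [pow_succ', Module.End.mul_apply, coeff_SPS, ih, show n + 1 + k = n + (k + 1) by ring]

lemma rational_of_shift (f : PowerSeries ℂ) (V : Submodule ℂ (PowerSeries ℂ)) (hV : V.FG)
    (hf : f ∈ V) (hS : ∀ v ∈ V, SPS v ∈ V) : IsRationalPS f := by
  have : Module.Finite ℂ V := Module.Finite.iff_fg.2 hV
  let T : Module.End ℂ V := SPS.restrict hS
  let χ := minpoly ℂ T
  have hmon : χ.Monic := minpoly.monic (Algebra.IsIntegral.isIntegral T)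
  have h0 : Polynomial.aeval T χ = 0 := minpoly.aeval ℂ T
  have hpow : ∀ k : ℕ, (((T ^ k) ⟨f, hf⟩ : V) : PowerSeries ℂ) = (SPS ^ k) f := by
    intro k
    induction k with
    | zero => rfl
    | succ k ih => rw [pow_succ', pow_succ', Module.End.mul_apply, Module.End.mul_apply, ← ih]; rfl
  have h1 : ∀ n, ∑ k ∈ Finset.range (χ.natDegree + 1), χ.coeff k * PowerSeries.coeff (n+k) f = 0 := by
    intro n
    have h2 := congrArg (fun L : Module.End ℂ V => PowerSeries.coeff n ((L ⟨f, hf⟩ : V) : PowerSeries ℂ)) h0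
    simp only [Polynomial.aeval_eq_sum_range, LinearMap.sum_apply, LinearMap.smul_apply,
      Submodule.coe_sum, Submodule.coe_smul, hpow, map_sum, LinearMap.zero_apply,
      Submodule.coe_zero, map_zero, PowerSeries.coeff_smul, coeff_SPS_pow] at h2
    simpa using h2
  set d := χ.natDegree with hd
  refine ⟨PowerSeries.trunc d ((χ.reverse : PowerSeries ℂ) * f), χ.reverse, ?_, ?_⟩
  · simp [hmon.leadingCoeff]
  · ext n
    rw [Polynomial.coeff_coe, PowerSeries.coeff_trunc]
    split_ifs with hn
    · rfl
    · push Not at hn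
      rw [PowerSeries.coeff_mul, Finset.Nat.sum_antidiagonal_eq_sum_range_succ
        (fun i j => PowerSeries.coeff i (χ.reverse : PowerSeries ℂ) * PowerSeries.coeff j f)]
      obtain ⟨e, rfl⟩ := Nat.exists_eq_add_of_le hn
      have h3 := h1 e
      rw [← Finset.sum_range_reflect] at h3
      rw [← h3]
      symm
      apply Finset.sum_subset_zero_on_sdiff
      · intro i; simp; omega
      · intro i hi
        simp at hi
        rw [Polynomial.coeff_coe, Polynomial.coeff_eq_zero_of_natDegree_lt, zero_mul]
        have := Polynomial.reverse_natDegree_le χ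
        omega
      · intro i hi
        simp at hi
        rw [Polynomial.coeff_coe, Polynomial.coeff_reverse, Polynomial.revAt_le (by omega)]
        rw [show d + 1 - 1 - i = d - i by omega, show e + (d - i) = d + e - i by omega]

lemma FDps_EPS_of_rational (f : PowerSeries ℂ) (h : IsRationalPS f) : FDps (EPS f) := by
  obtain ⟨p, q, hq, hpq⟩ := h
  let D := max p.natDegree q.natDegree
  let ψ : PowerSeries ℂ →ₗ[ℂ] PowerSeries ℂ := LinearMap.mulLeft ℂ (q : PowerSeries ℂ)
  let U : Submodule ℂ (PowerSeries ℂ) :=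
    (Polynomial.degreeLE ℂ D).map (Polynomial.coeToPowerSeries.algHom ℂ).toLinearMap
  have hUm : ∀ u, u ∈ U ↔ ∃ r : Polynomial ℂ, r.natDegree ≤ D ∧ (r : PowerSeries ℂ) = u := by
    intro u
    simp [U, Polynomial.mem_degreeLE, Polynomial.natDegree_le_iff_degree_le]
  have hU : U.FG := by
    apply Submodule.FG.map
    rw [Polynomial.degreeLE_eq_span_X_pow]
    exact ⟨_, rfl⟩
  have hqi : Function.Injective ψ := by
    intro a b hab
    have hq0 : (q : PowerSeries ℂ) ≠ 0 := by
      intro h0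
      apply hq
      have := congrArg (PowerSeries.coeff 0) h0
      simpa using this
    exact mul_left_cancel₀ hq0 hab
  have hV : (U.comap ψ).FG := by
    have : Module.Finite ℂ U := Module.Finite.iff_fg.2 hU
    have : Module.Finite ℂ (U.comap ψ) := by
      refine Module.Finite.of_injective (ψ.restrict (p := U.comap ψ) (q := U) (fun x hx => hx)) ?_
      intro a b hab
      apply Subtype.ext
      apply hqi
      exact congrArg Subtype.val hab
    exact Module.Finite.iff_fg.1 this
  refine ⟨(U.comap ψ).map EPS, hV.map _, ⟨f, ?_, rfl⟩, ?_⟩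
  · show (q : PowerSeries ℂ) * f ∈ U
    rw [hUm]
    exact ⟨p, le_max_left _ _, hpq.symm⟩
  · rintro _ ⟨v, hv, rfl⟩
    rw [EPS_SPS]
    refine ⟨SPS v, ?_, rfl⟩
    have hv' : (q : PowerSeries ℂ) * v ∈ U := hv
    show (q : PowerSeries ℂ) * SPS v ∈ U
    rw [hUm] at hv' ⊢
    obtain ⟨r, hr, hrv⟩ := hv'
    refine ⟨(r - Polynomial.C (PowerSeries.coeff 0 v) * q).divX, ?_, ?_⟩
    · rw [Polynomial.natDegree_divX_eq_natDegree_tsub_one]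
      refine (Nat.sub_le _ _).trans ((Polynomial.natDegree_sub_le _ _).trans (max_le hr ?_))
      exact (Polynomial.natDegree_C_mul_le _ _).trans (le_max_right _ _)
    · have hv2 : v = PowerSeries.C (PowerSeries.coeff 0 v) + PowerSeries.X * SPS v := by
        ext n
        cases n with
        | zero => simp
        | succ n => simp [PowerSeries.coeff_succ_X_mul]
      have : PowerSeries.X * ((r - Polynomial.C (PowerSeries.coeff 0 v) * q).divX : PowerSeries ℂ)
          = PowerSeries.X * ((q : PowerSeries ℂ) * SPS v) := by
        have h3 := Polynomial.X_mul_divX_add (r - Polynomial.C (PowerSeries.coeff 0 v) * q)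
        have h4 : (r - Polynomial.C (PowerSeries.coeff 0 v) * q).coeff 0 = 0 := by
          have := congrArg (PowerSeries.coeff 0) hrv
          simp [PowerSeries.coeff_mul] at this
          simp [this, mul_comm]
        rw [h4] at h3
        have h5 := congrArg (fun r : Polynomial ℂ => (r : PowerSeries ℂ)) h3
        simp only [map_zero, add_zero, Polynomial.coe_mul, Polynomial.coe_X, Polynomial.coe_sub,
          Polynomial.coe_C, hrv] at h5
        rw [h5]
        nth_rewrite 1 [hv2]
        ring
      exact mul_left_cancel₀ PowerSeries.X_ne_zero this

lemma rational_of_FDps_EPS (f : PowerSeries ℂ) (h : FDps (EPS f)) : IsRationalPS f := by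
  obtain ⟨V, hV, hfV, hd⟩ := h
  refine rational_of_shift f (V.comap EPS) ?_ hfV ?_
  · have : Module.Finite ℂ V := Module.Finite.iff_fg.2 hV
    have : Module.Finite ℂ (V.comap EPS) := by
      refine Module.Finite.of_injective (EPS.restrict (p := V.comap EPS) (q := V) (fun x hx => hx)) ?_
      intro a b hab
      apply Subtype.ext
      apply EPS_inj
      exact congrArg Subtype.val hab
    exact Module.Finite.iff_fg.1 this
  · intro v hv
    show EPS (SPS v) ∈ V
    rw [← EPS_SPS]
    exact hd _ hv

/-- numeric core -/
lemma rational_core (c c1 c2 i j r γ : ℕ → ℂ)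
    (hi : ∀ n, i n + c1 n = n.factorial) (hj : ∀ n, j n + c2 n = n.factorial)
    (hr : ∀ n, r n + c n = n.factorial)
    (hjγ : ∀ n, j n = ∑ k ∈ Finset.range (n+1), (n.choose k : ℂ) * (γ k * ((n-k).factorial : ℂ)))
    (hrγ : ∀ n, r n = ∑ k ∈ Finset.range (n+1), (n.choose k : ℂ) * (γ k * i (n-k)))
    (h1 : IsRationalPS (PowerSeries.mk c1)) (h2 : IsRationalPS (PowerSeries.mk c2)) :
    IsRationalPS (PowerSeries.mk c) := by
  have hfac : ∀ n : ℕ, (n.factorial : ℂ) ≠ 0 := fun n => by exact_mod_cast n.factorial_ne_zero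
  have key : ∀ (a b d : ℕ → ℂ), (∀ n, d n = ∑ k ∈ Finset.range (n+1), (n.choose k : ℂ) * (a k * b (n-k))) →
      EPS (PowerSeries.mk d) = EPS (PowerSeries.mk a) * EPS (PowerSeries.mk b) := by
    intro a b d h
    ext n
    rw [PowerSeries.coeff_mul, Finset.Nat.sum_antidiagonal_eq_sum_range_succ
        (fun i j => PowerSeries.coeff i (EPS (PowerSeries.mk a)) * PowerSeries.coeff j (EPS (PowerSeries.mk b)))]
    simp only [coeff_EPS, PowerSeries.coeff_mk, h n, Finset.sum_div]
    apply Finset.sum_congr rfl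
    intro k hk
    have hk' : k ≤ n := by simp at hk; omega
    rw [Nat.cast_choose ℂ hk']
    have := hfac n; have := hfac k; have := hfac (n-k)
    field_simp
  have e1 := key γ (fun n => (n.factorial : ℂ)) j hjγ
  have e2 := key γ i r hrγ
  set P := EPS (PowerSeries.mk fun n => (n.factorial : ℂ)) with hP
  have hP1 : (1 - PowerSeries.X) * P = 1 := by
    have : P = PowerSeries.mk 1 := by ext n; simp [hP, hfac n]
    rw [this, mul_comm, PowerSeries.mk_one_mul_one_sub_eq_one]
  have sumP : ∀ a b : ℕ → ℂ, (∀ n, a n + b n = n.factorial) →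
      EPS (PowerSeries.mk a) = P - EPS (PowerSeries.mk b) := by
    intro a b h
    rw [hP, ← map_sub]
    congr 1
    ext n
    simp [← h n]
  have e3 := sumP i c1 hi
  have e4 := sumP j c2 hj
  have e5 := sumP r c hr
  apply rational_of_FDps_EPS
  have : EPS (PowerSeries.mk c) = EPS (PowerSeries.mk c1) + EPS (PowerSeries.mk c2)
      + (PowerSeries.X - 1) * (EPS (PowerSeries.mk c1) * EPS (PowerSeries.mk c2)) := by
    have hγ : EPS (PowerSeries.mk γ) = (1 - PowerSeries.X) * (P - EPS (PowerSeries.mk c2)) := by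
      rw [← e4, e1]
      linear_combination (- EPS (PowerSeries.mk γ)) * hP1
    have hh : P - EPS (PowerSeries.mk c) = (1 - PowerSeries.X) * (P - EPS (PowerSeries.mk c2)) * (P - EPS (PowerSeries.mk c1)) := by
      rw [← e5, e2, hγ, e3]
    linear_combination (-1) * hh + (-P + EPS (PowerSeries.mk c1) + EPS (PowerSeries.mk c2)) * hP1
  rw [this]
  have f1 := FDps_EPS_of_rational _ h1
  have f2 := FDps_EPS_of_rational _ h2
  exact (f1.add f2).add (FDps.X_sub_one.mul (f1.mul f2))

section Words
variable (K : Type*) [Field K]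

local notation "FA" => FreeAlgebra K ℕ

/-- word basis of the free algebra -/
noncomputable def wb : Module.Basis (List ℕ) K (FreeAlgebra K ℕ) :=
  (FreeAlgebra.basisFreeMonoid K ℕ).reindex FreeMonoid.toList

lemma wb_apply (w : List ℕ) : wb K w = (w.map (FreeAlgebra.ι K)).prod := by
  simp only [wb, Module.Basis.reindex_apply, FreeAlgebra.basisFreeMonoid, Module.Basis.map_apply,
    Finsupp.coe_basisSingleOne]
  show FreeAlgebra.equivMonoidAlgebraFreeMonoid.symm (MonoidAlgebra.single (FreeMonoid.ofList w) 1) = _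
  simp [FreeAlgebra.equivMonoidAlgebraFreeMonoid, MonoidAlgebra.lift_single, FreeMonoid.lift_apply]

lemma wb_nil : wb K [] = 1 := by simp [wb_apply]
lemma wb_cons (x : ℕ) (w : List ℕ) : wb K (x :: w) = FreeAlgebra.ι K x * wb K w := by
  simp [wb_apply]
lemma wb_append (u v : List ℕ) : wb K (u ++ v) = wb K u * wb K v := by
  simp [wb_apply]

/-- multihomogeneous component -/
noncomputable def DD (m : Multiset ℕ) : Submodule K (FreeAlgebra K ℕ) :=
  Submodule.span K (wb K '' {w | (w : Multiset ℕ) = m})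

noncomputable def pr (m : Multiset ℕ) : FreeAlgebra K ℕ →ₗ[K] FreeAlgebra K ℕ :=
  (wb K).constr K fun w => if (w : Multiset ℕ) = m then wb K w else 0

lemma pr_wb (m : Multiset ℕ) (w : List ℕ) :
    pr K m (wb K w) = if (w : Multiset ℕ) = m then wb K w else 0 := by
  simp [pr]

variable {K}

lemma wb_induction {p : FA → Prop} (u : FA) (hz : p 0) (hw : ∀ w, p (wb K w))
    (ha : ∀ u v, p u → p v → p (u + v)) (hs : ∀ (c : K) u, p u → p (c • u)) : p u := by
  have : u ∈ Submodule.span K (Set.range (wb K)) := by simp [(wb K).span_eq]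
  induction this using Submodule.span_induction with
  | mem x hx => obtain ⟨w, rfl⟩ := hx; exact hw w
  | zero => exact hz
  | add a b _ _ iha ihb => exact ha _ _ iha ihb
  | smul c a _ iha => exact hs _ _ iha

lemma wb_mem (w : List ℕ) : wb K w ∈ DD K (w : Multiset ℕ) :=
  Submodule.subset_span ⟨w, rfl, rfl⟩

lemma pr_mem (m : Multiset ℕ) (u : FA) : pr K m u ∈ DD K m := by
  induction u using wb_induction with
  | hz => simp
  | hw w =>
    rw [pr_wb]
    split_ifs with h
    · rw [← h]; exact wb_mem w
    · simp
  | ha u v hu hv => rw [map_add]; exact add_mem hu hv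
  | hs c u hu => rw [map_smul]; exact Submodule.smul_mem _ _ hu

lemma pr_of_mem_eq {m B : Multiset ℕ} {u : FA} (hu : u ∈ DD K B) :
    pr K m u = if B = m then u else 0 := by
  induction hu using Submodule.span_induction with
  | mem x hx =>
    obtain ⟨w, hw, rfl⟩ := hx
    rw [pr_wb, show (w : Multiset ℕ) = B from hw]
  | zero => simp
  | add a b _ _ iha ihb => rw [map_add, iha, ihb]; split_ifs <;> simp
  | smul c a _ iha => rw [map_smul, iha]; split_ifs <;> simp

lemma DD_mul {A B : Multiset ℕ} {u v : FA} (hu : u ∈ DD K A) (hv : v ∈ DD K B) :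
    u * v ∈ DD K (A + B) := by
  have h : DD K A * DD K B ≤ DD K (A + B) := by
    unfold DD
    rw [Submodule.span_mul_span]
    apply Submodule.span_mono
    rintro _ ⟨_, ⟨a, ha, rfl⟩, _, ⟨b, hb, rfl⟩, rfl⟩
    refine ⟨a ++ b, ?_, wb_append K a b⟩
    have ha' : (a : Multiset ℕ) = A := ha
    have hb' : (b : Multiset ℕ) = B := hb
    show ((a ++ b : List ℕ) : Multiset ℕ) = A + B
    rw [← Multiset.coe_add, ha', hb']
  exact h (Submodule.mul_mem_mul hu hv)

lemma pr_mul {m B : Multiset ℕ} (u : FA) {g : FA} (hg : g ∈ DD K B) :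
    pr K m (u * g) = if B ≤ m then pr K (m - B) u * g else 0 := by
  induction u using wb_induction with
  | hz => simp
  | hw w =>
    rw [pr_of_mem_eq (DD_mul (wb_mem w) hg), pr_wb]
    by_cases hB : B ≤ m
    · rw [if_pos hB]
      have : ((w : Multiset ℕ) + B = m) ↔ ((w : Multiset ℕ) = m - B) :=
        (eq_tsub_iff_add_eq_of_le hB).symm
      simp only [this]
      split_ifs <;> simp
    · rw [if_neg hB, if_neg]
      rintro rfl
      exact hB (Multiset.le_add_left _ _)
  | ha u v hu hv => rw [add_mul, map_add, hu, hv, map_add]; split_ifs <;> simp [add_mul]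
  | hs c u hu => rw [smul_mul_assoc, map_smul, hu, map_smul]; split_ifs <;> simp

lemma ι_mem (x : ℕ) : FreeAlgebra.ι K x ∈ DD K {x} := by
  have := wb_mem (K := K) [x]
  rw [wb_cons, wb_nil, mul_one] at this
  exact this

lemma pr_ι_mul {m : Multiset ℕ} (x : ℕ) (u : FA) :
    pr K m (FreeAlgebra.ι K x * u) =
      if x ∈ m then FreeAlgebra.ι K x * pr K (m.erase x) u else 0 := by
  induction u using wb_induction with
  | hz => simp
  | hw w =>
    rw [← wb_cons, pr_wb, pr_wb]
    by_cases hx : x ∈ m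
    · rw [if_pos hx]
      have : (((x :: w : List ℕ) : Multiset ℕ) = m) ↔ ((w : Multiset ℕ) = m.erase x) := by
        rw [← Multiset.cons_coe]
        constructor
        · rintro rfl; simp
        · intro h; rw [h, Multiset.cons_erase hx]
      simp only [this]
      split_ifs <;> simp [wb_cons]
    · rw [if_neg hx, if_neg]
      rintro rfl
      simp at hx
  | ha u v hu hv => rw [mul_add, map_add, hu, hv, map_add]; split_ifs <;> simp [mul_add]
  | hs c u hu => rw [mul_smul_comm, map_smul, hu, map_smul]; split_ifs <;> simp

lemma exists_sum_pr (u : FA) : ∃ s : Finset (Multiset ℕ), ∀ t, s ⊆ t → ∑ m ∈ t, pr K m u = u := by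
  classical
  induction u using wb_induction with
  | hz => exact ⟨∅, by simp⟩
  | hw w =>
    refine ⟨{(w : Multiset ℕ)}, fun t ht => ?_⟩
    simp only [pr_wb]
    rw [Finset.sum_ite_eq, if_pos (ht (by simp))]
  | ha u v hu hv =>
    obtain ⟨s, hs⟩ := hu
    obtain ⟨s', hs'⟩ := hv
    refine ⟨s ∪ s', fun t ht => ?_⟩
    simp only [map_add, Finset.sum_add_distrib]
    rw [hs t (Finset.union_subset_left ht), hs' t (Finset.union_subset_right ht)]
  | hs c u hu =>
    obtain ⟨s, hs⟩ := hu
    refine ⟨s, fun t ht => ?_⟩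
    simp only [map_smul]
    rw [← Finset.smul_sum, hs t ht]

instance DD_finite (m : Multiset ℕ) : Module.Finite K (DD K m) := by
  apply Module.Finite.iff_fg.2
  apply Submodule.fg_span
  apply Set.Finite.image
  induction m using Quotient.inductionOn with
  | h l =>
    refine (List.finite_toSet l.permutations).subset ?_
    intro w hw
    have : (w : Multiset ℕ) = (l : Multiset ℕ) := hw
    simpa [List.mem_permutations] using this

instance inf_DD_finite (I : Submodule K FA) (m : Multiset ℕ) :
    Module.Finite K (I ⊓ DD K m : Submodule K FA) :=
  Submodule.finiteDimensional_of_le (inf_le_right : I ⊓ DD K m ≤ DD K m)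

/-- strip a letter on the left -/
noncomputable def dl (x : ℕ) : FreeAlgebra K ℕ →ₗ[K] FreeAlgebra K ℕ :=
  (wb K).constr K fun w => if w.head? = some x then wb K w.tail else 0

noncomputable def ep : FreeAlgebra K ℕ →ₗ[K] K := (wb K).coord []

lemma dl_ι_mul (x y : ℕ) (v : FA) :
    dl x (FreeAlgebra.ι K y * v) = if y = x then v else 0 := by
  induction v using wb_induction with
  | hz => simp
  | hw w => rw [← wb_cons]; simp [dl]
  | ha u v hu hv => rw [mul_add, map_add, hu, hv]; split_ifs <;> simp
  | hs c u hu => rw [mul_smul_comm, map_smul, hu]; split_ifs <;> simp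

lemma ep_nil : ep (wb K []) = 1 := by simp [ep]
lemma ep_cons (x : ℕ) (w : List ℕ) : ep (wb K (x :: w)) = 0 := by simp [ep]

lemma dl_mul (x : ℕ) (u v : FA) : dl x (u * v) = dl x u * v + ep u • dl x v := by
  induction u using wb_induction with
  | hz => simp
  | hw w =>
    cases w with
    | nil =>
      rw [ep_nil, wb_nil, one_mul, one_smul]
      have : dl x (1 : FA) = 0 := by rw [← wb_nil]; simp [dl]
      rw [this]; simp
    | cons y w =>
      rw [ep_cons, wb_cons, mul_assoc, dl_ι_mul, dl_ι_mul]
      split_ifs <;> simp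
  | ha u w hu hw => rw [add_mul, map_add, hu, hw, map_add, map_add, add_mul, add_smul]; abel
  | hs c u hu => rw [smul_mul_assoc, map_smul, hu, map_smul, map_smul, smul_add, smul_mul_assoc,
      smul_assoc]

lemma repr_dl (x : ℕ) (w : List ℕ) (u : FA) : (wb K).repr (dl x u) w = (wb K).repr u (x :: w) := by
  induction u using wb_induction with
  | hz => simp
  | hw v =>
    cases v with
    | nil => simp [dl]
    | cons y v =>
      rw [wb_cons, dl_ι_mul, ← wb_cons]
      by_cases h : y = x
      · subst h; simp [Finsupp.single_apply]
      · simp [h]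
  | ha u v hu hv => simp [hu, hv]
  | hs c u hu => simp [hu]

/-- F_+ J -/
def NN (J : Submodule K (FreeAlgebra K ℕ)) : Submodule K (FreeAlgebra K ℕ) :=
  Submodule.span K {u | ∃ x : ℕ, ∃ v ∈ J, u = FreeAlgebra.ι K x * v}

lemma mul_sub_mem_NN {J : Submodule K FA} (hJ : ∀ a, ∀ v ∈ J, a * v ∈ J) (u v : FA) (hv : v ∈ J) :
    u * v - ep u • v ∈ NN J := by
  induction u using wb_induction with
  | hz => simp
  | hw w =>
    cases w with
    | nil => rw [ep_nil, wb_nil]; simp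
    | cons y w =>
      rw [ep_cons, wb_cons, mul_assoc, zero_smul, sub_zero]
      exact Submodule.subset_span ⟨y, _, hJ _ _ hv, rfl⟩
  | ha u w hu hw =>
    rw [add_mul, map_add, add_smul]
    convert add_mem hu hw using 1
    abel
  | hs c u hu =>
    rw [smul_mul_assoc, map_smul, smul_assoc, ← smul_sub]
    exact Submodule.smul_mem _ _ hu

lemma pr_mem_NN {J : Submodule K FA} (hJh : ∀ m, ∀ v ∈ J, pr K m v ∈ J) (m : Multiset ℕ)
    (u : FA) (hu : u ∈ NN J) : pr K m u ∈ NN J := by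
  induction hu using Submodule.span_induction with
  | mem u hu =>
    obtain ⟨x, v, hv, rfl⟩ := hu
    rw [pr_ι_mul]
    split_ifs
    · exact Submodule.subset_span ⟨x, _, hJh _ _ hv, rfl⟩
    · simp
  | zero => simp
  | add a b _ _ iha ihb => rw [map_add]; exact add_mem iha ihb
  | smul c a _ iha => rw [map_smul]; exact Submodule.smul_mem _ _ iha

lemma exists_compl_family {E : Type*} [AddCommGroup E] [Module K E] (N W : Submodule K E)
    [Module.Finite K W] :
    ∃ (n : ℕ) (g : Fin n → E), (∀ j, g j ∈ W) ∧ (∀ u ∈ W, ∃ c : Fin n → K, u - ∑ j, c j • g j ∈ N) ∧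
      (∀ c : Fin n → K, ∑ j, c j • g j ∈ N → c = 0) := by
  let Q := W.map N.mkQ
  let b := Module.finBasis K Q
  have hb : ∀ j, ∃ v ∈ W, N.mkQ v = (b j : E ⧸ N) := fun j => (b j).2
  choose g hgW hg using hb
  refine ⟨_, g, hgW, ?_, ?_⟩
  · intro u hu
    refine ⟨b.repr ⟨N.mkQ u, u, hu, rfl⟩, ?_⟩
    rw [← Submodule.Quotient.mk_eq_zero, ← Submodule.mkQ_apply, map_sub, map_sum]
    simp only [map_smul, hg]
    have := congrArg Subtype.val (b.sum_repr ⟨N.mkQ u, u, hu, rfl⟩)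
    simp only [Submodule.coe_sum, Submodule.coe_smul] at this
    rw [this, sub_self]
  · intro c hc
    rw [← Submodule.Quotient.mk_eq_zero, ← Submodule.mkQ_apply, map_sum] at hc
    simp only [map_smul, hg] at hc
    have h2 : ∑ j, c j • b j = 0 := by
      apply Subtype.ext
      simpa using hc
    funext j
    exact Fintype.linearIndependent_iff.1 b.linearIndependent c h2 j

theorem exists_gens (J : Submodule K (FreeAlgebra K ℕ)) (hJ : ∀ a, ∀ v ∈ J, a * v ∈ J)
    (hJh : ∀ m, ∀ v ∈ J, pr K m v ∈ J) :
    ∃ (n : Multiset ℕ → ℕ) (g : (Σ B, Fin (n B)) → FreeAlgebra K ℕ),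
      (∀ i, g i ∈ J) ∧ (∀ i, g i ∈ DD K i.1) ∧ LinearIndependent FA g ∧
      ∀ u ∈ J, u ∈ Submodule.span FA (Set.range g) := by
  classical
  choose n g hg1 hg2 hg3 using fun m => exists_compl_family (NN J) (J ⊓ DD K m)
  refine ⟨n, fun i => g i.1 i.2, fun i => (hg1 i.1 i.2).1, fun i => (hg1 i.1 i.2).2, ?_, ?_⟩
  · have step0 : ∀ p : (Σ B, Fin (n B)) →₀ FA,
        Finsupp.linearCombination FA (fun i : (Σ B, Fin (n B)) => g i.1 i.2) p = 0 →
        ∀ i, ep (p i) = 0 := by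
      intro p hp i
      obtain ⟨m, j⟩ := i
      have hN : ∑ i ∈ p.support, ep (p i) • g i.1 i.2 ∈ NN J := by
        have h1 : ∑ i ∈ p.support, (p i * g i.1 i.2 - ep (p i) • g i.1 i.2) ∈ NN J :=
          sum_mem fun i _ => mul_sub_mem_NN hJ _ _ (hg1 i.1 i.2).1
        rw [Finset.sum_sub_distrib] at h1
        rw [Finsupp.linearCombination_apply, Finsupp.sum] at hp
        simp only [smul_eq_mul] at hp
        rw [hp, zero_sub] at h1
        simpa using h1
      have h2 := pr_mem_NN hJh m _ hN
      have h3 : ∑ i ∈ p.support, ep (p i) • g i.1 i.2 =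
          ∑ i ∈ (insert m (p.support.image Sigma.fst)).sigma (fun B => (Finset.univ : Finset (Fin (n B)))),
            ep (p i) • g i.1 i.2 := by
        apply Finset.sum_subset
        · intro i hi
          simp only [Finset.mem_sigma, Finset.mem_univ, and_true]
          exact Finset.mem_insert_of_mem (Finset.mem_image_of_mem _ hi)
        · intro i _ hi
          rw [Finsupp.notMem_support_iff.1 hi]; simp
      rw [h3, map_sum, Finset.sum_sigma, Finset.sum_eq_single m] at h2
      · simp only [map_smul, pr_of_mem_eq (hg1 m _).2, if_true] at h2
        exact congrFun (hg3 m _ h2) j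
      · intro B _ hB
        apply Finset.sum_eq_zero
        intro j _
        rw [map_smul, pr_of_mem_eq (hg1 B j).2, if_neg hB, smul_zero]
      · intro h; exact absurd (Finset.mem_insert_self _ _) h
    have main : ∀ w : List ℕ, ∀ p : (Σ B, Fin (n B)) →₀ FA,
        Finsupp.linearCombination FA (fun i : (Σ B, Fin (n B)) => g i.1 i.2) p = 0 →
        ∀ i, (wb K).repr (p i) w = 0 := by
      intro w
      induction w with
      | nil => exact step0
      | cons x w ih =>
        intro p hp i
        rw [← repr_dl]
        have := ih (p.mapRange (dl x) (map_zero _)) ?_ i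
        · simpa using this
        · rw [Finsupp.linearCombination_apply, Finsupp.sum_mapRange_index (by simp)]
          have h1 := congrArg (dl x) hp
          rw [Finsupp.linearCombination_apply, Finsupp.sum, map_sum, map_zero] at h1
          rw [Finsupp.sum, ← h1]
          apply Finset.sum_congr rfl
          intro i _
          rw [smul_eq_mul, smul_eq_mul, dl_mul, step0 p hp i, zero_smul, add_zero]
    rw [linearIndependent_iff]
    intro p hp
    ext i : 1
    apply (wb K).repr.injective
    ext w
    simpa using main w p hp i
  · set L := Submodule.span FA (Set.range fun i : (Σ B, Fin (n B)) => g i.1 i.2) with hL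
    have hLs : ∀ (c : K) (u : FA), u ∈ L → c • u ∈ L := fun c u hu => by
      rw [← one_mul u, ← smul_mul_assoc, ← smul_eq_mul (c • (1 : FA))]
      exact L.smul_mem _ hu
    have hind : ∀ k, ∀ m : Multiset ℕ, Multiset.card m = k → ∀ u ∈ J, pr K m u ∈ L := by
      intro k
      induction k using Nat.strong_induction_on with
      | _ k ih =>
      intro m hm u hu
      obtain ⟨c, hc⟩ := hg2 m (pr K m u) ⟨hJh m u hu, pr_mem m u⟩
      have hN : ∀ v ∈ NN J, pr K m v ∈ L := by
        intro v hv
        induction hv using Submodule.span_induction with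
        | mem v hv =>
          obtain ⟨x, v, hv, rfl⟩ := hv
          rw [pr_ι_mul]
          split_ifs with hx
          · exact L.smul_mem _ (ih _ (by rw [← hm]; exact Multiset.card_erase_lt_of_mem hx) _ rfl v hv)
          · exact L.zero_mem
        | zero => simp
        | add a b _ _ iha ihb => rw [map_add]; exact add_mem iha ihb
        | smul c a _ iha => rw [map_smul]; exact hLs _ _ iha
      have hgL : ∑ j, c j • g m j ∈ L :=
        sum_mem fun j _ => hLs _ _ (Submodule.subset_span ⟨⟨m, j⟩, rfl⟩)
      have h1 := hN _ hc
      rw [map_sub, pr_of_mem_eq (pr_mem m u), if_pos rfl, map_sum] at h1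
      simp only [map_smul, pr_of_mem_eq (hg1 m _).2, if_true] at h1
      simpa using add_mem h1 hgL
    intro u hu
    obtain ⟨s, hs⟩ := exists_sum_pr u
    rw [← hs s subset_rfl]
    exact sum_mem fun m _ => hind _ m rfl u hu

theorem finrank_mul_inf (I J : Submodule K (FreeAlgebra K ℕ))
    (hI : ∀ a, ∀ v ∈ I, v * a ∈ I) (hIh : ∀ m, ∀ v ∈ I, pr K m v ∈ I)
    (n : Multiset ℕ → ℕ) (g : (Σ B, Fin (n B)) → FreeAlgebra K ℕ)
    (hg1 : ∀ i, g i ∈ J) (hg2 : ∀ i, g i ∈ DD K i.1) (hg3 : LinearIndependent FA g)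
    (hg4 : ∀ u ∈ J, u ∈ Submodule.span FA (Set.range g)) (m : Multiset ℕ) :
    Module.finrank K (I * J ⊓ DD K m : Submodule K FA) =
      ∑ B ∈ Finset.Iic m, n B * Module.finrank K (I ⊓ DD K (m - B) : Submodule K FA) := by
  classical
  let e : (Σ B : Finset.Iic m, Fin (n B)) → (Σ B, Fin (n B)) := fun i => ⟨i.1, i.2⟩
  have he : Function.Injective e := by
    rintro ⟨⟨B, hB⟩, j⟩ ⟨⟨B', hB'⟩, j'⟩ h
    simp only [e, Sigma.mk.injEq] at h
    obtain ⟨rfl, h⟩ := h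
    simpa using h
  let Φ : ((i : Σ B : Finset.Iic m, Fin (n B)) → (I ⊓ DD K (m - i.1) : Submodule K FA)) →ₗ[K] FA :=
    ∑ i, (LinearMap.mulRight K (g (e i))) ∘ₗ (Submodule.subtype _) ∘ₗ (LinearMap.proj i)
  have hΦ : ∀ c, Φ c = ∑ i, (c i : FA) * g (e i) := by
    intro c; simp [Φ]
  have hinj : Function.Injective Φ := by
    rw [← LinearMap.ker_eq_bot, LinearMap.ker_eq_bot']
    intro c hc
    rw [hΦ] at hc
    have := Fintype.linearIndependent_iff.1 (hg3.comp e he) (fun i => (c i : FA)) hc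
    funext i
    exact Subtype.ext (this i)
  have hrange : LinearMap.range Φ = I * J ⊓ DD K m := by
    apply le_antisymm
    · rintro _ ⟨c, rfl⟩
      rw [hΦ]
      refine sum_mem fun i _ => ⟨Submodule.mul_mem_mul (c i).2.1 (hg1 _), ?_⟩
      have := DD_mul (c i).2.2 (hg2 (e i))
      rwa [tsub_add_cancel_of_le (Finset.mem_Iic.1 i.1.2)] at this
    · rintro u ⟨hu, hum⟩
      have h1 : ∃ p : (Σ B, Fin (n B)) →₀ FA, (∀ i, p i ∈ I) ∧
          Finsupp.linearCombination FA g p = u := by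
        clear hum
        induction hu using Submodule.mul_induction_on' with
        | mem_mul_mem a ha b hb =>
          obtain ⟨q, hq⟩ := Finsupp.mem_span_range_iff_exists_finsupp.1 (hg4 b hb)
          refine ⟨a • q, fun i => hI _ _ ha, ?_⟩
          rw [map_smul, Finsupp.linearCombination_apply, hq, smul_eq_mul]
        | add a _ b _ iha ihb =>
          obtain ⟨p, hp, rfl⟩ := iha
          obtain ⟨q, hq, rfl⟩ := ihb
          exact ⟨p + q, fun i => add_mem (hp i) (hq i), map_add _ _ _⟩
      obtain ⟨p, hp, rfl⟩ := h1
      have h2 := pr_of_mem_eq (m := m) hum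
      rw [if_pos rfl] at h2
      rw [← h2, Finsupp.linearCombination_apply, Finsupp.sum, map_sum]
      refine sum_mem fun i _ => ?_
      rw [smul_eq_mul, pr_mul _ (hg2 i)]
      split_ifs with hB
      · refine ⟨Pi.single ⟨⟨i.1, Finset.mem_Iic.2 hB⟩, i.2⟩ ⟨pr K (m - i.1) (p i), hIh _ _ (hp i), pr_mem _ _⟩, ?_⟩
        rw [hΦ, Finset.sum_eq_single ⟨⟨i.1, Finset.mem_Iic.2 hB⟩, i.2⟩]
        · simp [e]
        · intro b _ hb
          simp [Pi.single_eq_of_ne hb]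
        · simp
      · exact zero_mem _
  rw [← hrange, LinearMap.finrank_range_of_inj hinj, Module.finrank_pi_fintype,
    Fintype.sum_sigma, ← Finset.sum_coe_sort (Finset.Iic m)
      (fun B => n B * Module.finrank K (I ⊓ DD K (m - B) : Submodule K FA))]
  apply Finset.sum_congr rfl
  intro B _
  show ∑ _x : Fin (n B), Module.finrank K (I ⊓ DD K (m - B) : Submodule K FA) = _
  rw [Finset.sum_const, Finset.card_univ, Fintype.card_fin, smul_eq_mul]

end Words

section TI
variable {K : Type*} [Field K]

local notation "FA" => FreeAlgebra K ℕ

lemma mem_Tideal {R : Type*} [Ring R] [Algebra K R] (u : FA) :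
    u ∈ Tideal K R ↔ ∀ f : FA →ₐ[K] R, f u = 0 := by
  simp [Tideal, Submodule.mem_iInf]

lemma Tideal_left {R : Type*} [Ring R] [Algebra K R] (a v : FA) (hv : v ∈ Tideal K R) :
    a * v ∈ Tideal K R := by
  rw [mem_Tideal] at *
  intro f; rw [map_mul, hv f, mul_zero]

lemma Tideal_right {R : Type*} [Ring R] [Algebra K R] (a v : FA) (hv : v ∈ Tideal K R) :
    v * a ∈ Tideal K R := by
  rw [mem_Tideal] at *
  intro f; rw [map_mul, hv f, zero_mul]

lemma Tideal_endo {R : Type*} [Ring R] [Algebra K R] (φ : FA →ₐ[K] FA) (v : FA)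
    (hv : v ∈ Tideal K R) : φ v ∈ Tideal K R := by
  rw [mem_Tideal] at *
  intro f; exact hv (f.comp φ)

lemma Tideal_pr [CharZero K] {R : Type*} [Ring R] [Algebra K R] (m : Multiset ℕ) (v : FA)
    (hv : v ∈ Tideal K R) : pr K m v ∈ Tideal K R := by
  classical
  rw [mem_Tideal] at *
  intro f
  rw [← Module.forall_dual_apply_eq_zero_iff K]
  intro l
  let Q : FA →ₗ[K] MvPolynomial ℕ K := (wb K).constr K fun w =>
    MvPolynomial.monomial (Multiset.toFinsupp (w : Multiset ℕ)) (l (f (wb K w)))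
  have h1 : ∀ u, MvPolynomial.coeff (Multiset.toFinsupp m) (Q u) = l (f (pr K m u)) := by
    intro u
    induction u using wb_induction with
    | hz => simp
    | hw w =>
      rw [pr_wb]
      simp only [Q, Module.Basis.constr_basis, MvPolynomial.coeff_monomial,
        EmbeddingLike.apply_eq_iff_eq]
      split_ifs <;> simp
    | ha u v hu hv => simp [hu, hv]
    | hs c u hu => simp [hu]
  have h2 : ∀ (x : ℕ → K) u, MvPolynomial.eval x (Q u) =
      l (FreeAlgebra.lift K (fun i => x i • f (FreeAlgebra.ι K i)) u) := by
    intro x u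
    induction u using wb_induction with
    | hz => simp
    | hw w =>
      simp only [Q, Module.Basis.constr_basis]
      have h5 : FreeAlgebra.lift K (fun i => x i • f (FreeAlgebra.ι K i)) (wb K w) =
          (w.map x).prod • f (wb K w) := by
        induction w with
        | nil => simp [wb_nil]
        | cons y w ih =>
          rw [wb_cons, map_mul, ih, map_mul, FreeAlgebra.lift_ι_apply, List.map_cons, List.prod_cons,
            smul_mul_smul_comm]
      have h6 : ∀ c : K, MvPolynomial.eval x (MvPolynomial.monomial
          (Multiset.toFinsupp (w : Multiset ℕ)) c) = (w.map x).prod * c := by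
        intro c
        rw [MvPolynomial.eval_monomial, mul_comm]
        congr 1
        have h7 := Finset.prod_multiset_map_count (w : Multiset ℕ) x
        rw [Multiset.map_coe, Multiset.prod_coe] at h7
        exact h7.symm
      rw [h5, h6, map_smul, smul_eq_mul]
    | ha u v hu hv => simp [hu, hv]
    | hs c u hu => simp [hu]
  have h3 : Q v = 0 := by
    apply MvPolynomial.funext
    intro x
    rw [h2, hv, map_zero, map_zero]
  rw [← h1, h3, MvPolynomial.coeff_zero]

/-- rename -/
noncomputable def ren (σ : ℕ → ℕ) : FreeAlgebra K ℕ →ₐ[K] FreeAlgebra K ℕ :=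
  FreeAlgebra.lift K (fun i => FreeAlgebra.ι K (σ i))

lemma ren_wb (σ : ℕ → ℕ) (w : List ℕ) : ren σ (wb K w) = wb K (w.map σ) := by
  induction w with
  | nil => simp [wb_nil]
  | cons x w ih => rw [wb_cons, map_mul, ih, List.map_cons, wb_cons]; simp [ren]

lemma ren_mem (σ : ℕ → ℕ) (m : Multiset ℕ) (u : FA) (hu : u ∈ DD K m) :
    ren σ u ∈ DD K (m.map σ) := by
  induction hu using Submodule.span_induction with
  | mem x hx =>
    obtain ⟨w, hw, rfl⟩ := hx
    have hw' : (w : Multiset ℕ) = m := hw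
    rw [ren_wb, ← hw', Multiset.map_coe]
    exact wb_mem _
  | zero => simp
  | add a b _ _ iha ihb => rw [map_add]; exact add_mem iha ihb
  | smul c a _ iha => rw [map_smul]; exact Submodule.smul_mem _ _ iha

lemma ren_ren (σ : Equiv.Perm ℕ) (u : FA) : ren σ.symm (ren σ u) = u := by
  induction u using wb_induction with
  | hz => simp
  | hw w => simp [ren_wb]
  | ha u v hu hv => simp [hu, hv]
  | hs c u hu => simp [hu]

lemma finrank_le_of_card (I : Submodule K FA) (hI : ∀ (φ : FA →ₐ[K] FA), ∀ v ∈ I, φ v ∈ I)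
    (S T : Finset ℕ) (h : S.card = T.card) :
    Module.finrank K (I ⊓ DD K S.val : Submodule K FA) ≤
      Module.finrank K (I ⊓ DD K T.val : Submodule K FA) := by
  obtain ⟨σ, rfl⟩ := Equiv.Perm.exists_map_finset_eq S T h
  have hmap : ∀ u ∈ (I ⊓ DD K S.val : Submodule K FA),
      (ren (K := K) σ).toLinearMap u ∈ (I ⊓ DD K (S.map σ.toEmbedding).val : Submodule K FA) := by
    intro u hu
    exact ⟨hI _ _ hu.1, ren_mem _ _ _ hu.2⟩
  refine LinearMap.finrank_le_finrank_of_injective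
    (f := (ren (K := K) σ).toLinearMap.restrict hmap) ?_
  intro a b hab
  apply Subtype.ext
  have h1 : ren (K := K) σ a = ren σ b := congrArg Subtype.val hab
  rw [← ren_ren σ (a : FA), h1, ren_ren]

lemma finrank_eq_of_card (I : Submodule K FA) (hI : ∀ (φ : FA →ₐ[K] FA), ∀ v ∈ I, φ v ∈ I)
    (S T : Finset ℕ) (h : S.card = T.card) :
    Module.finrank K (I ⊓ DD K S.val : Submodule K FA) =
      Module.finrank K (I ⊓ DD K T.val : Submodule K FA) :=
  le_antisymm (finrank_le_of_card I hI S T h) (finrank_le_of_card I hI T S h.symm)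

lemma ml_eq_range (n : ℕ) : multilinearPart K n = Submodule.span K
    (Set.range fun σ : Equiv.Perm (Fin n) => wb K (List.ofFn fun i => (σ i : ℕ))) := by
  unfold multilinearPart
  congr 1
  ext u
  simp only [Set.mem_ofPred_eq, Set.mem_range, wb_apply, List.map_ofFn]
  constructor
  · rintro ⟨σ, rfl⟩; exact ⟨σ, rfl⟩
  · rintro ⟨σ, rfl⟩; exact ⟨σ, rfl⟩

lemma finrank_ml (n : ℕ) : Module.finrank K (multilinearPart K n) = n.factorial := by
  rw [ml_eq_range, finrank_span_eq_card]
  · simp [Fintype.card_perm]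
  · apply (wb K).linearIndependent.comp
    intro σ τ h
    have := List.ofFn_injective h
    ext i
    exact congrFun this i

lemma ml_eq_DD (n : ℕ) : multilinearPart K n = DD K (Finset.range n).val := by
  rw [ml_eq_range, DD]
  congr 1
  ext u
  constructor
  · rintro ⟨σ, rfl⟩
    refine ⟨_, ?_, rfl⟩
    show ((List.ofFn fun i => (σ i : ℕ) : List ℕ) : Multiset ℕ) = (List.range n : Multiset ℕ)
    rw [Multiset.coe_eq_coe]
    have h := (Equiv.Perm.ofFn_comp_perm σ (fun i : Fin n => (i : ℕ)))
    have h2 : List.ofFn (fun i : Fin n => (i : ℕ)) = List.range n := by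
      apply List.ext_getElem <;> simp
    rw [h2] at h
    exact h
  · rintro ⟨w, hw, rfl⟩
    have hw' : (w : Multiset ℕ) = (List.range n : Multiset ℕ) := hw
    rw [Multiset.coe_eq_coe] at hw'
    have hlen : w.length = n := by simpa using hw'.length_eq
    have hnd : w.Nodup := hw'.nodup_iff.2 List.nodup_range
    subst hlen
    have hlt : ∀ i : Fin w.length, w.get i < w.length := fun i => by
      have := hw'.mem_iff.1 (List.get_mem w i)
      simpa using this
    have hinj : Function.Injective (fun i : Fin w.length => (⟨w.get i, hlt i⟩ : Fin w.length)) := by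
      intro a b hab
      exact hnd.injective_get (by simpa using hab)
    refine ⟨Equiv.ofBijective _ (Finite.injective_iff_bijective.1 hinj), ?_⟩
    simp

lemma codim_add (I : Submodule K FA) (n : ℕ) :
    Module.finrank K (I ⊓ DD K (Finset.range n).val : Submodule K FA) + codim K I n = n.factorial := by
  have : Module.Finite K (multilinearPart K n) := by rw [ml_eq_DD]; infer_instance
  have h := Submodule.finrank_quotient_add_finrank (I.comap (multilinearPart K n).subtype)
  rw [finrank_ml] at h
  rw [← h, codim, add_comm, ← ml_eq_DD]
  congr 1
  rw [inf_comm, ← Submodule.map_comap_subtype]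
  exact (Submodule.equivMapOfInjective _ (Submodule.subtype_injective _) _).finrank_eq.symm

lemma sum_Iic_val (S : Finset ℕ) (f : Multiset ℕ → ℕ) :
    ∑ B ∈ Finset.Iic S.val, f B = ∑ B ∈ S.powerset, f B.val := by
  symm
  refine Finset.sum_bij (fun B _ => B.val) ?_ ?_ ?_ ?_
  · intro B hB
    simpa [Finset.val_le_iff] using hB
  · intro a _ b _ h; exact Finset.val_inj.1 h
  · intro B hB
    have hB' : B ≤ S.val := by simpa using hB
    exact ⟨⟨B, Multiset.nodup_of_le hB' S.nodup⟩, by simpa [← Finset.val_le_iff] using hB', rfl⟩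
  · intro _ _; rfl

theorem combin (n : Multiset ℕ → ℕ) (j : Finset ℕ → ℕ) (hjc : ∀ S T, S.card = T.card → j S = j T)
    (h : ∀ S : Finset ℕ, j S = ∑ B ∈ S.powerset, n B.val * (S.card - B.card).factorial) (S : Finset ℕ) :
    n S.val = n (Finset.range S.card).val := by
  generalize hk : S.card = k
  induction k using Nat.strong_induction_on generalizing S with
  | _ k ih =>
  have key : ∀ T : Finset ℕ, T.card = k → j T = n T.val + ((∑ B ∈ T.powerset.erase T,
      n (Finset.range B.card).val * (T.card - B.card).factorial)) := by
    intro T hT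
    rw [h T, ← Finset.add_sum_erase _ _ (Finset.mem_powerset_self T)]
    simp only [Nat.sub_self, Nat.factorial_zero, mul_one, add_right_inj]
    apply Finset.sum_congr rfl
    intro B hB
    rw [Finset.mem_erase, Finset.mem_powerset] at hB
    rw [ih B.card (by rw [← hT]; exact Finset.card_lt_card (hB.2.ssubset_of_ne hB.1)) B rfl]
  have key2 : ∀ T : Finset ℕ, T.card = k → j T + n (Finset.range k).val = n T.val +
      ∑ l ∈ Finset.range (k+1), k.choose l • (n (Finset.range l).val * (k - l).factorial) := by
    intro T hT
    have := Finset.sum_powerset_apply_card (x := T) (fun l => n (Finset.range l).val * (k - l).factorial)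
    rw [hT] at this
    rw [key T hT, ← this, ← Finset.add_sum_erase _ _ (Finset.mem_powerset_self T), hT]
    simp only [Nat.sub_self, Nat.factorial_zero, mul_one]
    ring
  have e1 := key2 S hk
  have e2 := key2 (Finset.range k) (by simp)
  have e3 := hjc S (Finset.range k) (by simp [hk])
  omega

end TI

/-- If `T(R) = T(R₁)·T(R₂)` for unital PI-algebras `R, R₁, R₂` over a field of
characteristic 0, and the codimension series of `R₁` and `R₂` are rational, then
the codimension series of `R` is rational. -/
theorem codimSeries_isRational_of_Tideal_mul
    (K : Type*) [Field K] [CharZero K]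
    (R R₁ R₂ : Type*) [Ring R] [Algebra K R] [Ring R₁] [Algebra K R₁]
    [Ring R₂] [Algebra K R₂]
    (hPI : Tideal K R ≠ ⊥) (hPI₁ : Tideal K R₁ ≠ ⊥) (hPI₂ : Tideal K R₂ ≠ ⊥)
    (hT : Tideal K R = Tideal K R₁ * Tideal K R₂)
    (h₁ : IsRationalPS (codimSeries K (Tideal K R₁)))
    (h₂ : IsRationalPS (codimSeries K (Tideal K R₂))) :
    IsRationalPS (codimSeries K (Tideal K R)) := by
  classical
  obtain ⟨n, g, hg1, hg2, hg3, hg4⟩ := exists_gens (Tideal K R₂) Tideal_left Tideal_pr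
  have hd : ∀ S : Finset ℕ, Module.finrank K ((⊤ : Submodule K (FreeAlgebra K ℕ)) ⊓ DD K S.val :
      Submodule K (FreeAlgebra K ℕ)) = S.card.factorial := by
    intro S
    rw [finrank_eq_of_card ⊤ (by simp) S (Finset.range S.card) (by simp), top_inf_eq, ← ml_eq_DD,
      finrank_ml]
  have htop : (⊤ : Submodule K (FreeAlgebra K ℕ)) * Tideal K R₂ = Tideal K R₂ := by
    apply le_antisymm
    · rw [Submodule.mul_le]
      intro a _ b hb
      exact Tideal_left a b hb
    · intro b hb
      rw [← one_mul b]
      exact Submodule.mul_mem_mul trivial hb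
  have hJ : ∀ S : Finset ℕ, Module.finrank K (Tideal K R₂ ⊓ DD K S.val :
      Submodule K (FreeAlgebra K ℕ)) =
      ∑ B ∈ S.powerset, n B.val * (S.card - B.card).factorial := by
    intro S
    have := finrank_mul_inf ⊤ (Tideal K R₂) (by simp) (by simp) n g hg1 hg2 hg3 hg4 S.val
    rw [htop, sum_Iic_val] at this
    rw [this]
    apply Finset.sum_congr rfl
    intro B hB
    rw [← Finset.sdiff_val, hd, Finset.card_sdiff_of_subset (Finset.mem_powerset.1 hB)]
  have hn := combin n _ (fun S T h => finrank_eq_of_card (Tideal K R₂) Tideal_endo S T h) hJ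
  let γ : ℕ → ℕ := fun k => n (Finset.range k).val
  let i : ℕ → ℕ := fun k => Module.finrank K (Tideal K R₁ ⊓ DD K (Finset.range k).val :
      Submodule K (FreeAlgebra K ℕ))
  let j : ℕ → ℕ := fun k => Module.finrank K (Tideal K R₂ ⊓ DD K (Finset.range k).val :
      Submodule K (FreeAlgebra K ℕ))
  let r : ℕ → ℕ := fun k => Module.finrank K (Tideal K R ⊓ DD K (Finset.range k).val :
      Submodule K (FreeAlgebra K ℕ))
  have hjγ : ∀ k, j k = ∑ l ∈ Finset.range (k+1), k.choose l * (γ l * (k-l).factorial) := by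
    intro k
    have h := Finset.sum_powerset_apply_card (x := Finset.range k) (fun l => γ l * (k-l).factorial)
    simp only [Finset.card_range, smul_eq_mul] at h
    rw [← h]
    show Module.finrank K _ = _
    rw [hJ]
    apply Finset.sum_congr rfl
    intro B _
    rw [hn B, Finset.card_range]
  have hrγ : ∀ k, r k = ∑ l ∈ Finset.range (k+1), k.choose l * (γ l * i (k-l)) := by
    intro k
    have h := Finset.sum_powerset_apply_card (x := Finset.range k) (fun l => γ l * i (k-l))
    simp only [Finset.card_range, smul_eq_mul] at h
    rw [← h]
    show Module.finrank K _ = _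
    rw [hT, finrank_mul_inf (Tideal K R₁) (Tideal K R₂) Tideal_right Tideal_pr n g hg1 hg2 hg3 hg4,
      sum_Iic_val]
    apply Finset.sum_congr rfl
    intro B hB
    rw [hn B, ← Finset.sdiff_val, finrank_eq_of_card (Tideal K R₁) Tideal_endo _
      (Finset.range (k - B.card))]
    rw [Finset.card_sdiff_of_subset (Finset.mem_powerset.1 hB)]
    simp
  exact rational_core (fun k => codim K (Tideal K R) k) (fun k => codim K (Tideal K R₁) k)
    (fun k => codim K (Tideal K R₂) k) (fun k => i k) (fun k => j k) (fun k => r k) (fun k => γ k)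
    (fun k => by exact_mod_cast codim_add (Tideal K R₁) k)
    (fun k => by exact_mod_cast codim_add (Tideal K R₂) k)
    (fun k => by exact_mod_cast codim_add (Tideal K R) k)
    (fun k => by exact_mod_cast hjγ k)
    (fun k => by exact_mod_cast hrγ k) h₁ h₂
end

section
/- Let K be a field of characteristic 0 and let R, R₁, R₂ be unital PI-algebras over K such that T(R) = T(R₁)·T(R₂) (product of two-sided ideals in K⟨X⟩). If the codimension series c(R₁,t) is a rational power series and the codimension series c(R₂,t) is algebraic over ℂ(t), then the codimension series c(R,t) is also algebraic over ℂ(t). -/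
namespace CodimProof

set_option linter.unusedSectionVars false

open TensorProduct

/-- an algebra with a basis of words -/
class FB (K : Type*) (F : Type*) [Field K] [Ring F] [Algebra K F] where
  X : ℕ → F
  b : Module.Basis (List ℕ) K F
  hb : ∀ w, b w = (w.map X).prod

section Alg
variable {K : Type*} {F : Type*} [Field K] [Ring F] [Algebra K F] [FB K F]

/-- variables -/
def xi (K : Type*) (F : Type*) [Field K] [Ring F] [Algebra K F] [FB K F] (x : ℕ) : F :=
  FB.X K x

/-- words in the free algebra -/
noncomputable def wd (K : Type*) (F : Type*) [Field K] [Ring F] [Algebra K F] [FB K F] (w : List ℕ) : F :=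
  (w.map (xi K F)).prod

@[simp] lemma wd_nil : wd K F [] = 1 := rfl
@[simp] lemma wd_cons (x : ℕ) (w : List ℕ) : wd K F (x :: w) = xi K F x * wd K F w := by
  simp [wd]
lemma wd_append (u v : List ℕ) : wd K F (u ++ v) = wd K F u * wd K F v := by
  simp [wd]

/-- basis of words -/
noncomputable def wb (K : Type*) (F : Type*) [Field K] [Ring F] [Algebra K F] [FB K F] : Module.Basis (List ℕ) K (F) :=
  FB.b

@[simp] lemma wb_apply (w : List ℕ) : wb K F w = wd K F w := FB.hb w

lemma wd_ext {V : Type*} [AddCommMonoid V] [Module K V] {f g : F →ₗ[K] V}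
    (h : ∀ w, f (wd K F w) = g (wd K F w)) : f = g :=
  (wb K F).ext fun w => by simpa using h w

lemma tw_ext {V : Type*} [AddCommMonoid V] [Module K V]
    {f g : F ⊗[K] F →ₗ[K] V}
    (h : ∀ u v, f (wd K F u ⊗ₜ wd K F v) = g (wd K F u ⊗ₜ wd K F v)) : f = g :=
  ((wb K F).tensorProduct (wb K F)).ext fun ⟨u, v⟩ => by simpa using h u v

abbrev FF (K : Type*) (F : Type*) [Field K] [Ring F] [Algebra K F] := F ⊗[K] F

lemma fs_ext {V : Type*} [AddCommMonoid V] [Module K V]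
    {f g : (ℕ →₀ FF K F) →ₗ[K] V}
    (h : ∀ x u v, f (Finsupp.single x (wd K F u ⊗ₜ wd K F v)) = g (Finsupp.single x (wd K F u ⊗ₜ wd K F v))) :
    f = g := by
  refine Finsupp.lhom_ext' fun x => tw_ext fun u v => ?_
  simpa using h x u v

/-- left action -/
noncomputable def la (K : Type*) {F : Type*} [Field K] [Ring F] [Algebra K F] (p : F) : (ℕ →₀ FF K F) →ₗ[K] (ℕ →₀ FF K F) :=
  Finsupp.mapRange.linearMap (LinearMap.mulLeft K (p ⊗ₜ 1))

/-- right action -/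
noncomputable def ra (K : Type*) {F : Type*} [Field K] [Ring F] [Algebra K F] (q : F) : (ℕ →₀ FF K F) →ₗ[K] (ℕ →₀ FF K F) :=
  Finsupp.mapRange.linearMap (LinearMap.mulRight K (1 ⊗ₜ q))

@[simp] lemma la_single (p : F) (x z) :
    la K p (Finsupp.single x z) = Finsupp.single x ((p ⊗ₜ 1) * z) := by simp [la]
@[simp] lemma ra_single (p : F) (x z) :
    ra K p (Finsupp.single x z) = Finsupp.single x (z * (1 ⊗ₜ p)) := by simp [ra]

lemma la_mul (p q : F) (z) : la K (p * q) z = la K p (la K q z) := by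
  have : la K (p * q) = la K p ∘ₗ la K q := fs_ext fun x u v => by simp [mul_assoc]
  rw [this]; rfl

@[simp] lemma la_one (z : ℕ →₀ FF K F) : la K 1 z = z := by
  have : la K (1 : F) = LinearMap.id := fs_ext fun x u v => by simp
  rw [this]; rfl

lemma la_add (p q : F) : la K (p + q) = la K p + la K q :=
  fs_ext fun x u v => by simp [add_mul, TensorProduct.add_tmul]
lemma la_smul (c : K) (q : F) : la K (c • q) = c • la K q :=
  fs_ext fun x u v => by simp [TensorProduct.smul_tmul']
lemma ra_add (p q : F) : ra K (p + q) = ra K p + ra K q :=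
  fs_ext fun x u v => by simp [mul_add, TensorProduct.tmul_add]
lemma ra_smul (c : K) (q : F) : ra K (c • q) = c • ra K q :=
  fs_ext fun x u v => by simp

/-- la, bilinear -/
noncomputable def laL (K : Type*) (F : Type*) [Field K] [Ring F] [Algebra K F] [FB K F] :
    F →ₗ[K] (ℕ →₀ FF K F) →ₗ[K] (ℕ →₀ FF K F) where
  toFun := la K
  map_add' := la_add
  map_smul' := la_smul

/-- ra, bilinear -/
noncomputable def raL (K : Type*) (F : Type*) [Field K] [Ring F] [Algebra K F] [FB K F] :
    F →ₗ[K] (ℕ →₀ FF K F) →ₗ[K] (ℕ →₀ FF K F) where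
  toFun := ra K
  map_add' := ra_add
  map_smul' := ra_smul

/-- universal derivation on words -/
noncomputable def deltaW (K : Type*) (F : Type*) [Field K] [Ring F] [Algebra K F] [FB K F] : List ℕ → (ℕ →₀ FF K F)
  | [] => 0
  | x :: w => Finsupp.single x (1 ⊗ₜ wd K F w) + la K (xi K F x) (deltaW K F w)

/-- universal derivation -/
noncomputable def delta (K : Type*) (F : Type*) [Field K] [Ring F] [Algebra K F] [FB K F] : F →ₗ[K] (ℕ →₀ FF K F) :=
  (wb K F).constr K (deltaW K F)

lemma delta_wd (w : List ℕ) : delta K F (wd K F w) = deltaW K F w := by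
  rw [← wb_apply, delta, Module.Basis.constr_basis]

lemma delta_cons (x : ℕ) (w : List ℕ) : delta K F (xi K F x * wd K F w) =
    Finsupp.single x (1 ⊗ₜ wd K F w) + la K (xi K F x) (delta K F (wd K F w)) := by
  rw [← wd_cons, delta_wd, delta_wd, deltaW]

/-- components of the differential -/
noncomputable def DX (K : Type*) (F : Type*) [Field K] [Ring F] [Algebra K F] [FB K F] (x : ℕ) : FF K F →ₗ[K] FF K F :=
  LinearMap.mulRight K (xi K F x ⊗ₜ 1) - LinearMap.mulLeft K (1 ⊗ₜ xi K F x)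

lemma DX_tmul (x : ℕ) (p q : F) : DX K F x (p ⊗ₜ q) =
    (p * xi K F x) ⊗ₜ q - p ⊗ₜ (xi K F x * q) := by
  simp [DX]

/-- differential -/
noncomputable def dd (K : Type*) (F : Type*) [Field K] [Ring F] [Algebra K F] [FB K F] : (ℕ →₀ FF K F) →ₗ[K] FF K F :=
  Finsupp.lsum ℕ (DX K F)

@[simp] lemma dd_single (x z) : dd K F (Finsupp.single x z) = DX K F x z := by simp [dd]

lemma dd_la (p : F) (z) : dd K F (la K p z) = (p ⊗ₜ 1) * dd K F z := by
  have : dd K F ∘ₗ la K p = LinearMap.mulLeft K (p ⊗ₜ 1) ∘ₗ dd K F := fs_ext fun x u v => by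
    simp [DX_tmul, mul_sub, mul_assoc]
  simpa using LinearMap.congr_fun this z

lemma dd_ra (p : F) (z) : dd K F (ra K p z) = dd K F z * (1 ⊗ₜ p) := by
  have : dd K F ∘ₗ ra K p = LinearMap.mulRight K (1 ⊗ₜ p) ∘ₗ dd K F := fs_ext fun x u v => by
    simp [DX_tmul, sub_mul, mul_assoc]
  simpa using LinearMap.congr_fun this z

lemma dd_delta_wd (w : List ℕ) : dd K F (delta K F (wd K F w)) = wd K F w ⊗ₜ 1 - 1 ⊗ₜ wd K F w := by
  induction w with
  | nil => rw [delta_wd, deltaW]; simp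
  | cons x w ih =>
    rw [wd_cons, delta_cons, map_add, dd_la, ih, dd_single, DX_tmul]
    simp [mul_sub]

lemma dd_delta (f : F) : dd K F (delta K F f) = f ⊗ₜ 1 - 1 ⊗ₜ f := by
  have : dd K F ∘ₗ delta K F = (TensorProduct.mk K _ _).flip 1 - TensorProduct.mk K _ _ 1 :=
    wd_ext fun w => by simpa using dd_delta_wd w
  simpa using LinearMap.congr_fun this f

/-- homotopy -/
noncomputable def sL (K : Type*) (F : Type*) [Field K] [Ring F] [Algebra K F] [FB K F] : FF K F →ₗ[K] (ℕ →₀ FF K F) :=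
  TensorProduct.lift ((laL K F).compl₂ (delta K F))
/-- homotopy -/
noncomputable def sR (K : Type*) (F : Type*) [Field K] [Ring F] [Algebra K F] [FB K F] : FF K F →ₗ[K] (ℕ →₀ FF K F) :=
  TensorProduct.lift ((raL K F).flip ∘ₗ (delta K F))

lemma sL_tmul (p q : F) : sL K F (p ⊗ₜ q) = la K p (delta K F q) := by
  simp [sL, laL]
lemma sR_tmul (p q : F) : sR K F (p ⊗ₜ q) = ra K q (delta K F p) := by
  simp [sR, raL]

lemma sL_dd (z) : sL K F (dd K F z) = - z := by
  have : sL K F ∘ₗ dd K F = - LinearMap.id := fs_ext fun x u v => by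
    simp only [LinearMap.comp_apply, dd_single, DX_tmul, map_sub, sL_tmul, delta_cons, map_add,
      la_single, la_mul]
    simp
  simpa using LinearMap.congr_fun this z

lemma dd_inj {z z' : ℕ →₀ FF K F} (h : dd K F z = dd K F z') : z = z' := by
  have := congrArg (sL K F) h
  rwa [sL_dd, sL_dd, neg_inj] at this

/-- multiplication -/
noncomputable def mu (K : Type*) (F : Type*) [Field K] [Ring F] [Algebra K F] [FB K F] : FF K F →ₗ[K] F := LinearMap.mul' K _

@[simp] lemma mu_tmul (p q : F) : mu K F (p ⊗ₜ q) = p * q := by simp [mu]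

lemma dd_sL (z : FF K F) : dd K F (sL K F z) = (mu K F z) ⊗ₜ 1 - z := by
  induction z using TensorProduct.induction_on with
  | zero => simp
  | tmul p q => simp [sL_tmul, dd_la, dd_delta, mul_sub]
  | add a b ha hb => simp only [map_add, ha, hb, TensorProduct.add_tmul]; abel

lemma dd_sR (z : FF K F) : dd K F (sR K F z) = z - 1 ⊗ₜ (mu K F z) := by
  induction z using TensorProduct.induction_on with
  | zero => simp
  | tmul p q => simp [sR_tmul, dd_ra, dd_delta, sub_mul]
  | add a b ha hb => simp only [map_add, ha, hb, TensorProduct.tmul_add]; abel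

lemma delta_mul (p q : F) :
    delta K F (p * q) = la K p (delta K F q) + ra K q (delta K F p) := by
  apply dd_inj
  simp [dd_delta, dd_la, dd_ra, mul_sub, sub_mul]

lemma mu_DX (x : ℕ) (z : FF K F) : mu K F (DX K F x z) = 0 := by
  have : mu K F ∘ₗ DX K F x = 0 := tw_ext fun u v => by simp [DX_tmul, mul_assoc]
  simpa using LinearMap.congr_fun this z

lemma mu_dd (z) : mu K F (dd K F z) = 0 := by
  have : mu K F ∘ₗ dd K F = 0 := fs_ext fun x u v => by simp [mu_DX]
  simpa using LinearMap.congr_fun this z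

end Alg

section Exact
variable {K : Type*} {F : Type*} [Field K] [Ring F] [Algebra K F] [FB K F]
variable (I J : Submodule K F)

/-- the quotient map -/
noncomputable def qq : FF K F →ₗ[K] (F ⧸ I) ⊗[K] (F ⧸ J) := TensorProduct.map I.mkQ J.mkQ

/-- the quotient map, on finsupps -/
noncomputable def QQ : (ℕ →₀ FF K F) →ₗ[K] (ℕ →₀ (F ⧸ I) ⊗[K] (F ⧸ J)) :=
  Finsupp.mapRange.linearMap (qq I J)

omit [FB K F] in
@[simp] lemma qq_tmul (p q : F) : qq I J (p ⊗ₜ q) = I.mkQ p ⊗ₜ J.mkQ q := by simp [qq]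

omit [FB K F] in
@[simp] lemma QQ_single (x z) : QQ I J (Finsupp.single x z) = Finsupp.single x (qq I J z) := by
  simp [QQ]

omit [FB K F] in
lemma QQ_apply (z x) : QQ I J z x = qq I J (z x) := by simp [QQ]

omit [FB K F] in
lemma ker_qq : LinearMap.ker (qq I J) =
    LinearMap.range (LinearMap.lTensor F J.subtype) ⊔
    LinearMap.range (LinearMap.rTensor F I.subtype) := by
  refine TensorProduct.map_ker ?_ I.mkQ_surjective ?_ J.mkQ_surjective
  · exact LinearMap.exact_subtype_mkQ I
  · exact LinearMap.exact_subtype_mkQ J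

omit [FB K F] in
lemma qq_surj : Function.Surjective (qq I J) :=
  TensorProduct.map_surjective I.mkQ_surjective J.mkQ_surjective

omit [FB K F] in
lemma QQ_surj : Function.Surjective (QQ I J) := by
  intro z
  obtain ⟨g, hg⟩ := Function.Surjective.hasRightInverse (qq_surj I J)
  induction z using Finsupp.induction_linear with
  | zero => exact ⟨0, by simp⟩
  | add a b ha hb =>
    obtain ⟨a, rfl⟩ := ha
    obtain ⟨b, rfl⟩ := hb
    exact ⟨a + b, by simp⟩
  | single x z => exact ⟨Finsupp.single x (g z), by simp [hg z]⟩

omit [FB K F] in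
lemma inf_range : LinearMap.range (LinearMap.rTensor F I.subtype) ⊓
    LinearMap.range (LinearMap.lTensor F J.subtype) ≤
    LinearMap.range (TensorProduct.map I.subtype J.subtype) := by
  rintro z ⟨⟨a, rfl⟩, hz⟩
  have h1 : LinearMap.lTensor F J.mkQ (LinearMap.rTensor F I.subtype a) = 0 := by
    obtain ⟨b, hb⟩ := hz
    rw [← hb, ← LinearMap.comp_apply, ← LinearMap.lTensor_comp]
    have : J.mkQ ∘ₗ J.subtype = 0 := by ext; simp
    rw [this]; simp
  have h2 : LinearMap.rTensor (F ⧸ J) I.subtype (LinearMap.lTensor I J.mkQ a) = 0 := by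
    rw [← h1, ← LinearMap.comp_apply, ← LinearMap.comp_apply, LinearMap.rTensor_comp_lTensor,
      LinearMap.lTensor_comp_rTensor]
  have h3 : LinearMap.lTensor I J.mkQ a = 0 := by
    have := Module.Flat.rTensor_preserves_injective_linearMap (M := F ⧸ J) I.subtype
      I.injective_subtype
    exact this (by rw [h2, map_zero])
  have h4 := (lTensor_exact I (LinearMap.exact_subtype_mkQ J) J.mkQ_surjective a).1 h3
  obtain ⟨b, rfl⟩ := h4
  refine ⟨b, ?_⟩
  rw [← LinearMap.comp_apply, LinearMap.rTensor_comp_lTensor]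

variable (hI : ∀ a ∈ I, ∀ b, a * b ∈ I) (hJ : ∀ a ∈ J, ∀ b, b * a ∈ J)

include hI in
lemma DX_LI (x : ℕ) (z) (hz : z ∈ LinearMap.range (LinearMap.rTensor F I.subtype)) :
    DX K F x z ∈ LinearMap.range (LinearMap.rTensor F I.subtype) := by
  obtain ⟨z, rfl⟩ := hz
  induction z using TensorProduct.induction_on with
  | zero => simp
  | add a b ha hb => simpa using add_mem ha hb
  | tmul a b =>
    simp only [LinearMap.rTensor_tmul, DX_tmul]
    refine sub_mem ⟨⟨_, hI _ a.2 (xi K F x)⟩ ⊗ₜ b, by simp⟩ ⟨a ⊗ₜ (xi K F x * b), by simp⟩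

include hJ in
lemma DX_LJ (x : ℕ) (z) (hz : z ∈ LinearMap.range (LinearMap.lTensor F J.subtype)) :
    DX K F x z ∈ LinearMap.range (LinearMap.lTensor F J.subtype) := by
  obtain ⟨z, rfl⟩ := hz
  induction z using TensorProduct.induction_on with
  | zero => simp
  | add a b ha hb => simpa using add_mem ha hb
  | tmul a b =>
    simp only [LinearMap.lTensor_tmul, DX_tmul]
    refine sub_mem ⟨(a * xi K F x) ⊗ₜ b, by simp⟩ ⟨a ⊗ₜ ⟨_, hJ _ b.2 (xi K F x)⟩, by simp⟩

include hI in
lemma QQ_la (a : F) (ha : a ∈ I) (z) : QQ I J (la K a z) = 0 := by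
  have : QQ I J ∘ₗ la K a = 0 := fs_ext fun x u v => by
    have : Submodule.Quotient.mk (p := I) (a * wd K F u) = 0 := by
      rw [Submodule.Quotient.mk_eq_zero]; exact hI _ ha _
    simp [this]
  simpa using LinearMap.congr_fun this z

include hJ in
lemma QQ_ra (a : F) (ha : a ∈ J) (z) : QQ I J (ra K a z) = 0 := by
  have : QQ I J ∘ₗ ra K a = 0 := fs_ext fun x u v => by
    have : Submodule.Quotient.mk (p := J) (wd K F v * a) = 0 := by
      rw [Submodule.Quotient.mk_eq_zero]; exact hJ _ ha _
    simp [this]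
  simpa using LinearMap.congr_fun this z

include hI in
lemma QQ_sL (z) (hz : z ∈ LinearMap.range (LinearMap.rTensor F I.subtype)) :
    QQ I J (sL K F z) = 0 := by
  obtain ⟨z, rfl⟩ := hz
  induction z using TensorProduct.induction_on with
  | zero => simp
  | add a b ha hb => simp [ha, hb]
  | tmul a b => simp [sL_tmul, QQ_la I J hI a a.2]

include hJ in
lemma QQ_sR (z) (hz : z ∈ LinearMap.range (LinearMap.lTensor F J.subtype)) :
    QQ I J (sR K F z) = 0 := by
  obtain ⟨z, rfl⟩ := hz
  induction z using TensorProduct.induction_on with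
  | zero => simp
  | add a b ha hb => simp [ha, hb]
  | tmul a b => simp [sR_tmul, QQ_ra I J hJ b b.2]

include hI in
lemma mu_LI (z) (hz : z ∈ LinearMap.range (LinearMap.rTensor F I.subtype)) : mu K F z ∈ I := by
  obtain ⟨z, rfl⟩ := hz
  induction z using TensorProduct.induction_on with
  | zero => simp
  | add a b ha hb => simpa using add_mem ha hb
  | tmul a b => simpa using hI _ a.2 b

include hJ in
lemma mu_LJ (z) (hz : z ∈ LinearMap.range (LinearMap.lTensor F J.subtype)) : mu K F z ∈ J := by
  obtain ⟨z, rfl⟩ := hz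
  induction z using TensorProduct.induction_on with
  | zero => simp
  | add a b ha hb => simpa using add_mem ha hb
  | tmul a b => simpa using hJ _ b.2 a

/-- the embedding -/
noncomputable def phi : F →ₗ[K] (F ⧸ I) × (F ⧸ J) × (ℕ →₀ (F ⧸ I) ⊗[K] (F ⧸ J)) :=
  I.mkQ.prod (J.mkQ.prod (QQ I J ∘ₗ delta K F))

include hI hJ in
lemma ker_phi : LinearMap.ker (phi I J) = I * J := by
  apply le_antisymm
  · intro f hf
    simp only [phi, LinearMap.mem_ker, LinearMap.prod_apply, Function.prod_apply, Prod.mk_eq_zero,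
      LinearMap.comp_apply, Submodule.mkQ_apply, Submodule.Quotient.mk_eq_zero] at hf
    obtain ⟨h1, h2, h3⟩ := hf
    have key : dd K F (delta K F f) ∈
        (LinearMap.range (LinearMap.rTensor F I.subtype) ⊓ LinearMap.ker (mu K F)) ⊔
        LinearMap.range (LinearMap.lTensor F J.subtype) := by
      rw [dd, Finsupp.lsum_apply]
      refine Submodule.sum_mem _ fun x _ => ?_
      have : delta K F f x ∈ LinearMap.ker (qq I J) := by
        rw [LinearMap.mem_ker, ← QQ_apply, h3]; rfl
      rw [ker_qq, Submodule.mem_sup] at this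
      obtain ⟨b, hb, a, ha, hab⟩ := this
      change DX K F x (delta K F f x) ∈ _
      rw [← hab, map_add, add_comm]
      exact Submodule.add_mem_sup ⟨DX_LI I hI x a ha, mu_DX x a⟩ (DX_LJ J hJ x b hb)
    rw [dd_delta, Submodule.mem_sup] at key
    obtain ⟨a, ⟨ha, ha'⟩, b, hb, hab⟩ := key
    have h5 : f ⊗ₜ 1 - a = 1 ⊗ₜ f + b := by
      rw [sub_eq_iff_eq_add, add_assoc, add_comm b a, hab]; abel
    have h6 : f ⊗ₜ[K] (1 : F) - a ∈ LinearMap.range (TensorProduct.map I.subtype J.subtype) := by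
      refine inf_range I J ⟨?_, ?_⟩
      · exact sub_mem ⟨⟨f, h1⟩ ⊗ₜ 1, by simp⟩ ha
      · rw [h5]
        exact add_mem ⟨1 ⊗ₜ ⟨f, h2⟩, by simp⟩ hb
    have h7 : mu K F (f ⊗ₜ[K] (1 : F) - a) = f := by
      rw [map_sub, LinearMap.mem_ker.1 ha']; simp
    rw [← h7]
    obtain ⟨z, hz⟩ := h6
    rw [← hz]
    clear * -
    induction z using TensorProduct.induction_on with
    | zero => simp
    | add a b ha hb => simpa using add_mem ha hb
    | tmul a b => simpa using Submodule.mul_mem_mul a.2 b.2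
  · rw [Submodule.mul_le]
    intro a ha b hb
    simp only [phi, LinearMap.mem_ker, LinearMap.prod_apply, Function.prod_apply, Prod.mk_eq_zero,
      LinearMap.comp_apply, Submodule.mkQ_apply, Submodule.Quotient.mk_eq_zero]
    exact ⟨hI _ ha _, hJ _ hb _, by rw [delta_mul, map_add, QQ_la I J hI a ha, QQ_ra I J hJ b hb, add_zero]⟩

/-- differential on the quotients -/
noncomputable def DQ (x : ℕ) : (F ⧸ I) ⊗[K] (F ⧸ J) →ₗ[K] (F ⧸ I) ⊗[K] (F ⧸ J) :=
  LinearMap.rTensor _ (I.mapQ I (LinearMap.mulRight K (xi K F x)) (fun a ha => hI a ha _)) -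
  LinearMap.lTensor _ (J.mapQ J (LinearMap.mulLeft K (xi K F x)) (fun a ha => hJ a ha _))

/-- differential on the quotients -/
noncomputable def dq : (ℕ →₀ (F ⧸ I) ⊗[K] (F ⧸ J)) →ₗ[K] (F ⧸ I) ⊗[K] (F ⧸ J) :=
  Finsupp.lsum ℕ (DQ I J hI hJ)

lemma dq_QQ (z) : dq I J hI hJ (QQ I J z) = qq I J (dd K F z) := by
  have : dq I J hI hJ ∘ₗ QQ I J = qq I J ∘ₗ dd K F := fs_ext fun x u v => by
    simp [dq, DX_tmul, DQ]
    rfl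
  simpa using LinearMap.congr_fun this z

/-- the projection -/
noncomputable def psi : (F ⧸ I) × (F ⧸ J) × (ℕ →₀ (F ⧸ I) ⊗[K] (F ⧸ J)) →ₗ[K]
    (F ⧸ I) ⊗[K] (F ⧸ J) :=
  ((TensorProduct.mk K _ _).flip (J.mkQ 1)).coprod
    ((- (TensorProduct.mk K _ _ (I.mkQ 1))).coprod (- dq I J hI hJ))

lemma psi_mk (m n : F) (z) : psi I J hI hJ (I.mkQ m, J.mkQ n, QQ I J z) =
    qq I J (m ⊗ₜ 1 - 1 ⊗ₜ n - dd K F z) := by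
  simp only [psi, LinearMap.coprod_apply, LinearMap.neg_apply, dq_QQ, map_sub, qq_tmul,
    LinearMap.flip_apply, TensorProduct.mk_apply]
  abel

lemma V_surj (v : (F ⧸ I) × (F ⧸ J) × (ℕ →₀ (F ⧸ I) ⊗[K] (F ⧸ J))) :
    ∃ m n z, v = (I.mkQ m, J.mkQ n, QQ I J z) := by
  obtain ⟨a, b, c⟩ := v
  obtain ⟨m, rfl⟩ := I.mkQ_surjective a
  obtain ⟨n, rfl⟩ := J.mkQ_surjective b
  obtain ⟨z, rfl⟩ := QQ_surj I J c
  exact ⟨m, n, z, rfl⟩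

lemma psi_surj : Function.Surjective (psi I J hI hJ) := by
  intro w
  obtain ⟨w, rfl⟩ := qq_surj I J w
  refine ⟨(I.mkQ (mu K F w), J.mkQ 0, QQ I J (sL K F w)), ?_⟩
  rw [psi_mk, dd_sL]
  simp

lemma range_phi : LinearMap.range (phi I J) = LinearMap.ker (psi I J hI hJ) := by
  apply le_antisymm
  · rintro _ ⟨f, rfl⟩
    rw [LinearMap.mem_ker]
    have : phi I J f = (I.mkQ f, J.mkQ f, QQ I J (delta K F f)) := rfl
    rw [this, psi_mk, dd_delta, sub_self, map_zero]
  · intro v hv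
    obtain ⟨m, n, z, rfl⟩ := V_surj I J v
    rw [LinearMap.mem_ker, psi_mk, ← LinearMap.mem_ker, ker_qq, Submodule.mem_sup] at hv
    obtain ⟨b, hb, a, ha, hab⟩ := hv
    have hmu := congrArg (mu K F) hab
    simp only [map_add, map_sub, mu_tmul, mu_dd, mul_one, one_mul, sub_zero] at hmu
    -- b + a = m - n
    have hf : m - mu K F a = n + mu K F b := by
      rw [sub_eq_iff_eq_add, add_assoc, hmu]; abel
    set f := m - mu K F a with hfdef
    have hd : delta K F f = z + sR K F b - sL K F a := by
      apply dd_inj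
      rw [dd_delta, map_sub, map_add, dd_sL, dd_sR]
      have e1 : dd K F z = m ⊗ₜ 1 - 1 ⊗ₜ n - (b + a) := by rw [hab]; abel
      rw [e1]
      nth_rewrite 2 [hf]
      rw [hfdef, TensorProduct.sub_tmul, TensorProduct.tmul_add]
      abel
    refine ⟨f, ?_⟩
    have : phi I J f = (I.mkQ f, J.mkQ f, QQ I J (delta K F f)) := rfl
    have hQ : QQ I J (delta K F f) = QQ I J z := by
      rw [hd, map_sub, map_add, QQ_sR I J hJ b hb, QQ_sL I J hI a ha]
      simp
    have hm : I.mkQ f = I.mkQ m := by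
      rw [hfdef, map_sub, sub_eq_self]
      simpa using mu_LI I hI a ha
    have hn : J.mkQ f = J.mkQ n := by
      rw [hf, map_add, add_eq_left]
      simpa using mu_LJ J hJ b hb
    rw [this, hQ, hm, hn]

end Exact

section LinAlg
variable {K : Type*} [Field K]

lemma finrank_retract {X V : Type*} [AddCommGroup X] [Module K X] [AddCommGroup V] [Module K V]
    (Φ : X →ₗ[K] V) (Ψ : V →ₗ[K] X) (h1 : ∀ x, Ψ (Φ x) = x) (e : V →ₗ[K] V)
    (h2 : ∀ v, Φ (Ψ v) = e v) : LinearMap.range e = LinearMap.range Φ ∧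
      Module.finrank K (LinearMap.range e) = Module.finrank K X := by
  have h : LinearMap.range e = LinearMap.range Φ := by
    apply le_antisymm
    · rintro _ ⟨v, rfl⟩
      exact ⟨Ψ v, h2 v⟩
    · rintro _ ⟨x, rfl⟩
      exact ⟨Φ x, by rw [← h2, h1]⟩
  refine ⟨h, ?_⟩
  rw [h]
  exact LinearMap.finrank_range_of_inj (Function.LeftInverse.injective h1)

lemma rank_exact {U V W : Type*} [AddCommGroup U] [Module K U] [AddCommGroup V] [Module K V]
    [AddCommGroup W] [Module K W] (f : U →ₗ[K] V) (g : V →ₗ[K] W)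
    (hfg : LinearMap.range f = LinearMap.ker g) (hg : Function.Surjective g)
    (eU : U →ₗ[K] U) (eV : V →ₗ[K] V) (eW : W →ₗ[K] W)
    (hf : ∀ u, f (eU u) = eV (f u)) (hg' : ∀ v, g (eV v) = eW (g v))
    (hid : ∀ v, eV (eV v) = eV v) [FiniteDimensional K (LinearMap.range eV)] :
    Module.finrank K (LinearMap.range eV) =
      Module.finrank K ((LinearMap.range eU).map f) + Module.finrank K (LinearMap.range eW) := by
  have h := LinearMap.finrank_range_add_finrank_ker (g.domRestrict (LinearMap.range eV))
  have h1 : LinearMap.range (g.domRestrict (LinearMap.range eV)) = LinearMap.range eW := by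
    ext w
    simp only [LinearMap.mem_range, LinearMap.domRestrict_apply, Subtype.exists, exists_prop]
    constructor
    · rintro ⟨_, ⟨v, rfl⟩, rfl⟩
      exact ⟨g v, (hg' v).symm⟩
    · rintro ⟨w, rfl⟩
      obtain ⟨v, rfl⟩ := hg w
      exact ⟨_, ⟨v, rfl⟩, hg' v⟩
  have h2 : (LinearMap.ker (g.domRestrict (LinearMap.range eV))).map
      (LinearMap.range eV).subtype = (LinearMap.range eU).map f := by
    ext v
    simp only [Submodule.mem_map, LinearMap.mem_ker, LinearMap.domRestrict_apply, Subtype.exists,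
      Submodule.subtype_apply, LinearMap.mem_range]
    constructor
    · rintro ⟨_, ⟨v, rfl⟩, h, rfl⟩
      have : eV v ∈ LinearMap.range f := by rw [hfg]; exact h
      obtain ⟨u, hu⟩ := this
      exact ⟨_, ⟨u, rfl⟩, by rw [hf, hu, hid]⟩
    · rintro ⟨_, ⟨u, rfl⟩, rfl⟩
      refine ⟨_, ⟨f u, (hf u).symm⟩, ?_, rfl⟩
      have : f (eU u) ∈ LinearMap.ker g := by rw [← hfg]; exact ⟨_, rfl⟩
      exact this
  rw [← h, h1, ← h2, add_comm]
  congr 1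
  exact (Submodule.equivMapOfInjective _ (Submodule.subtype_injective _) _).finrank_eq

lemma finrank_quot_comap {V W : Type*} [AddCommGroup V] [Module K V] [AddCommGroup W] [Module K W]
    (f : V →ₗ[K] W) (P : Submodule K V) :
    Module.finrank K (↥P ⧸ (LinearMap.ker f).comap P.subtype) = Module.finrank K (P.map f) := by
  have h1 : (LinearMap.ker f).comap P.subtype = LinearMap.ker (f ∘ₗ P.subtype) := by
    ext; simp
  have h2 : P.map f = LinearMap.range (f ∘ₗ P.subtype) := by
    rw [LinearMap.range_comp, Submodule.range_subtype]
  rw [h1, h2]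
  exact (LinearMap.quotKerEquivRange _).finrank_eq

lemma orth_add {V : Type*} [AddCommGroup V] [Module K V] (p q : V →ₗ[K] V)
    (hp : ∀ v, p (p v) = p v) (hq : ∀ v, q (q v) = q v)
    (hpq : ∀ v, p (q v) = 0) (hqp : ∀ v, q (p v) = 0)
    [FiniteDimensional K (LinearMap.range p)] [FiniteDimensional K (LinearMap.range q)] :
    FiniteDimensional K (LinearMap.range (p + q)) ∧
    Module.finrank K (LinearMap.range (p + q)) =
      Module.finrank K (LinearMap.range p) + Module.finrank K (LinearMap.range q) := by
  have h1 : LinearMap.range (p + q) = LinearMap.range p ⊔ LinearMap.range q := by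
    apply le_antisymm
    · rintro _ ⟨v, rfl⟩
      exact Submodule.add_mem_sup ⟨v, rfl⟩ ⟨v, rfl⟩
    · apply sup_le
      · rintro _ ⟨v, rfl⟩
        exact ⟨p v, by simp [hp, hqp]⟩
      · rintro _ ⟨v, rfl⟩
        exact ⟨q v, by simp [hq, hpq]⟩
  have h2 : LinearMap.range p ⊓ LinearMap.range q = ⊥ := by
    rw [eq_bot_iff]
    rintro _ ⟨⟨v, rfl⟩, ⟨w, hw⟩⟩
    rw [Submodule.mem_bot, ← hp, ← hw, hpq]
  have h3 := Submodule.finrank_sup_add_finrank_inf_eq (LinearMap.range p) (LinearMap.range q)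
  rw [h2, finrank_bot, add_zero] at h3
  rw [h1]
  exact ⟨inferInstance, h3⟩

lemma orth_sum {V ι : Type*} [DecidableEq ι] [AddCommGroup V] [Module K V] (p : ι → V →ₗ[K] V) (s : Finset ι)
    (hp : ∀ i ∈ s, ∀ v, p i (p i v) = p i v)
    (hpq : ∀ i ∈ s, ∀ j ∈ s, i ≠ j → ∀ v, p i (p j v) = 0)
    (hf : ∀ i ∈ s, FiniteDimensional K (LinearMap.range (p i))) :
    FiniteDimensional K (LinearMap.range (∑ i ∈ s, p i)) ∧
    (∀ v, (∑ i ∈ s, p i) ((∑ i ∈ s, p i) v) = (∑ i ∈ s, p i) v) ∧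
    Module.finrank K (LinearMap.range (∑ i ∈ s, p i)) =
      ∑ i ∈ s, Module.finrank K (LinearMap.range (p i)) := by
  induction s using Finset.induction_on with
  | empty => 
    have : LinearMap.range (∑ i ∈ (∅ : Finset ι), p i) = ⊥ := by simp
    rw [this]
    refine ⟨inferInstance, by simp, by simp⟩
  | insert a s ha ih =>
    obtain ⟨i1, i2, i3⟩ := ih (fun i hi => hp i (by simp [hi]))
      (fun i hi j hj => hpq i (by simp [hi]) j (by simp [hj])) (fun i hi => hf i (by simp [hi]))
    rw [Finset.sum_insert ha, Finset.sum_insert ha, ← i3]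
    have := hf a (by simp)
    have c1 : ∀ v, p a ((∑ i ∈ s, p i) v) = 0 := fun v => by
      rw [LinearMap.sum_apply, map_sum]
      refine Finset.sum_eq_zero fun i hi => hpq _ (by simp) _ (by simp [hi]) ?_ _
      rintro rfl; exact ha hi
    have c2 : ∀ v, (∑ i ∈ s, p i) (p a v) = 0 := fun v => by
      rw [LinearMap.sum_apply]
      refine Finset.sum_eq_zero fun i hi => hpq _ (by simp [hi]) _ (by simp) ?_ _
      rintro rfl; exact ha hi
    obtain ⟨j1, j2⟩ := orth_add (p a) (∑ i ∈ s, p i) (hp a (by simp)) i2 c1 c2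
    refine ⟨j1, fun v => ?_, j2⟩
    rw [LinearMap.add_apply, LinearMap.add_apply, map_add, map_add, c1, c2, i2, hp a (by simp)]
    simp

lemma finrank_range_map {V W : Type*} [AddCommGroup V] [Module K V] [AddCommGroup W] [Module K W]
    (p : V →ₗ[K] V) (q : W →ₗ[K] W)
    (hp : ∀ v, p (p v) = p v) (hq : ∀ v, q (q v) = q v)
    [FiniteDimensional K (LinearMap.range p)] [FiniteDimensional K (LinearMap.range q)] :
    FiniteDimensional K (LinearMap.range (TensorProduct.map p q)) ∧
    Module.finrank K (LinearMap.range (TensorProduct.map p q)) =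
      Module.finrank K (LinearMap.range p) * Module.finrank K (LinearMap.range q) := by
  have := finrank_retract (TensorProduct.map (LinearMap.range p).subtype (LinearMap.range q).subtype)
    (TensorProduct.map p.rangeRestrict q.rangeRestrict) (fun x => by
      have : TensorProduct.map p.rangeRestrict q.rangeRestrict ∘ₗ
        (TensorProduct.map (LinearMap.range p).subtype (LinearMap.range q).subtype) = LinearMap.id := by
        apply TensorProduct.ext'
        rintro ⟨_, v, rfl⟩ ⟨_, w, rfl⟩
        simp only [LinearMap.comp_apply, TensorProduct.map_tmul, LinearMap.id_apply]
        congr 1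
        · ext; simp [hp]
        · ext; simp [hq]
      exact LinearMap.congr_fun this x) (TensorProduct.map p q) (fun v => by
        rw [← LinearMap.comp_apply, ← TensorProduct.map_comp]
        rfl)
  obtain ⟨h1, h2⟩ := this
  rw [h2, h1, Module.finrank_tensorProduct]
  exact ⟨inferInstance, rfl⟩

lemma finrank_range_prodMap {V W : Type*} [AddCommGroup V] [Module K V] [AddCommGroup W] [Module K W]
    (p : V →ₗ[K] V) (q : W →ₗ[K] W)
    (hp : ∀ v, p (p v) = p v) (hq : ∀ v, q (q v) = q v)
    [FiniteDimensional K (LinearMap.range p)] [FiniteDimensional K (LinearMap.range q)] :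
    FiniteDimensional K (LinearMap.range (p.prodMap q)) ∧
    Module.finrank K (LinearMap.range (p.prodMap q)) =
      Module.finrank K (LinearMap.range p) + Module.finrank K (LinearMap.range q) := by
  have := finrank_retract ((LinearMap.range p).subtype.prodMap (LinearMap.range q).subtype)
    (p.rangeRestrict.prodMap q.rangeRestrict) (fun x => by
      obtain ⟨⟨_, v, rfl⟩, ⟨_, w, rfl⟩⟩ := x
      ext <;> simp [hp, hq]) (p.prodMap q) (fun v => rfl)
  obtain ⟨h1, h2⟩ := this
  rw [h2, h1, Module.finrank_prod]
  exact ⟨inferInstance, rfl⟩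

lemma finrank_fs {V : Type*} [AddCommGroup V] [Module K V] (E : ℕ → V →ₗ[K] V) (S : Finset ℕ) 
    (hid : ∀ x v, E x (E x v) = E x v) (hfd : ∀ x, FiniteDimensional K (LinearMap.range (E x))) :
    FiniteDimensional K (LinearMap.range (∑ x ∈ S, Finsupp.lsingle x ∘ₗ E x ∘ₗ Finsupp.lapply x)) ∧
    (∀ v, (∑ x ∈ S, Finsupp.lsingle x ∘ₗ E x ∘ₗ Finsupp.lapply x)
        ((∑ x ∈ S, Finsupp.lsingle (R := K) x ∘ₗ E x ∘ₗ Finsupp.lapply x) v) = 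
      (∑ x ∈ S, Finsupp.lsingle x ∘ₗ E x ∘ₗ Finsupp.lapply x) v) ∧ 
    Module.finrank K (LinearMap.range (∑ x ∈ S, Finsupp.lsingle x ∘ₗ E x ∘ₗ Finsupp.lapply x)) = 
      ∑ x ∈ S, Module.finrank K (LinearMap.range (E x)) := by
  have hr : ∀ x, LinearMap.range (Finsupp.lsingle (R := K) x ∘ₗ E x ∘ₗ Finsupp.lapply x)
      = (LinearMap.range (E x)).map (Finsupp.lsingle x) := fun x => by
    rw [LinearMap.range_comp, LinearMap.range_comp_of_range_eq_top]
    rw [LinearMap.range_eq_top]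
    intro v
    exact ⟨Finsupp.single x v, by simp⟩
  have h := orth_sum (K := K) (V := ℕ →₀ V) 
    (fun x => Finsupp.lsingle x ∘ₗ E x ∘ₗ Finsupp.lapply x) S
    (fun x _ v => by
      simp [hid])
    (fun x _ y _ hAB v => by
      simp [Finsupp.single_eq_of_ne hAB])
    (fun x _ => by rw [hr]; infer_instance)
  refine ⟨h.1, h.2.1, h.2.2.trans ?_⟩
  refine Finset.sum_congr rfl fun x _ => ?_
  rw [hr]
  exact (Submodule.equivMapOfInjective _ (Finsupp.single_injective x) _).finrank_eq.symm

lemma abs_main {U A B V : Type*} [AddCommGroup U] [Module K U] [AddCommGroup A] [Module K A]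
    [AddCommGroup B] [Module K B] [AddCommGroup V] [Module K V]
    (f : U →ₗ[K] A × B × (ℕ →₀ V)) (g : A × B × (ℕ →₀ V) →ₗ[K] V)
    (hfg : LinearMap.range f = LinearMap.ker g) (hg : Function.Surjective g)
    (eU : U →ₗ[K] U) (eA : A →ₗ[K] A) (eB : B →ₗ[K] B) (E : ℕ → V →ₗ[K] V) (eW : V →ₗ[K] V)
    (S : Finset ℕ)
    (hf : ∀ u, f (eU u) = 
      (eA.prodMap (eB.prodMap (∑ x ∈ S, Finsupp.lsingle x ∘ₗ E x ∘ₗ Finsupp.lapply x))) (f u)) 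
    (hg' : ∀ v, g ((eA.prodMap (eB.prodMap 
      (∑ x ∈ S, Finsupp.lsingle x ∘ₗ E x ∘ₗ Finsupp.lapply x))) v) = eW (g v))
    (iA : ∀ v, eA (eA v) = eA v) (iB : ∀ v, eB (eB v) = eB v)
    (iE : ∀ x v, E x (E x v) = E x v)
    (fA : FiniteDimensional K (LinearMap.range eA)) (fB : FiniteDimensional K (LinearMap.range eB))
    (N : Submodule K U) (hN : LinearMap.ker f = N)
    (fE : ∀ x, FiniteDimensional K (LinearMap.range (E x))) :
    Module.finrank K (↥(LinearMap.range eU) ⧸ N.comap (LinearMap.range eU).subtype) + Module.finrank K (LinearMap.range eW) =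
    Module.finrank K (LinearMap.range eA) + (Module.finrank K (LinearMap.range eB) +
      ∑ x ∈ S, Module.finrank K (LinearMap.range (E x))) := by
  rw [← hN, finrank_quot_comap]
  obtain ⟨h1, h1', h1''⟩ := finrank_fs E S iE fE
  rw [← h1'']
  set Z := (∑ x ∈ S, Finsupp.lsingle (R := K) x ∘ₗ E x ∘ₗ Finsupp.lapply x) with hZ
  have h2 := finrank_range_prodMap eB Z iB h1'
  have := h2.1
  have h3 := finrank_range_prodMap eA (eB.prodMap Z) iA
    (fun v => by ext1 <;> simp [iB, h1'])
  have := h3.1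
  rw [← h2.2, ← h3.2]
  symm
  exact rank_exact f g hfg hg eU _ eW hf hg' (fun v => by 
    ext1
    · simp [iA]
    · ext1 <;> simp [iB, h1'])

end LinAlg

section Grad
variable {K : Type*} {F : Type*} [Field K] [Ring F] [Algebra K F] [FB K F]

/-- multilinear projector -/
noncomputable def eA (K : Type*) (F : Type*) [Field K] [Ring F] [Algebra K F] [FB K F]
    (A : Finset ℕ) : F →ₗ[K] F :=
  (wb K F).constr K (fun w => if (w : Multiset ℕ) = A.val then wd K F w else 0)

lemma eA_wd (A : Finset ℕ) (w : List ℕ) :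
    eA K F A (wd K F w) = if (w : Multiset ℕ) = A.val then wd K F w else 0 := by
  rw [← wb_apply, eA, Module.Basis.constr_basis, wb_apply]

lemma eA_idem (A : Finset ℕ) (f : F) : eA K F A (eA K F A f) = eA K F A f := by
  have : eA K F A ∘ₗ eA K F A = eA K F A := wd_ext fun w => by
    rw [LinearMap.comp_apply, eA_wd]; split_ifs with h <;> simp [eA_wd, h]
  exact LinearMap.congr_fun this f

lemma eA_orth {A B : Finset ℕ} (hAB : A ≠ B) (f : F) : eA K F A (eA K F B f) = 0 := by
  have : eA K F A ∘ₗ eA K F B = 0 := wd_ext fun w => by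
    rw [LinearMap.comp_apply, eA_wd]; split_ifs with h
    · have : B.val ≠ A.val := fun h => hAB (Finset.val_injective h.symm)
      simp [eA_wd, h, this]
    · simp
  exact LinearMap.congr_fun this f

lemma range_eA (A : Finset ℕ) : LinearMap.range (eA K F A) =
    Submodule.span K (wd K F '' {w | (w : Multiset ℕ) = A.val}) := by
  rw [LinearMap.range_eq_map, ← (wb K F).span_eq, Submodule.map_span]
  apply le_antisymm
  · rw [Submodule.span_le]
    rintro _ ⟨_, ⟨w, rfl⟩, rfl⟩
    rw [wb_apply, eA_wd]
    split_ifs with h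
    · exact Submodule.subset_span ⟨w, h, rfl⟩
    · exact zero_mem _
  · apply Submodule.span_mono
    rintro _ ⟨w, h, rfl⟩
    exact ⟨wd K F w, ⟨w, wb_apply w⟩, (eA_wd A w).trans (if_pos h)⟩

instance (A : Finset ℕ) : FiniteDimensional K (LinearMap.range (eA K F A)) := by
  rw [range_eA]
  apply FiniteDimensional.span_of_finite
  apply Set.Finite.image
  apply Set.Finite.subset (A.toList.permutations.toFinset.finite_toSet)
  intro w hw
  simp only [List.coe_toFinset, Set.mem_ofPred_eq, List.mem_permutations]
  rw [← Multiset.coe_eq_coe, Finset.coe_toList]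
  exact hw

/-- projector on the tensor square -/
noncomputable def EF (K : Type*) (F : Type*) [Field K] [Ring F] [Algebra K F] [FB K F]
    (T : Finset ℕ) : FF K F →ₗ[K] FF K F :=
  ∑ A ∈ T.powerset, TensorProduct.map (eA K F A) (eA K F (T \ A))

lemma EF_wd (T : Finset ℕ) (u v : List ℕ) : EF K F T (wd K F u ⊗ₜ wd K F v) =
    if (u : Multiset ℕ) + (v : Multiset ℕ) = T.val then wd K F u ⊗ₜ wd K F v else 0 := by
  rw [EF, LinearMap.sum_apply]
  simp only [TensorProduct.map_tmul, eA_wd]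
  have key : ∀ A ∈ T.powerset, A.val + (T \ A).val = T.val := fun A hA => by
    rw [Finset.mem_powerset] at hA
    rw [Finset.sdiff_val, add_tsub_cancel_of_le (Finset.val_le_iff.2 hA)]
  split_ifs with h
  · have hn : (u : Multiset ℕ).Nodup := (Multiset.nodup_of_le (by rw [← h]; exact Multiset.le_add_right _ _) T.nodup)
    have hle : (u : Multiset ℕ) ≤ T.val := by rw [← h]; exact Multiset.le_add_right _ _
    rw [Finset.sum_eq_single_of_mem (⟨u, hn⟩ : Finset ℕ) (by
      rw [Finset.mem_powerset]; exact Finset.val_le_iff.1 hle)]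
    · have : (v : Multiset ℕ) = (T \ ⟨u, hn⟩).val := by
        rw [Finset.sdiff_val, ← h, add_tsub_cancel_left]
      simp [this]
    · intro A _ hA
      have : (u : Multiset ℕ) ≠ A.val := fun h => hA (Finset.val_injective h.symm)
      simp [this]
  · refine Finset.sum_eq_zero fun A hA => ?_
    by_cases h1 : (u : Multiset ℕ) = A.val
    · by_cases h2 : (v : Multiset ℕ) = (T \ A).val
      · exact absurd (by rw [h1, h2, key A hA]) h
      · rw [if_neg h2, TensorProduct.tmul_zero]
    · simp [h1]

/-- projector on the universal derivation bimodule -/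
noncomputable def EFS (K : Type*) (F : Type*) [Field K] [Ring F] [Algebra K F] [FB K F]
    (S : Finset ℕ) : (ℕ →₀ FF K F) →ₗ[K] (ℕ →₀ FF K F) :=
  ∑ x ∈ S, Finsupp.lsingle x ∘ₗ EF K F (S.erase x) ∘ₗ Finsupp.lapply x

lemma EFS_wd (S : Finset ℕ) (x : ℕ) (u v : List ℕ) :
    EFS K F S (Finsupp.single x (wd K F u ⊗ₜ wd K F v)) =
    if (u : Multiset ℕ) + x ::ₘ (v : Multiset ℕ) = S.val then
      Finsupp.single x (wd K F u ⊗ₜ wd K F v) else 0 := by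
  rw [EFS, LinearMap.sum_apply]
  simp only [LinearMap.comp_apply, Finsupp.lapply_apply, Finsupp.lsingle_apply]
  by_cases hx : x ∈ S
  · rw [Finset.sum_eq_single_of_mem x hx]
    · rw [Finsupp.single_eq_same, EF_wd]
      have : ((u : Multiset ℕ) + (v : Multiset ℕ) = (S.erase x).val) ↔
        ((u : Multiset ℕ) + x ::ₘ (v : Multiset ℕ) = S.val) := by
        rw [Finset.erase_val, Multiset.add_cons, ← Multiset.cons_inj_right x,
          Multiset.cons_erase hx]
      simp only [this]
      split_ifs <;> simp
    · intro y _ hy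
      rw [Finsupp.single_eq_of_ne hy]; simp
  · have : ¬ ((u : Multiset ℕ) + x ::ₘ (v : Multiset ℕ) = S.val) := fun h => hx (by
      rw [← Finset.mem_val, ← h]; simp)
    rw [if_neg this]
    refine Finset.sum_eq_zero fun y hy => ?_
    rw [Finsupp.single_eq_of_ne]
    · simp
    · rintro rfl; exact hx hy

lemma EF_idem (S : Finset ℕ) (z) : EF K F S (EF K F S z) = EF K F S z := by
  have : EF K F S ∘ₗ EF K F S = EF K F S := tw_ext fun u v => by
    rw [LinearMap.comp_apply, EF_wd]; split_ifs with h <;> simp [EF_wd, h]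
  exact LinearMap.congr_fun this z

lemma EFS_idem (S : Finset ℕ) (z) : EFS K F S (EFS K F S z) = EFS K F S z := by
  have : EFS K F S ∘ₗ EFS K F S = EFS K F S := fs_ext fun x u v => by
    rw [LinearMap.comp_apply, EFS_wd]; split_ifs with h
    · rw [EFS_wd, if_pos h]
    · simp
  exact LinearMap.congr_fun this z

lemma dd_EFS (S : Finset ℕ) (z) : dd K F (EFS K F S z) = EF K F S (dd K F z) := by
  have : dd K F ∘ₗ EFS K F S = EF K F S ∘ₗ dd K F := fs_ext fun x u v => by
    have e1 : wd K F u * xi K F x = wd K F (u ++ [x]) := by simp [wd_append]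
    have e2 : ((u ++ [x] : List ℕ) : Multiset ℕ) + (v : Multiset ℕ) = 
      (u : Multiset ℕ) + x ::ₘ (v : Multiset ℕ) := by
      rw [← Multiset.coe_add, add_assoc]; rfl
    rw [LinearMap.comp_apply, LinearMap.comp_apply, EFS_wd, dd_single, DX_tmul, e1, ← wd_cons,
      map_sub, EF_wd, EF_wd, e2, ← Multiset.cons_coe]
    split_ifs with h
    · rw [dd_single, DX_tmul, e1, ← wd_cons]
    · simp
  exact LinearMap.congr_fun this z

lemma EF_tmul_one (S : Finset ℕ) (f : F) : EF K F S (f ⊗ₜ 1) = eA K F S f ⊗ₜ 1 := by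
  have : EF K F S ∘ₗ (TensorProduct.mk K _ _).flip 1 = (TensorProduct.mk K _ _).flip 1 ∘ₗ eA K F S :=
    wd_ext fun w => by
      have := EF_wd (K := K) (F := F) S w []
      simp only [wd_nil] at this
      simp only [LinearMap.comp_apply, LinearMap.flip_apply, TensorProduct.mk_apply, this, eA_wd]
      simp only [Multiset.coe_nil, add_zero]
      split_ifs <;> simp
  exact LinearMap.congr_fun this f

lemma EF_one_tmul (S : Finset ℕ) (f : F) : EF K F S (1 ⊗ₜ f) = 1 ⊗ₜ eA K F S f := by
  have : EF K F S ∘ₗ (TensorProduct.mk K _ _) 1 = (TensorProduct.mk K _ _) 1 ∘ₗ eA K F S :=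
    wd_ext fun w => by
      have := EF_wd (K := K) (F := F) S [] w
      simp only [wd_nil] at this
      simp only [LinearMap.comp_apply, TensorProduct.mk_apply, this, eA_wd]
      simp only [Multiset.coe_nil, zero_add]
      split_ifs <;> simp
  exact LinearMap.congr_fun this f

lemma delta_eA (S : Finset ℕ) (f : F) : delta K F (eA K F S f) = EFS K F S (delta K F f) := by
  apply dd_inj
  rw [dd_EFS, dd_delta, dd_delta, map_sub, EF_tmul_one, EF_one_tmul]

section Quot
variable (I J : Submodule K F)

/-- stability -/
def Stab (I : Submodule K F) : Prop := ∀ A, ∀ f ∈ I, eA K F A f ∈ I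

variable {I J} (sI : Stab I) (sJ : Stab J)

/-- projector on quotient -/
noncomputable def eQ (A : Finset ℕ) : F ⧸ I →ₗ[K] F ⧸ I := I.mapQ I (eA K F A) (sI A)

lemma eQ_mk (A : Finset ℕ) (f : F) : eQ sI A (I.mkQ f) = I.mkQ (eA K F A f) := rfl

lemma eQ_idem (A : Finset ℕ) (f) : eQ sI A (eQ sI A f) = eQ sI A f := by
  obtain ⟨f, rfl⟩ := I.mkQ_surjective f
  rw [eQ_mk, eQ_mk, eA_idem]

lemma eQ_orth {A B : Finset ℕ} (h : A ≠ B) (f) : eQ sI A (eQ sI B f) = 0 := by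
  obtain ⟨f, rfl⟩ := I.mkQ_surjective f
  rw [eQ_mk, eQ_mk, eA_orth h, map_zero]

lemma range_eQ (A : Finset ℕ) : LinearMap.range (eQ sI A) = (LinearMap.range (eA K F A)).map I.mkQ := by
  ext v
  constructor
  · rintro ⟨v, rfl⟩
    obtain ⟨f, rfl⟩ := I.mkQ_surjective v
    exact ⟨_, ⟨f, rfl⟩, rfl⟩
  · rintro ⟨_, ⟨f, rfl⟩, rfl⟩
    exact ⟨I.mkQ f, rfl⟩

instance (A : Finset ℕ) : FiniteDimensional K (LinearMap.range (eQ sI A)) := by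
  rw [range_eQ]; infer_instance

/-- projector on tensor -/
noncomputable def ET (T : Finset ℕ) : (F ⧸ I) ⊗[K] (F ⧸ J) →ₗ[K] (F ⧸ I) ⊗[K] (F ⧸ J) :=
  ∑ A ∈ T.powerset, TensorProduct.map (eQ sI A) (eQ sJ (T \ A))

lemma qq_EF (T : Finset ℕ) (z) : qq I J (EF K F T z) = ET sI sJ T (qq I J z) := by
  have : qq I J ∘ₗ EF K F T = ET sI sJ T ∘ₗ qq I J := tw_ext fun u v => by
    simp only [LinearMap.comp_apply, EF, ET, LinearMap.sum_apply, map_sum, qq_tmul,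
      TensorProduct.map_tmul]
    rfl
  exact LinearMap.congr_fun this z

/-- projector on finsupps -/
noncomputable def ES (S : Finset ℕ) :
    (ℕ →₀ (F ⧸ I) ⊗[K] (F ⧸ J)) →ₗ[K] (ℕ →₀ (F ⧸ I) ⊗[K] (F ⧸ J)) :=
  ∑ x ∈ S, Finsupp.lsingle x ∘ₗ ET sI sJ (S.erase x) ∘ₗ Finsupp.lapply x

lemma QQ_EFS (T : Finset ℕ) (z) : QQ I J (EFS K F T z) = ES sI sJ T (QQ I J z) := by
  simp only [EFS, ES, LinearMap.sum_apply, map_sum, LinearMap.comp_apply, Finsupp.lapply_apply,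
    Finsupp.lsingle_apply, QQ_single, QQ_apply, qq_EF sI sJ]

lemma finrank_ET (T : Finset ℕ) : 
    FiniteDimensional K (LinearMap.range (ET sI sJ T)) ∧
    (∀ v, ET sI sJ T (ET sI sJ T v) = ET sI sJ T v) ∧ 
    Module.finrank K (LinearMap.range (ET sI sJ T)) = ∑ A ∈ T.powerset,
      Module.finrank K (LinearMap.range (eQ sI A)) * 
        Module.finrank K (LinearMap.range (eQ sJ (T \ A))) := by
  have h := orth_sum (K := K) (fun A => TensorProduct.map (eQ sI A) (eQ sJ (T \ A))) T.powerset
    (fun A _ v => by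
      have : TensorProduct.map (eQ sI A) (eQ sJ (T \ A)) ∘ₗ TensorProduct.map (eQ sI A) (eQ sJ (T \ A))
        = TensorProduct.map (eQ sI A) (eQ sJ (T \ A)) := by
        apply TensorProduct.ext'
        intro x y
        simp [eQ_idem]
      exact LinearMap.congr_fun this v)
    (fun A _ B _ hAB v => by
      have : TensorProduct.map (eQ sI A) (eQ sJ (T \ A)) ∘ₗ TensorProduct.map (eQ sI B) (eQ sJ (T \ B))
        = 0 := by
        apply TensorProduct.ext'
        intro x y
        simp [eQ_orth sI hAB]
      exact LinearMap.congr_fun this v)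
    (fun A _ => (finrank_range_map _ _ (eQ_idem sI A) (eQ_idem sJ _)).1)
  refine ⟨h.1, h.2.1, h.2.2.trans ?_⟩
  refine Finset.sum_congr rfl fun A _ => (finrank_range_map _ _ (eQ_idem sI A) (eQ_idem sJ _)).2

lemma main_rank (hI : ∀ a ∈ I, ∀ b, a * b ∈ I) (hJ : ∀ a ∈ J, ∀ b, b * a ∈ J) (S : Finset ℕ) :
    Module.finrank K (↥(LinearMap.range (eA K F S)) ⧸ (I * J).comap (LinearMap.range (eA K F S)).subtype) + 
      Module.finrank K (LinearMap.range (ET sI sJ S)) =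
    Module.finrank K (LinearMap.range (eQ sI S)) + (Module.finrank K (LinearMap.range (eQ sJ S)) +
      ∑ x ∈ S, Module.finrank K (LinearMap.range (ET sI sJ (S.erase x)))) := by
  apply abs_main (phi I J) (psi I J hI hJ) (range_phi I J hI hJ) (psi_surj I J hI hJ) (eA K F S)
    (eQ sI S) (eQ sJ S) (fun x => ET sI sJ (S.erase x)) (ET sI sJ S) S
  · intro f
    have : ∀ f, phi I J f = (I.mkQ f, J.mkQ f, QQ I J (delta K F f)) := fun _ => rfl
    rw [this, this, delta_eA, QQ_EFS sI sJ]
    rfl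
  · intro v
    obtain ⟨m, n, z, rfl⟩ := V_surj I J v
    rw [psi_mk, ← qq_EF, map_sub (EF K F S), map_sub (EF K F S), EF_tmul_one, EF_one_tmul, ← dd_EFS, ← psi_mk I J hI hJ,
      QQ_EFS sI sJ]
    rfl
  · exact eQ_idem sI S
  · exact eQ_idem sJ S
  · exact fun x => (finrank_ET sI sJ _).2.1
  · infer_instance
  · infer_instance
  · exact ker_phi I J hI hJ
  · exact fun x => (finrank_ET sI sJ _).1

end Quot
end Grad

section TI
variable {K : Type*} {F : Type*} [Field K] [Ring F] [Algebra K F] [FB K F]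

/-- the properties of T-ideals that are used -/
structure TId (I : Submodule K F) : Prop where
  left : ∀ a ∈ I, ∀ b, b * a ∈ I
  right : ∀ a ∈ I, ∀ b, a * b ∈ I
  sub : ∀ (c : ℕ → K) (g : ℕ → ℕ), ∃ θ : F →ₗ[K] F,
    (∀ w, θ (wd K F w) = (w.map c).prod • wd K F (w.map g)) ∧ ∀ f ∈ I, θ f ∈ I

/-- injective weights of multisets -/
noncomputable def NN (s : Multiset ℕ) : ℕ := (s.map (Nat.nth Nat.Prime)).prod

lemma NN_inj : Function.Injective NN := by
  intro s t h
  have key : ∀ s : Multiset ℕ, ∀ p ∈ s.map (Nat.nth Nat.Prime), Prime p := by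
    intro s p hp
    rw [Multiset.mem_map] at hp
    obtain ⟨i, _, rfl⟩ := hp
    exact (Nat.prime_nth_prime i).prime
  have := UniqueFactorizationMonoid.factors_unique (fun p hp => (key s p hp).irreducible)
    (fun p hp => (key t p hp).irreducible) (by rw [NN, NN] at h; rw [h]; exact Associated.refl _)
  have h2 : s.map (Nat.nth Nat.Prime) = t.map (Nat.nth Nat.Prime) := by
    rw [← Multiset.rel_eq]
    exact this.mono (fun a _ b _ h => associated_iff_eq.1 h)
  exact Multiset.map_injective (Nat.nth_injective Nat.infinite_setOfPred_prime) h2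

lemma aeval_wd (θ : F →ₗ[K] F) (p : Polynomial K) (w : List ℕ) (c : K) (h : θ (wd K F w) = c • wd K F w) :
    Polynomial.aeval θ p (wd K F w) = p.eval c • wd K F w := by
  induction p using Polynomial.induction_on' with
  | add p q hp hq => simp [hp, hq, add_smul]
  | monomial n a =>
    have : ∀ n : ℕ, (θ ^ n) (wd K F w) = c ^ n • wd K F w := by
      intro n
      induction n with
      | zero => simp
      | succ n ih => rw [pow_succ', Module.End.mul_apply, ih, map_smul, h, smul_smul, pow_succ]
    rw [Polynomial.aeval_monomial, Module.End.mul_apply, this, Module.algebraMap_end_apply, smul_smul,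
      Polynomial.eval_monomial]

lemma aeval_mem (θ : F →ₗ[K] F) (I : Submodule K F) (hθ : ∀ f ∈ I, θ f ∈ I) (p : Polynomial K) (f : F)
    (hf : f ∈ I) : Polynomial.aeval θ p f ∈ I := by
  induction p using Polynomial.induction_on' with
  | add p q hp hq => simpa using add_mem hp hq
  | monomial n a =>
    have : ∀ n : ℕ, (θ ^ n) f ∈ I := by
      intro n
      induction n with
      | zero => simpa
      | succ n ih => rw [pow_succ', Module.End.mul_apply]; exact hθ _ ih
    rw [Polynomial.aeval_monomial, Module.End.mul_apply, Module.algebraMap_end_apply]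
    exact Submodule.smul_mem _ _ (this n)

lemma TId.stab [CharZero K] {I : Submodule K F} (hI : TId I) : Stab I := by
  intro A f hf
  obtain ⟨θ, h1, h2⟩ := hI.sub (fun i => ((Nat.nth Nat.Prime i : ℕ) : K)) id
  have h1' : ∀ w, θ (wd K F w) = (NN w : K) • wd K F w := by
    intro w
    rw [h1, List.map_id]
    congr 1
    simp [NN]
    induction w with
    | nil => simp
    | cons a w ih => simp [ih]
  classical
  set s : Finset K := insert (NN A.val : K) (((wb K F).repr f).support.image fun w : List ℕ => (NN (w : Multiset ℕ) : K))
  set p := Lagrange.interpolate s id (Pi.single (NN A.val : K) (1 : K))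
  have hp : ∀ x ∈ s, p.eval x = if x = (NN A.val : K) then 1 else 0 := by
    intro x hx
    have := Lagrange.eval_interpolate_at_node (s := s) (v := id) (Pi.single (NN A.val : K) (1 : K)) Function.injective_id.injOn hx
    rw [id] at this
    rw [this, Pi.single_apply]
  have : eA K F A f = Polynomial.aeval θ p f := by
    have hs : ∀ w ∈ ((wb K F).repr f).support, (NN (w : Multiset ℕ) : K) ∈ s := fun w hw =>
      Finset.mem_insert_of_mem (Finset.mem_image_of_mem _ hw)
    have e := (wb K F).linearCombination_repr f
    rw [Finsupp.linearCombination_apply, Finsupp.sum] at e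
    generalize ((wb K F).repr f) = r at e hs
    rw [← e, map_sum, map_sum]
    refine Finset.sum_congr rfl fun w hw => ?_
    rw [map_smul, map_smul, wb_apply, aeval_wd θ p w _ (h1' w), hp _ (hs w hw), eA_wd]
    by_cases hwA : (w : Multiset ℕ) = A.val
    · rw [if_pos hwA, hwA]; simp
    · rw [if_neg hwA, if_neg]
      · simp
      · rw [Nat.cast_inj]; exact fun h => hwA (NN_inj h)
  rw [this]
  exact aeval_mem θ I h2 p f hf

lemma map_bij {A B : Finset ℕ} (e : A ≃ B) :
    A.val.map (fun x => if h : x ∈ A then ((e ⟨x, h⟩ : B) : ℕ) else 0) = B.val := by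
  rw [← Finset.image_val_of_injOn]
  · congr 1
    ext b
    rw [Finset.mem_image]
    constructor
    · rintro ⟨a, ha, rfl⟩
      simp [ha]
    · intro hb
      exact ⟨e.symm ⟨b, hb⟩, (e.symm ⟨b, hb⟩).2, by simp⟩
  · intro a ha b hb hab
    have ha' : a ∈ A := ha
    have hb' : b ∈ A := hb
    simp only [ha', hb', dif_pos] at hab
    simpa using hab

lemma exists_bij {A B : Finset ℕ} (h : A.card = B.card) : ∃ g g' : ℕ → ℕ, A.val.map g = B.val ∧
    B.val.map g' = A.val ∧ ∀ b ∈ B, g (g' b) = b := by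
  let e := Finset.equivOfCardEq h
  refine ⟨fun x => if h : x ∈ A then e ⟨x, h⟩ else 0, fun x => if h : x ∈ B then e.symm ⟨x, h⟩ else 0, ?_, ?_, ?_⟩
  · exact map_bij e
  · exact map_bij e.symm
  · intro b hb
    simp [hb]

lemma TId.le_of_card {I : Submodule K F} (hI : TId I) {A B : Finset ℕ} (h : A.card = B.card) :
    Module.finrank K ((LinearMap.range (eA K F B)).map I.mkQ) ≤
    Module.finrank K ((LinearMap.range (eA K F A)).map I.mkQ) := by
  obtain ⟨g, g', h1, h2, h3⟩ := exists_bij h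
  obtain ⟨θ, t1, t2⟩ := hI.sub (fun _ => 1) g
  have t1' : ∀ w, θ (wd K F w) = wd K F (w.map g) := by intro w; rw [t1]; simp
  have key : (LinearMap.range (eA K F B)).map I.mkQ ≤
      ((LinearMap.range (eA K F A)).map I.mkQ).map (I.mapQ I θ t2) := by
    rw [range_eA, Submodule.map_span, Submodule.span_le]
    rintro _ ⟨_, ⟨w, hw, rfl⟩, rfl⟩
    have hw : (w : Multiset ℕ) = B.val := hw
    refine ⟨I.mkQ (wd K F (w.map g')), ⟨_, ?_, rfl⟩, ?_⟩
    · rw [range_eA]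
      apply Submodule.subset_span
      refine ⟨_, ?_, rfl⟩
      change ((w.map g' : List ℕ) : Multiset ℕ) = A.val
      rw [← Multiset.map_coe, hw, h2]
    · change I.mkQ (θ _) = _
      rw [t1', List.map_map]
      congr 2
      conv_rhs => rw [← List.map_id w]
      apply List.map_congr_left
      intro b hb
      apply h3
      rw [← Finset.mem_val, ← hw]; simpa using hb
  exact (Submodule.finrank_mono key).trans (Submodule.finrank_map_le _ _)

lemma TId.eq_of_card {I : Submodule K F} (hI : TId I) {A B : Finset ℕ} (h : A.card = B.card) :
    Module.finrank K ((LinearMap.range (eA K F A)).map I.mkQ) =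
    Module.finrank K ((LinearMap.range (eA K F B)).map I.mkQ) :=
  le_antisymm (hI.le_of_card h.symm) (hI.le_of_card h)

/-- codimensions -/
noncomputable def cd (I : Submodule K F) (n : ℕ) : ℕ :=
  Module.finrank K (↥(LinearMap.range (eA K F (Finset.range n))) ⧸
    (I.comap (LinearMap.range (eA K F (Finset.range n))).subtype))

lemma TId.rank_eQ {I : Submodule K F} (hI : TId I) (sI : Stab I) (A : Finset ℕ) :
    Module.finrank K (LinearMap.range (eQ sI A)) = cd I A.card := by
  rw [range_eQ, cd]
  have := finrank_quot_comap I.mkQ (LinearMap.range (eA K F (Finset.range A.card)))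
  rw [Submodule.ker_mkQ] at this
  rw [this]
  exact hI.eq_of_card (by simp)

lemma TId.rank_ET {I J : Submodule K F} (hI : TId I) (hJ : TId J) (sI : Stab I) (sJ : Stab J) (T : Finset ℕ) :
    Module.finrank K (LinearMap.range (ET sI sJ T)) =
      ∑ k ∈ Finset.range (T.card + 1), T.card.choose k * (cd I k * cd J (T.card - k)) := by
  rw [(finrank_ET sI sJ T).2.2]
  have : ∀ A ∈ T.powerset, Module.finrank K (LinearMap.range (eQ sI A)) * 
        Module.finrank K (LinearMap.range (eQ sJ (T \ A))) = 
        (fun k => cd I k * cd J (T.card - k)) A.card := fun A hA => by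
    rw [hI.rank_eQ, hJ.rank_eQ, Finset.card_sdiff_of_subset (Finset.mem_powerset.1 hA)]
  rw [Finset.sum_congr rfl this, Finset.sum_powerset_apply_card (fun k => cd I k * cd J (T.card - k))]
  simp

theorem cd_formula [CharZero K] {I J : Submodule K F} (hI : TId I) (hJ : TId J) (n : ℕ) :
    cd (I * J) n + ∑ k ∈ Finset.range (n + 1), n.choose k * (cd I k * cd J (n - k)) =
    cd I n + (cd J n + n * ∑ k ∈ Finset.range (n - 1 + 1), (n-1).choose k * (cd I k * cd J (n - 1 - k))) := by
  have h := main_rank hI.stab hJ.stab hI.right hJ.left (Finset.range n)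
  rw [hI.rank_eQ, hJ.rank_eQ, hI.rank_ET hJ] at h
  have : ∀ x ∈ Finset.range n, Module.finrank K (LinearMap.range (ET hI.stab hJ.stab ((Finset.range n).erase x))) =
     ∑ k ∈ Finset.range (n - 1 + 1), (n-1).choose k * (cd I k * cd J (n - 1 - k)) := by
    intro x hx
    rw [hI.rank_ET hJ, Finset.card_erase_of_mem hx, Finset.card_range]
  rw [Finset.sum_congr rfl this, Finset.sum_const, Finset.card_range] at h
  rw [smul_eq_mul] at h
  exact h

end TI

section Free
variable (K : Type*) [Field K]

lemma FreeAlgebra_basis (w : FreeMonoid ℕ) : FreeAlgebra.basisFreeMonoid K ℕ w =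
    ((FreeMonoid.toList w).map (FreeAlgebra.ι K)).prod := by
  rw [FreeAlgebra.basisFreeMonoid, Module.Basis.map_apply, Finsupp.basisSingleOne]
  simp only [LinearEquiv.trans_symm, LinearEquiv.trans_apply, Module.Basis.coe_ofRepr, LinearEquiv.refl_symm, LinearEquiv.refl_apply]
  change FreeAlgebra.equivMonoidAlgebraFreeMonoid.symm (MonoidAlgebra.single w 1) = _
  rw [AlgEquiv.symm_apply_eq, map_list_prod, List.map_map]
  induction w using FreeMonoid.inductionOn' with
  | one => rfl
  | of_mul x w ih =>
    rw [FreeMonoid.toList_of_mul, List.map_cons, List.prod_cons, ← ih]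
    simp [FreeAlgebra.equivMonoidAlgebraFreeMonoid, MonoidAlgebra.single_mul_single]

noncomputable instance : FB K (FreeAlgebra K ℕ) where
  X := FreeAlgebra.ι K
  b := FreeAlgebra.basisFreeMonoid K ℕ
  hb := FreeAlgebra_basis K

lemma mp_eq (n : ℕ) : multilinearPart K n = LinearMap.range (eA K (FreeAlgebra K ℕ) (Finset.range n)) := by
  rw [range_eA, multilinearPart]
  congr 1
  ext f
  constructor
  · rintro ⟨σ, rfl⟩
    refine ⟨List.ofFn fun i : Fin n => ((σ i : Fin n) : ℕ), ?_, ?_⟩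
    · change ((List.ofFn fun i : Fin n => ((σ i : Fin n) : ℕ) : List ℕ) : Multiset ℕ) = _
      rw [Finset.range_val, Multiset.range, Multiset.coe_eq_coe]
      have := Equiv.Perm.ofFn_comp_perm σ (fun i : Fin n => (i : ℕ))
      refine this.trans ?_
      simp [List.ofFn_eq_map]
    · rw [wd, List.map_ofFn]; rfl
  · rintro ⟨w, hw, rfl⟩
    have hw : (w : Multiset ℕ) = (Finset.range n).val := hw
    have hl : w.length = n := by
      rw [← Multiset.coe_card, hw]; simp
    subst hl
    have hn : w.Nodup := by rw [← Multiset.coe_nodup, hw]; exact Finset.nodup _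
    have hlt : ∀ i : Fin w.length, w.get i < w.length := fun i => by
      have : w.get i ∈ (w : Multiset ℕ) := by simp
      rw [hw] at this; simpa using this
    have hinj : Function.Injective (fun i : Fin w.length => (⟨w.get i, hlt i⟩ : Fin w.length)) := by
      intro i j h
      simp only [Fin.mk.injEq] at h
      exact List.nodup_iff_injective_get.1 hn h
    refine ⟨Equiv.ofBijective _ (Finite.injective_iff_bijective.1 hinj), ?_⟩
    rw [wd]
    congr 1
    conv_lhs => rw [← List.ofFn_get w]
    rw [List.map_ofFn]
    rfl

lemma codim_eq (I : Submodule K (FreeAlgebra K ℕ)) (n : ℕ) : codim K I n = cd I n := by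
  rw [codim, cd, mp_eq]

lemma mem_Tideal {R : Type*} [Ring R] [Algebra K R] (f : FreeAlgebra K ℕ) :
    f ∈ Tideal K R ↔ ∀ φ : FreeAlgebra K ℕ →ₐ[K] R, φ f = 0 := by
  simp [Tideal]

lemma tid (R : Type*) [Ring R] [Algebra K R] : TId (Tideal K R) where
  left a ha b := by
    rw [mem_Tideal] at ha ⊢
    intro φ; rw [map_mul, ha, mul_zero]
  right a ha b := by
    rw [mem_Tideal] at ha ⊢
    intro φ; rw [map_mul, ha, zero_mul]
  sub c g := by
    refine ⟨(FreeAlgebra.lift K fun i => c i • FreeAlgebra.ι K (g i)).toLinearMap, ?_, ?_⟩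
    · intro w
      induction w with
      | nil => simp
      | cons x w ih =>
        have hx : ∀ x, xi K (FreeAlgebra K ℕ) x = FreeAlgebra.ι K x := fun _ => rfl
        rw [AlgHom.toLinearMap_apply] at ih ⊢
        rw [wd_cons, map_mul, ih, hx, FreeAlgebra.lift_ι_apply, List.map_cons, List.map_cons,
          List.prod_cons, wd_cons, hx, smul_mul_smul_comm]
    · intro f hf
      rw [mem_Tideal] at hf ⊢
      intro φ
      exact hf (φ.comp _)

theorem codim_formula [CharZero K] (R₁ R₂ : Type*) [Ring R₁] [Algebra K R₁] [Ring R₂] [Algebra K R₂] (n : ℕ) :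
    codim K (Tideal K R₁ * Tideal K R₂) n +
      ∑ k ∈ Finset.range (n + 1), n.choose k * (codim K (Tideal K R₁) k * codim K (Tideal K R₂) (n - k)) =
    codim K (Tideal K R₁) n + (codim K (Tideal K R₂) n + 
      n * ∑ k ∈ Finset.range (n - 1 + 1), (n-1).choose k * (codim K (Tideal K R₁) k * codim K (Tideal K R₂) (n - 1 - k))) := by
  simp only [codim_eq]
  exact cd_formula (tid K R₁) (tid K R₂) n

end Free
section PartD

/-- Algebraic power series, via Mathlib's `IsAlgebraic`. -/
abbrev AlgPS (b : PowerSeries ℂ) : Prop := IsAlgebraic (Polynomial ℂ) b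

theorem algMap_eq : algebraMap (Polynomial ℂ) (PowerSeries ℂ) =
    Polynomial.coeToPowerSeries.ringHom := by
  refine RingHom.ext fun p => ?_
  rw [PowerSeries.algebraMap_apply']
  simp

theorem algPS_iff (b : PowerSeries ℂ) : IsAlgebraicPS b ↔ AlgPS b := by
  unfold IsAlgebraicPS AlgPS IsAlgebraic
  simp only [Polynomial.aeval_def, algMap_eq]

theorem algPS_coe (p : Polynomial ℂ) : AlgPS (p : PowerSeries ℂ) := by
  have := isAlgebraic_algebraMap (R := Polynomial ℂ) (A := PowerSeries ℂ) p
  rw [algMap_eq] at this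
  exact this

theorem algPS_C (c : ℂ) : AlgPS (PowerSeries.C c) := by
  have := algPS_coe (Polynomial.C c)
  rwa [Polynomial.coe_C] at this

theorem algPS_X : AlgPS (PowerSeries.X) := by
  have := algPS_coe (Polynomial.X)
  rwa [Polynomial.coe_X] at this

theorem algPS_smul (c : ℂ) {b : PowerSeries ℂ} (hb : AlgPS b) : AlgPS (c • b) := by
  rw [PowerSeries.smul_eq_C_mul]
  exact (algPS_C c).mul hb

theorem algPS_cancel {y z : PowerSeries ℂ} (hy : y ≠ 0) (h1 : AlgPS y) (h2 : AlgPS (y * z)) :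
    AlgPS z :=
  IsAlgebraic.of_mul (mem_nonZeroDivisors_of_ne_zero hy) h1 h2

theorem algPS_aeval (F : Polynomial (Polynomial ℂ)) {b : PowerSeries ℂ} (hb : AlgPS b) :
    AlgPS (Polynomial.aeval b F) := by
  have : b ∈ Subalgebra.algebraicClosure (Polynomial ℂ) (PowerSeries ℂ) := hb
  exact (Algebra.adjoin_le (Set.singleton_subset_iff.mpr this))
    (Polynomial.aeval_mem_adjoin_singleton _ _)

theorem deriv_aeval (F : Polynomial (Polynomial ℂ)) {b : PowerSeries ℂ} (hb : AlgPS b) :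
    AlgPS (PowerSeries.derivative ℂ (Polynomial.aeval b F) -
      Polynomial.aeval b (Polynomial.derivative F) * PowerSeries.derivative ℂ b) := by
  induction F using Polynomial.induction_on' with
  | add p q hp hq =>
    have := hp.add hq
    simp only [map_add]
    convert this using 1
    ring
  | monomial n a =>
    have h : PowerSeries.derivative ℂ (Polynomial.aeval b (Polynomial.monomial n a)) -
      Polynomial.aeval b (Polynomial.derivative (Polynomial.monomial n a)) *
        PowerSeries.derivative ℂ b =
        (Polynomial.derivative a : PowerSeries ℂ) * b ^ n := by
      rw [Polynomial.derivative_monomial, Polynomial.aeval_monomial, Polynomial.aeval_monomial,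
        algMap_eq, Derivation.leibniz, PowerSeries.derivative_pow]
      simp only [Polynomial.coeToPowerSeries.ringHom_apply, PowerSeries.derivative_coe,
        smul_eq_mul, Polynomial.coe_mul]
      have : (((n : Polynomial ℂ)) : PowerSeries ℂ) = (n : PowerSeries ℂ) := by
        exact map_natCast (Polynomial.coeToPowerSeries.ringHom (R := ℂ)) n
      rw [this]
      ring
    rw [h]
    exact (algPS_coe _).mul (hb.pow n)

theorem algPS_deriv {b : PowerSeries ℂ} (hb : AlgPS b) : AlgPS (PowerSeries.derivative ℂ b) := by
  classical
  have hex : ∃ d, ∃ F : Polynomial (Polynomial ℂ), F ≠ 0 ∧ Polynomial.aeval b F = 0 ∧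
      F.natDegree = d := by
    obtain ⟨F, h1, h2⟩ := hb
    exact ⟨_, F, h1, h2, rfl⟩
  obtain ⟨F, h1, h2, h3⟩ := Nat.find_spec hex
  have hd : F.natDegree ≠ 0 := by
    intro h0
    rw [Polynomial.eq_C_of_natDegree_eq_zero h0, Polynomial.aeval_C, algMap_eq] at h2
    apply h1
    rw [Polynomial.eq_C_of_natDegree_eq_zero h0]
    have : F.coeff 0 = 0 := by
      apply Polynomial.coe_injective ℂ
      simpa using h2
    rw [this, map_zero]
  have hF' : Polynomial.aeval b (Polynomial.derivative F) ≠ 0 := by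
    intro h0
    have hlt := Polynomial.natDegree_derivative_lt hd
    rw [h3] at hlt
    refine Nat.find_min hex hlt ⟨_, ?_, h0, rfl⟩
    intro hz
    exact hd (Polynomial.derivative_eq_zero.mp hz)
  have h := deriv_aeval F hb
  rw [h2, map_zero, zero_sub] at h
  have h' := h.neg
  rw [neg_neg] at h'
  exact algPS_cancel hF' (algPS_aeval _ hb) h'

/-- the operator `a ↦ X * D (X * a)`. -/
noncomputable def opM (a : PowerSeries ℂ) : PowerSeries ℂ :=
  PowerSeries.X * PowerSeries.derivative ℂ (PowerSeries.X * a)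

theorem coeff_opM (a : PowerSeries ℂ) (n : ℕ) :
    PowerSeries.coeff n (opM a) = n * PowerSeries.coeff (n - 1) a := by
  unfold opM
  cases n with
  | zero => simp
  | succ n =>
    rw [PowerSeries.coeff_succ_X_mul, PowerSeries.coeff_derivative, PowerSeries.coeff_succ_X_mul]
    simp [mul_comm]

theorem algPS_opM {a : PowerSeries ℂ} (h : AlgPS a) : AlgPS (opM a) :=
  algPS_X.mul (algPS_deriv (algPS_X.mul h))

theorem opM_add (a b : PowerSeries ℂ) : opM (a + b) = opM a + opM b := by
  ext n; simp [coeff_opM, mul_add]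

theorem opM_smul (c : ℂ) (b : PowerSeries ℂ) : opM (c • b) = c • opM b := by
  ext n; simp [coeff_opM]; ring

/-- binomial convolution -/
noncomputable def sh (a b : PowerSeries ℂ) : PowerSeries ℂ :=
  PowerSeries.mk fun n => ∑ k ∈ Finset.range (n + 1), (n.choose k : ℂ) *
    (PowerSeries.coeff k a * PowerSeries.coeff (n - k) b)

/-- exponential generating function -/
noncomputable def egf (a : PowerSeries ℂ) : PowerSeries ℂ :=
  PowerSeries.mk fun n => PowerSeries.coeff n a / (n.factorial : ℂ)

theorem egf_inj {a b : PowerSeries ℂ} (h : egf a = egf b) : a = b := by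
  ext n
  have := congrArg (PowerSeries.coeff n) h
  simp only [egf, PowerSeries.coeff_mk] at this
  have hn : (n.factorial : ℂ) ≠ 0 := by exact_mod_cast n.factorial_ne_zero
  field_simp at this
  exact this

theorem egf_sh (a b : PowerSeries ℂ) : egf (sh a b) = egf a * egf b := by
  ext n
  rw [PowerSeries.coeff_mul, Finset.Nat.sum_antidiagonal_eq_sum_range_succ_mk]
  simp only [egf, sh, PowerSeries.coeff_mk]
  rw [Finset.sum_div]
  refine Finset.sum_congr rfl fun k hk => ?_
  have hk : k ≤ n := by simpa [Nat.lt_succ_iff] using hk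
  rw [Nat.cast_choose ℂ hk]
  have h1 : (n.factorial : ℂ) ≠ 0 := by exact_mod_cast n.factorial_ne_zero
  have h2 : (k.factorial : ℂ) ≠ 0 := by exact_mod_cast k.factorial_ne_zero
  have h3 : ((n-k).factorial : ℂ) ≠ 0 := by exact_mod_cast (n-k).factorial_ne_zero
  field_simp

theorem egf_opM (a : PowerSeries ℂ) : egf (opM a) = PowerSeries.X * egf a := by
  ext n
  cases n with
  | zero => simp [egf, coeff_opM]
  | succ n =>
    rw [PowerSeries.coeff_succ_X_mul]
    simp only [egf, PowerSeries.coeff_mk, coeff_opM, Nat.factorial_succ, Nat.add_sub_cancel]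
    have h1 : (n.factorial : ℂ) ≠ 0 := by exact_mod_cast n.factorial_ne_zero
    have h2 : ((n : ℂ) + 1) ≠ 0 := by exact_mod_cast n.succ_ne_zero
    push_cast
    field_simp

theorem egf_eq_zero {a : PowerSeries ℂ} (h : egf a = 0) : a = 0 :=
  egf_inj (h.trans (by ext n; simp [egf]))

theorem sh_opM_left (a b : PowerSeries ℂ) : sh (opM a) b = opM (sh a b) := by
  apply egf_inj
  rw [egf_sh, egf_opM, egf_opM, egf_sh]; ring

theorem sh_comm (a b : PowerSeries ℂ) : sh a b = sh b a := by
  apply egf_inj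
  rw [egf_sh, egf_sh]; ring

theorem sh_opM_right (a b : PowerSeries ℂ) : sh a (opM b) = opM (sh a b) := by
  rw [sh_comm, sh_opM_left, sh_comm]

theorem sh_add_left (a b c : PowerSeries ℂ) : sh (a + b) c = sh a c + sh b c := by
  ext n; simp [sh, add_mul, mul_add, Finset.sum_add_distrib]

theorem sh_add_right (a b c : PowerSeries ℂ) : sh a (b + c) = sh a b + sh a c := by
  rw [sh_comm, sh_add_left, sh_comm, sh_comm a c]

theorem sh_smul_left (r : ℂ) (a c : PowerSeries ℂ) : sh (r • a) c = r • sh a c := by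
  ext n; simp only [sh, PowerSeries.coeff_mk, PowerSeries.coeff_smul, smul_eq_mul, Finset.mul_sum]
  refine Finset.sum_congr rfl fun k _ => by ring

theorem sh_smul_right (r : ℂ) (a c : PowerSeries ℂ) : sh a (r • c) = r • sh a c := by
  rw [sh_comm, sh_smul_left, sh_comm]

theorem sh_one_right (a : PowerSeries ℂ) : sh a 1 = a := by
  apply egf_inj
  rw [egf_sh]
  have : egf 1 = 1 := by
    ext n
    simp only [egf, PowerSeries.coeff_mk, PowerSeries.coeff_one]
    split_ifs with h
    · simp [h]
    · simp
  rw [this, mul_one]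
open PowerSeries in
/-- geometric series -/
noncomputable def gu (l : ℂ) : PowerSeries ℂ := PowerSeries.mk fun n => l ^ n

theorem gu_eq (l : ℂ) : gu l = 1 + PowerSeries.C l * (PowerSeries.X * gu l) := by
  ext n
  cases n with
  | zero => simp [gu]
  | succ n =>
    rw [map_add, PowerSeries.coeff_C_mul, PowerSeries.coeff_succ_X_mul]
    simp [gu, PowerSeries.coeff_one, pow_succ, mul_comm]

theorem gu_mul (l : ℂ) : (1 - PowerSeries.C l * PowerSeries.X) * gu l = 1 := by
  have := gu_eq l
  linear_combination this

theorem gu_zero : gu 0 = 1 := by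
  have := gu_eq 0
  simpa using this

theorem algPS_gu (l : ℂ) : AlgPS (gu l) := by
  have h := gu_mul l
  refine algPS_cancel (y := 1 - PowerSeries.C l * PowerSeries.X) ?_ ?_ ?_
  · intro h0
    rw [h0, zero_mul] at h
    exact zero_ne_one h
  · exact (isAlgebraic_one).sub ((algPS_C l).mul algPS_X)
  · rw [h]; exact isAlgebraic_one

/-- `X * gu l` -/
noncomputable def gv (l : ℂ) : PowerSeries ℂ := PowerSeries.X * gu l

theorem deriv_gv (l : ℂ) : PowerSeries.derivative ℂ (gv l) = gu l ^ 2 := by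
  have h1 : PowerSeries.derivative ℂ (gu l) =
      PowerSeries.C l * PowerSeries.derivative ℂ (gv l) := by
    conv_lhs => rw [gu_eq l]
    rw [map_add, Derivation.leibniz, PowerSeries.derivative_C]
    simp [gv]
  have h2 : PowerSeries.derivative ℂ (gv l) =
      gu l + PowerSeries.X * PowerSeries.derivative ℂ (gu l) := by
    rw [gv, Derivation.leibniz, PowerSeries.derivative_X]
    simp [add_comm]
  rw [h1] at h2
  have h3 := gu_mul l
  linear_combination gu l * h2 - PowerSeries.derivative ℂ (gv l) * h3

theorem opM_gu (l : ℂ) (d : ℕ) :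
    opM (gu l * gv l ^ d) = ((d + 1 : ℕ) : ℂ) • (gu l * gv l ^ (d + 1)) := by
  have : PowerSeries.X * (gu l * gv l ^ d) = gv l ^ (d + 1) := by
    rw [pow_succ, gv]; ring
  rw [opM, this, PowerSeries.derivative_pow, deriv_gv, PowerSeries.smul_eq_C_mul]
  simp only [Nat.add_sub_cancel, map_natCast]
  rw [pow_succ (gv l) d]
  nth_rewrite 3 [gv]
  ring

theorem opM_X_pow (d : ℕ) :
    opM (PowerSeries.X ^ d) = ((d + 1 : ℕ) : ℂ) • (PowerSeries.X ^ (d + 1)) := by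
  have := opM_gu 0 d
  simpa [gv, gu_zero] using this

theorem smul_cancel_nat (d : ℕ) {a b : PowerSeries ℂ}
    (h : ((d + 1 : ℕ) : ℂ) • a = ((d + 1 : ℕ) : ℂ) • b) : a = b :=
  smul_right_injective _ (Nat.cast_ne_zero.mpr d.succ_ne_zero) h

theorem sh_gu_X_pow (l : ℂ) (d : ℕ) : sh (gu l) (PowerSeries.X ^ d) = gu l * gv l ^ d := by
  induction d with
  | zero => simp [sh_one_right]
  | succ d ih =>
    apply smul_cancel_nat d
    rw [← opM_gu, ← ih, ← sh_smul_right, ← opM_X_pow, sh_opM_right]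

theorem gv_hasSubst (l : ℂ) : PowerSeries.HasSubst (gv l) :=
  PowerSeries.HasSubst.of_constantCoeff_zero' (by simp [gv])

/-- substitution `X ↦ X/(1-lX)` -/
noncomputable def sg (l : ℂ) : PowerSeries ℂ →ₐ[ℂ] PowerSeries ℂ :=
  PowerSeries.substAlgHom (gv_hasSubst l)

theorem sg_X (l : ℂ) : sg l PowerSeries.X = gv l :=
  PowerSeries.substAlgHom_X (gv_hasSubst l)

theorem sh_gu_coe (l : ℂ) (p : Polynomial ℂ) :
    sh (gu l) (p : PowerSeries ℂ) = gu l * sg l p := by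
  induction p using Polynomial.induction_on' with
  | add p q hp hq => rw [Polynomial.coe_add, sh_add_right, hp, hq, map_add, mul_add]
  | monomial n a =>
    have : ((Polynomial.monomial n a : Polynomial ℂ) : PowerSeries ℂ) =
        a • PowerSeries.X ^ n := by
      rw [← Polynomial.C_mul_X_pow_eq_monomial, PowerSeries.smul_eq_C_mul]
      simp
    rw [this, sh_smul_right, sh_gu_X_pow, map_smul, map_pow, sg_X, mul_smul_comm]

theorem sh_gu (l : ℂ) (b : PowerSeries ℂ) : sh (gu l) b = gu l * sg l b := by
  ext n
  obtain ⟨c, hc⟩ : ∃ c, b = (PowerSeries.trunc (n + 1) b : PowerSeries ℂ) +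
      PowerSeries.X ^ (n + 1) * c := by
    have : PowerSeries.X ^ (n + 1) ∣ b - (PowerSeries.trunc (n + 1) b : PowerSeries ℂ) := by
      rw [PowerSeries.X_pow_dvd_iff]
      intro m hm
      rw [map_sub, Polynomial.coeff_coe, PowerSeries.coeff_trunc, if_pos hm, sub_self]
    obtain ⟨c, hc⟩ := this
    exact ⟨c, by rw [← hc]; ring⟩
  rw [hc, sh_add_right, map_add (sg l), mul_add, map_add, map_add, sh_gu_coe]
  congr 1
  have h1 : PowerSeries.coeff n (sh (gu l) (PowerSeries.X ^ (n + 1) * c)) = 0 := by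
    simp only [sh, PowerSeries.coeff_mk]
    refine Finset.sum_eq_zero fun k _ => ?_
    rw [PowerSeries.coeff_X_pow_mul', if_neg (by omega)]
    simp
  have h2 : gu l * sg l (PowerSeries.X ^ (n + 1) * c) =
      PowerSeries.X ^ (n + 1) * (gu l ^ (n + 2) * sg l c) := by
    rw [map_mul, map_pow, sg_X, gv]; ring
  rw [h1, h2, PowerSeries.coeff_X_pow_mul', if_neg (by omega)]

theorem gu_ne (l : ℂ) : gu l ≠ 0 := by
  intro h
  have := gu_mul l
  rw [h, mul_zero] at this
  exact zero_ne_one this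

theorem sg_inj (l : ℂ) {b : PowerSeries ℂ} (h : sg l b = 0) : b = 0 := by
  have h1 := sh_gu l b
  rw [h, mul_zero] at h1
  have h2 := egf_sh (gu l) b
  rw [h1] at h2
  have h3 : egf 0 = 0 := by ext n; simp [egf]
  rw [h3] at h2
  rcases mul_eq_zero.mp h2.symm with h | h
  · exact absurd (egf_eq_zero h) (gu_ne l)
  · exact egf_eq_zero h

theorem algPS_sg_coe (l : ℂ) (p : Polynomial ℂ) : AlgPS (sg l p) := by
  induction p using Polynomial.induction_on' with
  | add p q hp hq => rw [Polynomial.coe_add, map_add]; exact hp.add hq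
  | monomial n a =>
    have : ((Polynomial.monomial n a : Polynomial ℂ) : PowerSeries ℂ) =
        a • PowerSeries.X ^ n := by
      rw [← Polynomial.C_mul_X_pow_eq_monomial, PowerSeries.smul_eq_C_mul]
      simp
    rw [this, map_smul, map_pow, sg_X]
    exact algPS_smul _ ((algPS_X.mul (algPS_gu l)).pow n)

theorem algPS_sg (l : ℂ) {b : PowerSeries ℂ} (hb : AlgPS b) : AlgPS (sg l b) := by
  obtain ⟨F, hF, h0⟩ := hb
  let A := Subalgebra.algebraicClosure (Polynomial ℂ) (PowerSeries ℂ)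
  let ψ : Polynomial ℂ →+* PowerSeries ℂ :=
    (sg l : PowerSeries ℂ →+* PowerSeries ℂ).comp (algebraMap (Polynomial ℂ) (PowerSeries ℂ))
  have hψ : ∀ p, ψ p ∈ A := by
    intro p
    change AlgPS (sg l (algebraMap (Polynomial ℂ) (PowerSeries ℂ) p))
    rw [algMap_eq]
    exact algPS_sg_coe l p
  let φ : Polynomial ℂ →+* A := ψ.codRestrict A hψ
  have hφ : Function.Injective φ := by
    rw [injective_iff_map_eq_zero]
    intro p hp
    have h1 : ψ p = 0 := congrArg Subtype.val hp
    have h2 := sg_inj l h1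
    rw [algMap_eq] at h2
    exact Polynomial.coe_injective ℂ (by simpa using h2)
  have hA : IsAlgebraic A (sg l b) := by
    refine ⟨F.map φ, (Polynomial.map_ne_zero_iff hφ).mpr hF, ?_⟩
    rw [Polynomial.aeval_def, Polynomial.eval₂_map]
    have : (algebraMap A (PowerSeries ℂ)).comp φ = ψ := RingHom.ext fun p => rfl
    rw [this]
    have h := Polynomial.hom_eval₂ F (algebraMap (Polynomial ℂ) (PowerSeries ℂ))
      (sg l : PowerSeries ℂ →+* PowerSeries ℂ) b
    rw [← Polynomial.aeval_def, h0, map_zero] at h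
    exact h.symm
  exact hA.restrictScalars (Polynomial ℂ)

/-- Series whose binomial convolution preserves algebraicity. -/
noncomputable def WS : Submodule ℂ (PowerSeries ℂ) where
  carrier := {a | ∀ b, AlgPS b → AlgPS (sh a b)}
  add_mem' := by
    intro a a' h h' b hb
    rw [sh_add_left]; exact (h b hb).add (h' b hb)
  zero_mem' := by
    intro b _
    have : sh 0 b = 0 := by ext n; simp [sh]
    rw [this]; exact isAlgebraic_zero
  smul_mem' := by
    intro c a h b hb
    rw [sh_smul_left]; exact algPS_smul c (h b hb)

theorem WS_opM {a : PowerSeries ℂ} (h : a ∈ WS) : opM a ∈ WS := by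
  intro b hb
  rw [sh_opM_left]; exact algPS_opM (h b hb)

theorem WS_one : (1 : PowerSeries ℂ) ∈ WS := by
  intro b hb
  rw [sh_comm, sh_one_right]; exact hb

theorem WS_gu (l : ℂ) : gu l ∈ WS := by
  intro b hb
  rw [sh_gu]; exact (algPS_gu l).mul (algPS_sg l hb)

theorem WS_X_pow (n : ℕ) : (PowerSeries.X ^ n : PowerSeries ℂ) ∈ WS := by
  induction n with
  | zero => rw [pow_zero]; exact WS_one
  | succ n ih =>
    have h := WS_opM ih
    rw [opM_X_pow] at h
    exact (Submodule.smul_mem_iff _ (Nat.cast_ne_zero.mpr n.succ_ne_zero)).mp h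

theorem gu_rec (l : ℂ) (j : ℕ) :
    ((j + 1 : ℕ) : ℂ) • gu l ^ (j + 2) = l • opM (gu l ^ (j + 1)) +
      ((2 * j + 1 : ℕ) : ℂ) • gu l ^ (j + 1) - ((j : ℕ) : ℂ) • gu l ^ j := by
  have hD : PowerSeries.derivative ℂ (gu l) = PowerSeries.C l * gu l ^ 2 := by
    rw [← deriv_gv]
    conv_lhs => rw [gu_eq l]
    rw [map_add, Derivation.leibniz, PowerSeries.derivative_C]
    simp [gv]
  have hX : PowerSeries.C l * PowerSeries.X * gu l = gu l - 1 := by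
    linear_combination - gu_eq l
  have hM : l • opM (gu l ^ (j + 1)) = (PowerSeries.C l * PowerSeries.X * gu l) * gu l ^ j +
      ((j : PowerSeries ℂ) + 1) * (PowerSeries.C l * PowerSeries.X * gu l) ^ 2 * gu l ^ j := by
    rw [opM, Derivation.leibniz, PowerSeries.derivative_pow, hD, PowerSeries.derivative_X,
      PowerSeries.smul_eq_C_mul]
    simp only [smul_eq_mul, Nat.add_sub_cancel]
    push_cast
    ring
  rw [hM, hX]
  simp only [PowerSeries.smul_eq_C_mul, map_natCast]
  push_cast
  ring

theorem WS_gu_pow (l : ℂ) (j : ℕ) : gu l ^ j ∈ WS ∧ gu l ^ (j + 1) ∈ WS := by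
  induction j with
  | zero => simpa using ⟨WS_one, WS_gu l⟩
  | succ j ih =>
    refine ⟨ih.2, ?_⟩
    have h : ((j + 1 : ℕ) : ℂ) • gu l ^ (j + 2) ∈ WS := by
      rw [gu_rec]
      exact WS.sub_mem (WS.add_mem (WS.smul_mem _ (WS_opM ih.2)) (WS.smul_mem _ ih.2))
        (WS.smul_mem _ ih.1)
    exact (Submodule.smul_mem_iff _ (Nat.cast_ne_zero.mpr j.succ_ne_zero)).mp h

/-- span of partial fractions -/
noncomputable def PF : Submodule ℂ (PowerSeries ℂ) :=
  Submodule.span ℂ ({a | ∃ n : ℕ, a = PowerSeries.X ^ n} ∪ {a | ∃ (l : ℂ) (j : ℕ), a = gu l ^ j})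

theorem PF_X (n : ℕ) : (PowerSeries.X ^ n : PowerSeries ℂ) ∈ PF :=
  Submodule.subset_span (Or.inl ⟨n, rfl⟩)

theorem PF_gu (l : ℂ) (j : ℕ) : gu l ^ j ∈ PF :=
  Submodule.subset_span (Or.inr ⟨l, j, rfl⟩)

theorem PF_le : PF ≤ WS := by
  refine Submodule.span_le.mpr ?_
  rintro a (⟨n, rfl⟩ | ⟨l, j, rfl⟩)
  · exact WS_X_pow n
  · exact (WS_gu_pow l j).1

theorem PF_mul (c : PowerSeries ℂ) (h1 : ∀ n : ℕ, c * PowerSeries.X ^ n ∈ PF)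
    (h2 : ∀ l j, c * gu l ^ j ∈ PF) {a : PowerSeries ℂ} (ha : a ∈ PF) : c * a ∈ PF := by
  have : PF ≤ PF.comap (LinearMap.mulLeft ℂ c) := by
    refine Submodule.span_le.mpr ?_
    rintro a (⟨n, rfl⟩ | ⟨l, j, rfl⟩)
    · exact h1 n
    · exact h2 l j
  exact this ha

theorem PF_X_mul {a : PowerSeries ℂ} (ha : a ∈ PF) : PowerSeries.X * a ∈ PF := by
  refine PF_mul _ (fun n => ?_) (fun l j => ?_) ha
  · rw [← pow_succ']; exact PF_X _
  · cases j with
    | zero => simpa using PF_X 1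
    | succ j =>
      by_cases hl : l = 0
      · rw [hl, gu_zero]; simpa using PF_X 1
      · have h : l • (PowerSeries.X * gu l ^ (j + 1)) = gu l ^ (j + 1) - gu l ^ j := by
          rw [PowerSeries.smul_eq_C_mul]
          linear_combination - gu l ^ j * gu_eq l
        have h' : l • (PowerSeries.X * gu l ^ (j + 1)) ∈ PF := by
          rw [h]; exact PF.sub_mem (PF_gu _ _) (PF_gu _ _)
        exact (Submodule.smul_mem_iff _ hl).mp h'

theorem PF_gu_mul (l : ℂ) {a : PowerSeries ℂ} (ha : a ∈ PF) : gu l * a ∈ PF := by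
  refine PF_mul _ (fun n => ?_) (fun m j => ?_) ha
  · induction n with
    | zero => simpa using PF_gu l 1
    | succ n ih =>
      have := PF_X_mul ih
      rw [pow_succ]
      convert this using 1
      ring
  · by_cases hm : l = m
    · rw [hm, ← pow_succ']; exact PF_gu _ _
    · induction j with
      | zero => simpa using PF_gu l 1
      | succ j ih =>
        have h : (m - l) • (gu l * gu m ^ (j + 1)) = m • gu m ^ (j + 1) -
            l • (gu l * gu m ^ j) := by
          simp only [PowerSeries.smul_eq_C_mul, map_sub]
          linear_combination gu m ^ j * (PowerSeries.C m * gu m * gu_mul l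
            - PowerSeries.C l * gu l * gu_mul m)
        have h' : (m - l) • (gu l * gu m ^ (j + 1)) ∈ PF := by
          rw [h]; exact PF.sub_mem (PF.smul_mem _ (PF_gu _ _)) (PF.smul_mem _ ih)
        exact (Submodule.smul_mem_iff _ (sub_ne_zero.mpr (Ne.symm hm))).mp h'

theorem PF_coe (p : Polynomial ℂ) : (p : PowerSeries ℂ) ∈ PF := by
  induction p using Polynomial.induction_on' with
  | add p q hp hq => rw [Polynomial.coe_add]; exact PF.add_mem hp hq
  | monomial n a =>
    have : ((Polynomial.monomial n a : Polynomial ℂ) : PowerSeries ℂ) =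
        a • PowerSeries.X ^ n := by
      rw [← Polynomial.C_mul_X_pow_eq_monomial, PowerSeries.smul_eq_C_mul]
      simp
    rw [this]; exact PF.smul_mem _ (PF_X n)

theorem PF_root (r : ℂ) (hr : r ≠ 0) (a : PowerSeries ℂ)
    (h : (PowerSeries.X - PowerSeries.C r) * a ∈ PF) : a ∈ PF := by
  have h1 := PF_gu_mul r⁻¹ h
  have h2 : gu r⁻¹ * ((PowerSeries.X - PowerSeries.C r) * a) = (-r) • a := by
    have h3 : PowerSeries.C r * PowerSeries.C r⁻¹ = (1 : PowerSeries ℂ) := by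
      rw [← map_mul, mul_inv_cancel₀ hr, map_one]
    rw [PowerSeries.smul_eq_C_mul, map_neg]
    linear_combination (- PowerSeries.C r * a) * gu_mul r⁻¹ - PowerSeries.X * a * gu r⁻¹ * h3
  rw [h2] at h1
  exact (Submodule.smul_mem_iff _ (neg_ne_zero.mpr hr)).mp h1

theorem PF_roots (s : Multiset ℂ) (hs : ∀ r ∈ s, r ≠ 0) (a : PowerSeries ℂ)
    (h : (((s.map fun r => Polynomial.X - Polynomial.C r).prod : Polynomial ℂ) :
      PowerSeries ℂ) * a ∈ PF) : a ∈ PF := by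
  induction s using Multiset.induction_on generalizing a with
  | empty => simpa using h
  | cons r s ih =>
    rw [Multiset.map_cons, Multiset.prod_cons, Polynomial.coe_mul, mul_assoc] at h
    refine ih (fun x hx => hs x (Multiset.mem_cons_of_mem hx)) _
      (PF_root r (hs r (Multiset.mem_cons_self r s)) _ ?_)
    simpa using h

theorem rational_mem_PF {a : PowerSeries ℂ} (h : IsRationalPS a) : a ∈ PF := by
  obtain ⟨p, q, hq, hpq⟩ := h
  have hq0 : q ≠ 0 := by rintro rfl; simp at hq
  have hsp := (IsAlgClosed.splits q).eq_prod_roots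
  have h1 : (q : PowerSeries ℂ) * a ∈ PF := by rw [hpq]; exact PF_coe p
  rw [hsp, Polynomial.coe_mul, Polynomial.coe_C, mul_assoc, ← PowerSeries.smul_eq_C_mul] at h1
  have h2 := (Submodule.smul_mem_iff _ (Polynomial.leadingCoeff_ne_zero.mpr hq0)).mp h1
  refine PF_roots _ ?_ _ h2
  rintro r hr rfl
  rw [Polynomial.mem_roots hq0, Polynomial.IsRoot, ← Polynomial.coeff_zero_eq_eval_zero] at hr
  exact hq hr

theorem series_final (a b c : PowerSeries ℂ) (ha : IsRationalPS a) (hb : AlgPS b)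
    (h : c + sh a b = a + (b + opM (sh a b))) : AlgPS c := by
  have hW := PF_le (rational_mem_PF ha)
  have hab := hW b hb
  have haa : AlgPS a := by
    have := hW 1 isAlgebraic_one
    rwa [sh_one_right] at this
  have : c = a + (b + opM (sh a b)) - sh a b := by rw [← h]; ring
  rw [this]
  exact (haa.add (hb.add (algPS_opM hab))).sub hab

end PartD

end CodimProof

/-- If `T(R) = T(R₁)·T(R₂)` for unital PI-algebras `R, R₁, R₂` over a field of
characteristic 0, the codimension series of `R₁` is rational and that of `R₂` is
algebraic over ℂ(t), then the codimension series of `R` is algebraic over ℂ(t). -/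
theorem codimSeries_isAlgebraic_of_Tideal_mul
    (K : Type*) [Field K] [CharZero K]
    (R R₁ R₂ : Type*) [Ring R] [Algebra K R] [Ring R₁] [Algebra K R₁]
    [Ring R₂] [Algebra K R₂]
    (hPI : Tideal K R ≠ ⊥) (hPI₁ : Tideal K R₁ ≠ ⊥) (hPI₂ : Tideal K R₂ ≠ ⊥)
    (hT : Tideal K R = Tideal K R₁ * Tideal K R₂)
    (h₁ : IsRationalPS (codimSeries K (Tideal K R₁)))
    (h₂ : IsAlgebraicPS (codimSeries K (Tideal K R₂))) :
    IsAlgebraicPS (codimSeries K (Tideal K R)) := by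
  rw [CodimProof.algPS_iff] at h₂ ⊢
  refine CodimProof.series_final _ _ _ h₁ h₂ ?_
  ext n
  have h := CodimProof.codim_formula K R₁ R₂ n
  rw [← hT] at h
  have h' := congrArg (Nat.cast : ℕ → ℂ) h
  push_cast at h'
  simp only [map_add, CodimProof.coeff_opM, CodimProof.sh, codimSeries, PowerSeries.coeff_mk]
  exact h'
end

section
/- Let (a_n), (b_n), (c_n) be sequences of complex numbers whose exponential generating functions satisfy c̃(t) = ã(t) + b̃(t) + (e^t − 1)·ã(t)·b̃(t) in ℂ[[t]]. If the ordinary generating function a(t) = Σ a_n tⁿ is rational and the ordinary generating function b(t) = Σ b_n tⁿ is algebraic over ℂ(t), then the ordinary generating function c(t) = Σ c_n tⁿ is also algebraic over ℂ(t). -/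
/-- The exponential generating function of a sequence:  `∑ aₙ tⁿ/n!`. -/
noncomputable def egf (a : ℕ → ℂ) : PowerSeries ℂ :=
  PowerSeries.mk fun n => a n / n.factorial

/-- The formal exponential series `e^t = ∑ tⁿ/n!`. -/
noncomputable def expPS : PowerSeries ℂ :=
  PowerSeries.mk fun n => 1 / n.factorial

open PowerSeries in
theorem isAlgebraicPS_iff' (b : PowerSeries ℂ) :
    IsAlgebraicPS b ↔ IsAlgebraic (Polynomial ℂ) b := by
  have h : algebraMap (Polynomial ℂ) (PowerSeries ℂ) = Polynomial.coeToPowerSeries.ringHom := by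
    ext <;> simp [PowerSeries.algebraMap_apply']
  unfold IsAlgebraicPS IsAlgebraic
  simp only [Polynomial.aeval_def, h]

namespace EgfAux

open PowerSeries

instance : FaithfulSMul (Polynomial ℂ) (PowerSeries ℂ) := by
  rw [faithfulSMul_iff_algebraMap_injective]
  intro p q h
  simpa [PowerSeries.algebraMap_apply'] using h

theorem algMap_eq (p : Polynomial ℂ) :
    algebraMap (Polynomial ℂ) (PowerSeries ℂ) p = (p : PowerSeries ℂ) := by
  simp [PowerSeries.algebraMap_apply']

theorem alg_coe (p : Polynomial ℂ) : IsAlgebraic (Polynomial ℂ) (p : PowerSeries ℂ) := by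
  rw [← algMap_eq]; exact isAlgebraic_algebraMap p

theorem alg_aeval {b : PowerSeries ℂ} (hb : IsAlgebraic (Polynomial ℂ) b)
    (F : Polynomial (Polynomial ℂ)) : IsAlgebraic (Polynomial ℂ) (Polynomial.aeval b F) := by
  rw [Polynomial.aeval_eq_sum_range, ← Subalgebra.mem_algebraicClosure]
  refine Subalgebra.sum_mem _ fun i _ => Subalgebra.smul_mem _ (Subalgebra.pow_mem _ ?_ _) _
  rwa [Subalgebra.mem_algebraicClosure]

theorem deriv_aeval (b : PowerSeries ℂ) (F : Polynomial (Polynomial ℂ)) :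
    ∃ G : Polynomial (Polynomial ℂ), d⁄dX ℂ (Polynomial.aeval b F) =
      Polynomial.aeval b G + Polynomial.aeval b (Polynomial.derivative F) * d⁄dX ℂ b := by
  induction F using Polynomial.induction_on' with
  | add p q hp hq =>
    obtain ⟨G, hG⟩ := hp
    obtain ⟨H, hH⟩ := hq
    refine ⟨G + H, ?_⟩
    simp only [map_add, hG, hH]; ring
  | monomial n p =>
    refine ⟨Polynomial.monomial n (Polynomial.derivative p), ?_⟩
    simp only [Polynomial.aeval_monomial, algMap_eq, Derivation.leibniz, derivative_coe,
      derivative_pow, Polynomial.derivative_monomial, smul_eq_mul]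
    have hc : ((n : Polynomial ℂ) : PowerSeries ℂ) = (n : PowerSeries ℂ) := by
      rw [← Polynomial.coeToPowerSeries.ringHom_apply, map_natCast]
    rw [Polynomial.coe_mul, hc]
    ring

theorem alg_deriv {b : PowerSeries ℂ} (hb : IsAlgebraic (Polynomial ℂ) b) :
    IsAlgebraic (Polynomial ℂ) (d⁄dX ℂ b) := by
  classical
  have hex : ∃ n, ∃ F : Polynomial (Polynomial ℂ), F ≠ 0 ∧ Polynomial.aeval b F = 0 ∧
      F.natDegree = n := by
    obtain ⟨F, h1, h2⟩ := hb
    exact ⟨_, F, h1, h2, rfl⟩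
  obtain ⟨F, hF, hFb, hn⟩ := Nat.find_spec hex
  have hmin := fun m (hm : m < Nat.find hex) => Nat.find_min hex hm
  have hdeg : F.natDegree ≠ 0 := by
    intro h0
    rw [Polynomial.eq_C_of_natDegree_eq_zero h0, Polynomial.aeval_C] at hFb
    have : F.coeff 0 = 0 := by
      apply FaithfulSMul.algebraMap_injective (Polynomial ℂ) (PowerSeries ℂ)
      rw [hFb, map_zero]
    apply hF
    rw [Polynomial.eq_C_of_natDegree_eq_zero h0, this, map_zero]
  have hne : Polynomial.aeval b (Polynomial.derivative F) ≠ 0 := by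
    intro h0
    have hlt := Polynomial.natDegree_derivative_lt hdeg
    refine hmin _ (hn ▸ hlt) ⟨_, ?_, h0, rfl⟩
    intro h
    exact hdeg (Polynomial.derivative_eq_zero.1 h)
  obtain ⟨G, hG⟩ := deriv_aeval b F
  rw [hFb, map_zero] at hG
  refine IsAlgebraic.of_mul (mem_nonZeroDivisors_of_ne_zero hne) (alg_aeval hb _) ?_
  rw [show Polynomial.aeval b (Polynomial.derivative F) * d⁄dX ℂ b = - Polynomial.aeval b G by
    linear_combination -hG]
  exact (alg_aeval hb _).neg

/-- formal Laplace–Borel transform -/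
noncomputable def L : PowerSeries ℂ →ₗ[ℂ] PowerSeries ℂ where
  toFun f := PowerSeries.mk fun n => (n.factorial : ℂ) * coeff n f
  map_add' f g := by ext n; simp [mul_add]
  map_smul' r f := by ext n; simp; ring

theorem coeff_L (f : PowerSeries ℂ) (n : ℕ) : coeff n (L f) = (n.factorial : ℂ) * coeff n f := by
  simp [L]

theorem L_inj {f : PowerSeries ℂ} (h : L f = 0) : f = 0 := by
  ext n
  have := congrArg (coeff n) h
  rw [coeff_L] at this
  simpa [Nat.factorial_ne_zero] using this

theorem L_surj (g : PowerSeries ℂ) : ∃ f, L f = g := by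
  refine ⟨PowerSeries.mk fun n => coeff n g / n.factorial, ?_⟩
  ext n
  rw [coeff_L, coeff_mk, mul_div_cancel₀]
  exact_mod_cast Nat.factorial_ne_zero n

theorem L_egf (a : ℕ → ℂ) : L (egf a) = PowerSeries.mk a := by
  ext n
  rw [coeff_L, egf, coeff_mk, coeff_mk, mul_div_cancel₀]
  exact_mod_cast Nat.factorial_ne_zero n

theorem L_X_mul (f : PowerSeries ℂ) : L (X * f) = X * d⁄dX ℂ (X * L f) := by
  ext n
  rw [coeff_L]
  cases n with
  | zero => simp
  | succ n =>
    rw [coeff_succ_X_mul, coeff_succ_X_mul, coeff_derivative, coeff_succ_X_mul, coeff_L,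
      Nat.factorial_succ]
    push_cast; ring

theorem alg_X_mul {f : PowerSeries ℂ} (h : IsAlgebraic (Polynomial ℂ) (L f)) :
    IsAlgebraic (Polynomial ℂ) (L (X * f)) := by
  have hX : IsAlgebraic (Polynomial ℂ) (X : PowerSeries ℂ) := by
    simpa using alg_coe Polynomial.X
  rw [L_X_mul]
  exact hX.mul (alg_deriv (hX.mul h))

/-- `e^{lt}` -/
noncomputable def E (l : ℂ) : PowerSeries ℂ := PowerSeries.mk fun n => l ^ n / n.factorial

theorem E_eq (l : ℂ) : E l = rescale l (exp ℂ) := by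
  ext n; simp [E, coeff_rescale, coeff_exp, div_eq_mul_inv]

theorem E_mul (l m : ℂ) : E l * E m = E (l + m) := by
  simp only [E_eq, exp_mul_exp_eq_exp_add]

theorem E_zero : E 0 = 1 := by
  rw [E_eq]; simp

theorem deriv_E (l : ℂ) : d⁄dX ℂ (E l) = l • E l := by
  ext n
  rw [coeff_derivative, coeff_smul]
  simp only [E, coeff_mk, Nat.factorial_succ, smul_eq_mul]
  have := Nat.factorial_ne_zero n
  have h2 : (n : ℂ) + 1 ≠ 0 := by exact_mod_cast Nat.succ_ne_zero n
  push_cast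
  field_simp
  ring

/-- `1/(1-lt)` -/
noncomputable def U (l : ℂ) : PowerSeries ℂ := PowerSeries.mk fun n => l ^ n

theorem U_eq (l : ℂ) : U l = rescale l (PowerSeries.mk 1) := by
  ext n; simp [U, coeff_rescale]

theorem U_mul (l : ℂ) : U l * (1 - C l * X) = 1 := by
  rw [U_eq]
  have := congrArg (rescale l) (mk_one_mul_one_sub_eq_one ℂ)
  simpa [rescale_X] using this

theorem coeff_U_pow (l : ℂ) (d n : ℕ) :
    coeff n (U l ^ (d + 1)) = l ^ n * ((d + n).choose d : ℂ) := by
  rw [U_eq, ← map_pow, mk_one_pow_eq_mk_choose_add, coeff_rescale, coeff_mk]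

theorem hasSubst_XU (l : ℂ) : HasSubst (X * U l : PowerSeries ℂ) :=
  HasSubst.of_constantCoeff_zero' (by simp)

theorem coeff_subst_le (l : ℂ) (g : PowerSeries ℂ) {j n : ℕ} (h : j ≤ n) :
    coeff j (g.subst (X * U l) : PowerSeries ℂ) =
      ∑ k ∈ Finset.range (n + 1), coeff k g * coeff j ((X * U l) ^ k) := by
  rw [coeff_subst' (hasSubst_XU l)]
  simp only [smul_eq_mul]
  apply finsum_eq_sum_of_support_subset
  intro k hk
  by_contra hk'
  apply hk
  simp only [Finset.coe_range, Set.mem_Iio, not_lt] at hk'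
  simp only
  rw [mul_pow, coeff_X_pow_mul', if_neg (by omega), mul_zero]

theorem L_E_mul (l : ℂ) (f : PowerSeries ℂ) :
    L (E l * f) = U l * ((L f).subst (X * U l) : PowerSeries ℂ) := by
  ext n
  have h1 : coeff n (U l * ((L f).subst (X * U l) : PowerSeries ℂ)) =
      ∑ k ∈ Finset.range (n + 1), coeff k (L f) * coeff n (U l * (X * U l) ^ k) := by
    rw [coeff_mul]
    rw [Finset.sum_congr rfl (fun p hp => by
      rw [coeff_subst_le l (L f) (n := n) (by have := Finset.HasAntidiagonal.mem_antidiagonal.1 hp; omega)])]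
    simp only [Finset.mul_sum]
    rw [Finset.sum_comm]
    refine Finset.sum_congr rfl fun k _ => ?_
    rw [coeff_mul, Finset.mul_sum]
    refine Finset.sum_congr rfl fun p _ => by ring
  rw [h1, coeff_L, mul_comm, mul_comm (E l), coeff_mul, Finset.Nat.sum_antidiagonal_eq_sum_range_succ_mk,
    Finset.sum_mul]
  refine Finset.sum_congr rfl fun k hk => ?_
  have hk' : k ≤ n := by simpa [Nat.lt_succ_iff] using hk
  rw [show U l * (X * U l) ^ k = X ^ k * U l ^ (k + 1) by ring, coeff_X_pow_mul', if_pos hk',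
    coeff_U_pow, coeff_L]
  simp only [E, coeff_mk]
  obtain ⟨m, rfl⟩ := Nat.exists_eq_add_of_le hk'
  simp only [add_tsub_cancel_left]
  have := Nat.add_choose_mul_factorial_mul_factorial k m
  rw [Nat.choose_symm_add.symm] at this
  have h3 : ((k + m).choose k : ℂ) * k.factorial * m.factorial = (k + m).factorial := by
    exact_mod_cast this
  have := Nat.factorial_ne_zero m
  rw [← h3]
  field_simp

theorem subst_inj (l : ℂ) {g : PowerSeries ℂ} (h : (g.subst (X * U l) : PowerSeries ℂ) = 0) :
    g = 0 := by
  obtain ⟨f, rfl⟩ := L_surj g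
  have h2 := L_E_mul l f
  rw [h, mul_zero] at h2
  have h3 := L_inj h2
  have : f = E (-l) * (E l * f) := by rw [← mul_assoc, E_mul]; simp [E_zero]
  rw [this, h3, mul_zero, map_zero]

theorem subst_poly (l : ℂ) (P : Polynomial ℂ) (N : ℕ) (hN : P.natDegree ≤ N) :
    ∃ Q : Polynomial ℂ, (Q : PowerSeries ℂ) =
      (1 - C l * X) ^ N * ((P : PowerSeries ℂ).subst (X * U l) : PowerSeries ℂ) := by
  refine ⟨∑ i ∈ Finset.range (N + 1), Polynomial.C (P.coeff i) * Polynomial.X ^ i *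
    (1 - Polynomial.C l * Polynomial.X) ^ (N - i), ?_⟩
  rw [subst_coe (hasSubst_XU l), Polynomial.aeval_eq_sum_range' (Nat.lt_succ_of_le hN),
    Finset.mul_sum, ← Polynomial.coeToPowerSeries.ringHom_apply, map_sum]
  refine Finset.sum_congr rfl fun i hi => ?_
  have hi' : i ≤ N := by simpa [Nat.lt_succ_iff] using hi
  simp only [map_mul, map_pow, map_sub, map_one, Polynomial.coeToPowerSeries.ringHom_apply,
    Polynomial.coe_C, Polynomial.coe_X]
  obtain ⟨m, rfl⟩ := Nat.exists_eq_add_of_le hi'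
  have h := congrArg (· ^ i) (U_mul l)
  simp only [mul_pow, one_pow] at h
  rw [smul_eq_C_mul, add_tsub_cancel_left, mul_pow]
  linear_combination (- (C (P.coeff i)) * X ^ i * (1 - C l * X) ^ m) * h

theorem alg_subst (l : ℂ) {g : PowerSeries ℂ} (h : IsAlgebraic (Polynomial ℂ) g) :
    IsAlgebraic (Polynomial ℂ) (g.subst (X * U l) : PowerSeries ℂ) := by
  obtain ⟨F, hF, hFg⟩ := h
  obtain ⟨N, hN⟩ : ∃ N, ∀ j ∈ Finset.range (F.natDegree + 1), (F.coeff j).natDegree ≤ N :=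
    ⟨_, fun j hj => Finset.le_sup (f := fun j => (F.coeff j).natDegree) hj⟩
  have hQ : ∀ j, ∃ Q : Polynomial ℂ, j ∈ Finset.range (F.natDegree + 1) → (Q : PowerSeries ℂ) =
      (1 - C l * X) ^ N * ((F.coeff j : PowerSeries ℂ).subst (X * U l) : PowerSeries ℂ) := by
    intro j
    by_cases hj : j ∈ Finset.range (F.natDegree + 1)
    · obtain ⟨Q, hQ⟩ := subst_poly l (F.coeff j) N (hN j hj)
      exact ⟨Q, fun _ => hQ⟩
    · exact ⟨0, fun h => absurd h hj⟩
  choose Q hQ using hQ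
  refine ⟨∑ j ∈ Finset.range (F.natDegree + 1), Polynomial.monomial j (Q j), ?_, ?_⟩
  · intro h0
    have h1 := congrArg (fun p => Polynomial.coeff p F.natDegree) h0
    simp only [Polynomial.finsetSum_coeff, Polynomial.coeff_monomial, Polynomial.coeff_zero,
      Finset.sum_ite_eq', Finset.self_mem_range_succ, if_true] at h1
    have h2 := hQ F.natDegree (Finset.self_mem_range_succ _)
    rw [h1, Polynomial.coe_zero] at h2
    have h3 : (1 - C l * X : PowerSeries ℂ) ^ N ≠ 0 := by
      apply pow_ne_zero
      intro h
      have := U_mul l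
      rw [h, mul_zero] at this
      exact zero_ne_one this
    have h4 := subst_inj l ((mul_eq_zero.1 h2.symm).resolve_left h3)
    rw [Polynomial.coe_eq_zero_iff] at h4
    exact hF (Polynomial.leadingCoeff_eq_zero.1 h4)
  · have h5 := congrArg (substAlgHom (R := ℂ) (hasSubst_XU l)) hFg
    rw [Polynomial.aeval_eq_sum_range, map_sum, map_zero] at h5
    rw [map_sum, ← mul_zero ((1 - C l * X : PowerSeries ℂ) ^ N), ← h5, Finset.mul_sum]
    refine Finset.sum_congr rfl fun j hj => ?_
    rw [Polynomial.aeval_monomial, algMap_eq, hQ j hj, Algebra.smul_def, algMap_eq, map_mul,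
      map_pow, coe_substAlgHom, mul_assoc]

theorem alg_U (l : ℂ) : IsAlgebraic (Polynomial ℂ) (U l) := by
  have hne : (1 - C l * X : PowerSeries ℂ) ≠ 0 := by
    intro h
    have := U_mul l
    rw [h, mul_zero] at this
    exact zero_ne_one this
  refine IsAlgebraic.of_mul (mem_nonZeroDivisors_of_ne_zero hne) ?_ ?_
  · have := alg_coe (1 - Polynomial.C l * Polynomial.X)
    rw [← Polynomial.coeToPowerSeries.ringHom_apply] at this
    simpa only [map_sub, map_mul, map_one, Polynomial.coeToPowerSeries.ringHom_apply,
      Polynomial.coe_C, Polynomial.coe_X] using this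
  · rw [mul_comm, U_mul]; exact isAlgebraic_one

theorem alg_E_mul (l : ℂ) {f : PowerSeries ℂ} (h : IsAlgebraic (Polynomial ℂ) (L f)) :
    IsAlgebraic (Polynomial ℂ) (L (E l * f)) := by
  rw [L_E_mul]
  exact (alg_U l).mul (alg_subst l h)

/-- exponential polynomials -/
noncomputable def T : Submodule ℂ (PowerSeries ℂ) :=
  Submodule.span ℂ (Set.range fun p : ℕ × ℂ => X ^ p.1 * E p.2)

theorem mem_T (k : ℕ) (l : ℂ) : X ^ k * E l ∈ T := Submodule.subset_span ⟨(k, l), rfl⟩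

theorem T_ind {p : PowerSeries ℂ → Prop} (h0 : p 0) (hadd : ∀ f g, p f → p g → p (f + g))
    (hs : ∀ (r : ℂ) f, p f → p (r • f)) (hg : ∀ k l, p (X ^ k * E l)) {f : PowerSeries ℂ}
    (hf : f ∈ T) : p f := by
  refine Submodule.span_induction (p := fun f _ => p f) ?_ h0 (fun f g _ _ => hadd f g)
    (fun r f _ => hs r f) hf
  rintro _ ⟨⟨k, l⟩, rfl⟩
  exact hg k l

theorem alg_T_mul {f : PowerSeries ℂ} (hf : f ∈ T) {g : PowerSeries ℂ}
    (hg : IsAlgebraic (Polynomial ℂ) (L g)) : IsAlgebraic (Polynomial ℂ) (L (f * g)) := by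
  refine T_ind (p := fun f => IsAlgebraic (Polynomial ℂ) (L (f * g))) ?_ ?_ ?_ ?_ hf
  · simpa using isAlgebraic_zero
  · intro f1 f2 h1 h2
    rw [add_mul, map_add]; exact h1.add h2
  · intro r f h
    rw [smul_mul_assoc, map_smul, smul_eq_C_mul]
    refine IsAlgebraic.mul ?_ h
    simpa using alg_coe (Polynomial.C r)
  · intro k l
    induction k with
    | zero => simpa using alg_E_mul l hg
    | succ k ih =>
      rw [pow_succ', mul_assoc, mul_assoc, ← mul_assoc (X ^ k)]
      exact alg_X_mul ih

theorem E_mul_mem (m : ℂ) {f : PowerSeries ℂ} (hf : f ∈ T) : E m * f ∈ T := by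
  refine T_ind (p := fun f => E m * f ∈ T) (by simp) ?_ ?_ ?_ hf
  · intro f g h1 h2; rw [mul_add]; exact T.add_mem h1 h2
  · intro r f h; rw [mul_smul_comm]; exact T.smul_mem _ h
  · intro k l
    rw [mul_left_comm, E_mul]; exact mem_T _ _

theorem deriv_gen (k : ℕ) (l : ℂ) :
    d⁄dX ℂ (X ^ k * E l) = l • (X ^ k * E l) + (k : ℂ) • (X ^ (k - 1) * E l) := by
  rw [Derivation.leibniz, deriv_E, derivative_pow, derivative_X]
  simp only [smul_eq_mul, smul_eq_C_mul, map_natCast]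
  ring

theorem deriv_mem {f : PowerSeries ℂ} (hf : f ∈ T) : d⁄dX ℂ f ∈ T := by
  refine T_ind (p := fun f => d⁄dX ℂ f ∈ T) (by simp) ?_ ?_ ?_ hf
  · intro f g h1 h2; rw [map_add]; exact T.add_mem h1 h2
  · intro r f h; rw [Derivation.map_smul]; exact T.smul_mem _ h
  · intro k l
    rw [deriv_gen]
    exact T.add_mem (T.smul_mem _ (mem_T _ _)) (T.smul_mem _ (mem_T _ _))

theorem exists_prim {f : PowerSeries ℂ} (hf : f ∈ T) : ∃ g ∈ T, d⁄dX ℂ g = f := by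
  refine T_ind (p := fun f => ∃ g ∈ T, d⁄dX ℂ g = f) ⟨0, by simp, by simp⟩ ?_ ?_ ?_ hf
  · rintro f g ⟨f', h1, rfl⟩ ⟨g', h2, rfl⟩
    exact ⟨f' + g', T.add_mem h1 h2, map_add _ _ _⟩
  · rintro r f ⟨f', h1, rfl⟩
    exact ⟨r • f', T.smul_mem _ h1, Derivation.map_smul _ _ _⟩
  · intro k l
    by_cases hl : l = 0
    · subst hl
      refine ⟨((k : ℂ) + 1)⁻¹ • (X ^ (k + 1) * E 0), T.smul_mem _ (mem_T _ _), ?_⟩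
      rw [Derivation.map_smul, deriv_gen]
      have h2 : (k : ℂ) + 1 ≠ 0 := by exact_mod_cast Nat.succ_ne_zero k
      simp [smul_smul, inv_mul_cancel₀ h2]
    · induction k with
      | zero =>
        refine ⟨l⁻¹ • (X ^ 0 * E l), T.smul_mem _ (mem_T _ _), ?_⟩
        rw [Derivation.map_smul, deriv_gen]
        simp [smul_smul, inv_mul_cancel₀ hl]
      | succ k ih =>
        obtain ⟨g, hg, hgd⟩ := ih
        refine ⟨l⁻¹ • (X ^ (k + 1) * E l - ((k : ℂ) + 1) • g),
          T.smul_mem _ (T.sub_mem (mem_T _ _) (T.smul_mem _ hg)), ?_⟩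
        rw [Derivation.map_smul, map_sub, deriv_gen, Derivation.map_smul, hgd]
        simp [smul_smul, inv_mul_cancel₀ hl]

theorem mem_T_of_rational : ∀ (n : ℕ) (q p : Polynomial ℂ) (f : PowerSeries ℂ),
    q.natDegree = n → q.coeff 0 ≠ 0 → (q : PowerSeries ℂ) * L f = p → f ∈ T := by
  intro n
  induction n with
  | zero =>
    intro q p f hq h0 h
    rw [Polynomial.eq_C_of_natDegree_eq_zero hq, Polynomial.coe_C] at h
    have hf : f = ∑ i ∈ Finset.range (p.natDegree + 1), (coeff i f) • (X ^ i * E 0) := by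
      ext m
      simp only [E_zero, mul_one, map_sum, coeff_smul, coeff_X_pow, smul_eq_mul, mul_ite, mul_zero,
        Finset.sum_ite_eq, Finset.mem_range]
      split_ifs with hm
      · rfl
      · have := congrArg (coeff m) h
        rw [coeff_C_mul, coeff_L, Polynomial.coeff_coe,
          Polynomial.coeff_eq_zero_of_natDegree_lt (p := p) (n := m) (by omega)] at this
        simpa [h0, Nat.factorial_ne_zero] using this
    rw [hf]
    exact T.sum_mem fun i _ => T.smul_mem _ (mem_T _ _)
  | succ n ih =>
    intro q p f hq h0 h
    obtain ⟨μ, hμ⟩ := IsAlgClosed.exists_root q (by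
      intro hd
      have := Polynomial.natDegree_eq_zero_iff_degree_le_zero.2 hd.le
      omega)
    obtain ⟨q1, rfl⟩ := Polynomial.dvd_iff_isRoot.2 hμ
    have hq1 : q1 ≠ 0 := by rintro rfl; simp at h0
    rw [Polynomial.natDegree_mul (Polynomial.X_sub_C_ne_zero μ) hq1,
      Polynomial.natDegree_X_sub_C] at hq
    rw [Polynomial.mul_coeff_zero] at h0
    have hμ0 : μ ≠ 0 := by
      rintro rfl; simp at h0
    obtain ⟨f1, hf1⟩ := L_surj ((X - C μ) * L f)
    have hT1 : f1 ∈ T := by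
      refine ih q1 p f1 (by omega) (right_ne_zero_of_mul h0) ?_
      rw [hf1, ← h, Polynomial.coe_mul, Polynomial.coe_sub, Polynomial.coe_X, Polynomial.coe_C]
      ring
    have hd : f - μ • d⁄dX ℂ f = d⁄dX ℂ f1 := by
      ext m
      have := congrArg (coeff (m + 1)) hf1
      rw [sub_mul, map_sub, coeff_succ_X_mul, coeff_C_mul, coeff_L, coeff_L, coeff_L,
        Nat.factorial_succ] at this
      rw [map_sub, coeff_smul, coeff_derivative, coeff_derivative, smul_eq_mul]
      have hm : (m.factorial : ℂ) ≠ 0 := by exact_mod_cast Nat.factorial_ne_zero m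
      apply mul_left_cancel₀ hm
      push_cast at this
      linear_combination -this
    obtain ⟨g, hg, hgd⟩ := exists_prim (E_mul_mem (-μ⁻¹) (deriv_mem hT1))
    have hk : d⁄dX ℂ (E (-μ⁻¹) * f) = d⁄dX ℂ (-(μ⁻¹) • g +
        C (constantCoeff (E (-μ⁻¹) * f + μ⁻¹ • g))) := by
      rw [map_add, derivative_C, Derivation.map_smul, hgd, Derivation.leibniz, deriv_E, ← hd]
      simp only [smul_eq_mul, smul_eq_C_mul, map_neg]
      have : C μ⁻¹ * C μ = (1 : PowerSeries ℂ) := by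
        rw [← map_mul, inv_mul_cancel₀ hμ0, map_one]
      linear_combination (-(E (-μ⁻¹)) * d⁄dX ℂ f) * this
    have hk2 := derivative.ext hk (by simp [smul_eq_C_mul])
    have hf : f = E (μ⁻¹) * (E (-μ⁻¹) * f) := by
      rw [← mul_assoc, E_mul]; simp [E_zero]
    rw [hf, hk2]
    apply E_mul_mem
    refine T.add_mem (T.smul_mem _ hg) ?_
    have := T.smul_mem (constantCoeff (E (-μ⁻¹) * f + μ⁻¹ • g)) (mem_T 0 0)
    simpa [E_zero, smul_eq_C_mul] using this

end EgfAux

/-- If `c̃ = ã + b̃ + (eᵗ - 1)·ã·b̃`, the ordinary generating function of `a` is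
rational and that of `b` is algebraic over ℂ(t), then the ordinary generating
function of `c` is algebraic over ℂ(t). -/
theorem isAlgebraicPS_of_egf_relation (a b c : ℕ → ℂ)
    (h : egf c = egf a + egf b + (expPS - 1) * egf a * egf b)
    (ha : IsRationalPS (PowerSeries.mk a)) (hb : IsAlgebraicPS (PowerSeries.mk b)) :
    IsAlgebraicPS (PowerSeries.mk c) := by
  rw [isAlgebraicPS_iff', ← EgfAux.L_egf] at hb ⊢
  obtain ⟨p, q, hq, hqa⟩ := ha
  rw [← EgfAux.L_egf] at hqa
  have hT := EgfAux.mem_T_of_rational _ q p _ rfl hq hqa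
  have hE : expPS = EgfAux.E 1 := by ext n; simp [expPS, EgfAux.E]
  have hT2 : (expPS - 1) * egf a ∈ EgfAux.T := by
    rw [hE, sub_mul, one_mul]
    exact EgfAux.T.sub_mem (EgfAux.E_mul_mem 1 hT) hT
  have h1 : IsAlgebraic (Polynomial ℂ) (EgfAux.L 1) := by
    have : EgfAux.L 1 = 1 := by
      ext n
      rw [EgfAux.coeff_L, PowerSeries.coeff_one]
      split_ifs with hn <;> simp [hn]
    rw [this]; exact isAlgebraic_one
  rw [h, map_add, map_add]
  refine IsAlgebraic.add (IsAlgebraic.add ?_ hb) (EgfAux.alg_T_mul hT2 hb)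
  simpa using EgfAux.alg_T_mul hT h1
end
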